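/- Let G be a plane graph of girth at least 5 with outer face C, and let P be a path with at most 3 vertices such that V(P) ⊆ V(C). Let L be a list assignment satisfying: (S1) |L(v)| = 3 for every vertex v not incident with C; (S2) 2 ≤ |L(v)| ≤ 3 for every v ∈ V(C) ∖ V(P); (S3) |L(v)| = 1 for every v ∈ V(P), and these single colors form a proper coloring of the subgraph of G induced by V(P); (I) the vertices with lists of size two form an independent set; (Q) if a vertex v with list of size two has two neighbors w1 and w2 in P, then L(v) ≠ L(w1) ∪ L(w2). Then G is L-colorable. -/

import Mathlib

open SimpleGraph

/-- A plane embedding (drawing without crossings) of a simple graph `G`: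
vertices are mapped to distinct points of the plane, each edge to a simple arc
joining the images of its endpoints, such that distinct edges meet only in
common endpoints and arcs pass through no other vertex images. -/
structure PlaneEmbedding {V : Type} (G : SimpleGraph V) : Type where
  pos : V → ℝ × ℝ
  pos_inj : Function.Injective pos
  arc : ∀ ⦃u v : V⦄, G.Adj u v → ℝ → ℝ × ℝ
  arc_continuousOn : ∀ ⦃u v : V⦄ (h : G.Adj u v), ContinuousOn (arc h) (Set.Icc 0 1)
  arc_injOn : ∀ ⦃u v : V⦄ (h : G.Adj u v), Set.InjOn (arc h) (Set.Icc 0 1)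
  arc_zero : ∀ ⦃u v : V⦄ (h : G.Adj u v), arc h 0 = pos u
  arc_one : ∀ ⦃u v : V⦄ (h : G.Adj u v), arc h 1 = pos v
  arc_symm : ∀ ⦃u v : V⦄ (h : G.Adj u v),
    arc h.symm '' Set.Icc 0 1 = arc h '' Set.Icc 0 1
  arc_inter : ∀ ⦃u v x y : V⦄ (h₁ : G.Adj u v) (h₂ : G.Adj x y),
    s(u, v) ≠ s(x, y) →
    (arc h₁ '' Set.Icc 0 1) ∩ (arc h₂ '' Set.Icc 0 1) ⊆ pos '' ({u, v} ∩ {x, y})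
  arc_vertex : ∀ ⦃u v : V⦄ (h : G.Adj u v) (w : V),
    pos w ∈ arc h '' Set.Icc 0 1 → w = u ∨ w = v

/-- The point set of the drawing: all vertex images and all edge arcs. -/
def PlaneEmbedding.drawing {V : Type} {G : SimpleGraph V}
    (emb : PlaneEmbedding G) : Set (ℝ × ℝ) :=
  Set.range emb.pos ∪ ⋃ (u : V) (v : V) (h : G.Adj u v), emb.arc h '' Set.Icc 0 1

/-- The outer (unbounded) face of a plane embedding: points not on the drawing
whose connected component in the complement of the drawing is unbounded. -/
def PlaneEmbedding.outerFace {V : Type} {G : SimpleGraph V}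
    (emb : PlaneEmbedding G) : Set (ℝ × ℝ) :=
  {p | p ∉ emb.drawing ∧ ¬ Bornology.IsBounded (connectedComponentIn emb.drawingᶜ p)}

/-- A vertex is incident with the outer face if its image lies on the closure of
the outer face. -/
def PlaneEmbedding.OuterVertex {V : Type} {G : SimpleGraph V}
    (emb : PlaneEmbedding G) (v : V) : Prop :=
  emb.pos v ∈ closure emb.outerFace

/-- `φ` is a proper `L`-coloring of `G`. -/
def IsLColoring {V : Type} (G : SimpleGraph V) (L : V → Finset ℕ) (φ : V → ℕ) : Prop :=
  (∀ v, φ v ∈ L v) ∧ ∀ ⦃u v : V⦄, G.Adj u v → φ u ≠ φ v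

/-- `G` is `L`-colorable. -/
def LColorable {V : Type} (G : SimpleGraph V) (L : V → Finset ℕ) : Prop :=
  ∃ φ, IsLColoring G L φ

/-- `G` is `k`-choosable. -/
def Choosable {V : Type} (G : SimpleGraph V) (k : ℕ) : Prop :=
  ∀ L : V → Finset ℕ, (∀ v, k ≤ (L v).card) → LColorable G L

/-- Any two distinct cycles of length at most `4` in `G` are at distance at least `d`:
for any two such cycles (distinct as subgraphs, i.e. with different edge sets), every
walk from a vertex of one to a vertex of the other has length at least `d`. -/
def CyclesFarApart {V : Type} [DecidableEq V] (G : SimpleGraph V) (d : ℕ) : Prop :=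
  ∀ ⦃a b : V⦄ (c₁ : G.Walk a a) (c₂ : G.Walk b b),
    c₁.IsCycle → c₂.IsCycle → c₁.length ≤ 4 → c₂.length ≤ 4 →
    c₁.edges.toFinset ≠ c₂.edges.toFinset →
    ∀ x ∈ c₁.support, ∀ y ∈ c₂.support, ∀ p : G.Walk x y, d ≤ p.length

section Topology

open Complex

theorem exp_lift_unique {X : Type*} [TopologicalSpace X] {S : Set X} (hS : IsPreconnected S)
    {f g : X → ℂ} (hf : ContinuousOn f S) (hg : ContinuousOn g S) {k : ℂ}
    (h : ∀ x ∈ S, exp (f x) = k * exp (g x)) {x y : X} (hx : x ∈ S) (hy : y ∈ S) :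
    f x - g x = f y - g y := by
  have h1 : Set.EqOn f (fun z => g z + (f x - g x)) S := by
    have cov := isCoveringMap_exp
    refine cov.isSeparatedMap.eqOn_of_comp_eqOn
      cov.isLocalHomeomorph.isLocallyInjective hS hf (hg.add continuousOn_const) ?_ hx (by ring)
    intro z hz
    apply Subtype.ext
    simp only [Function.comp]
    rw [exp_add, exp_sub, h z hz, h x hx]
    have := exp_ne_zero (g x)
    field_simp
  have := h1 hy
  simp only at this
  rw [this]; ring

theorem exists_log_lift {X : Type*} [TopologicalSpace X] [SimplyConnectedSpace X]
    [LocallyPathConnectedSpace X] {f : X → ℂ} (hf : Continuous f) (h0 : ∀ x, f x ≠ 0) :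
    ∃ l : X → ℂ, Continuous l ∧ ∀ x, exp (l x) = f x := by
  obtain ⟨a⟩ : Nonempty X := inferInstance
  obtain ⟨F, ⟨-, hF⟩, -⟩ := isCoveringMapOn_exp.existsUnique_continuousMap_lifts ⟨f, hf⟩ (a₀ := a)
    (e₀ := log (f a)) (exp_log (h0 a)) (fun x => h0 x)
  exact ⟨F, F.continuous, fun x => congrFun hF x⟩

/-- The class modulo two of `u / (2 π i)` for `u` a multiple of `2 π i`. -/
noncomputable def turns (u : ℂ) : ZMod 2 := if exp (u / 2) = 1 then 0 else 1

theorem exp_half {u : ℂ} (hu : exp u = 1) : exp (u / 2) = 1 ∨ exp (u / 2) = -1 := by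
  have : exp (u / 2) ^ 2 = 1 := by rw [← exp_nat_mul]; rw [← hu]; congr 1; push_cast; ring
  exact sq_eq_one_iff.mp this

theorem turns_add {u v : ℂ} (hu : exp u = 1) (hv : exp v = 1) :
    turns (u + v) = turns u + turns v := by
  unfold turns
  rw [add_div, exp_add]
  have h1 : (-1 : ℂ) ≠ 1 := by norm_num
  have h2 : (1 : ZMod 2) + 1 = 0 := by decide
  rcases exp_half hu with h | h <;> rcases exp_half hv with h' | h' <;> simp [h, h', h1, h2]

theorem turns_zero : turns 0 = 0 := by simp [turns]

theorem turns_neg {u : ℂ} (hu : exp u = 1) : turns (-u) = turns u := by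
  have h := turns_add hu (v := -u) (by rw [exp_neg, hu]; simp)
  rw [add_neg_cancel, turns_zero] at h
  generalize turns u = a at *
  generalize turns (-u) = b at *
  revert a b; decide

theorem turns_sub {u v : ℂ} (hu : exp u = 1) (hv : exp v = 1) :
    turns (u - v) = turns u + turns v := by
  rw [sub_eq_add_neg, turns_add hu (by rw [exp_neg, hv]; simp), turns_neg hv]

theorem turns_four {u v w x : ℂ} (hu : exp u = 1) (hv : exp v = 1) (hw : exp w = 1)
    (hx : exp x = 1) : turns (u - v - w + x) = turns u + turns v + turns w + turns x := by
  have h1 : exp (u - v) = 1 := by rw [exp_sub, hu, hv, div_one]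
  rw [turns_add (by rw [exp_sub, h1, hw, div_one]) hx, turns_sub h1 hw, turns_sub hu hv]

theorem turns_two_pi : turns (2 * Real.pi * I) = 1 := by
  unfold turns
  rw [show (2 * Real.pi * I) / 2 = Real.pi * I by ring, exp_pi_mul_I]
  norm_num

open Classical in
/-- Half the winding of `γ` around `z`, compared with principal logarithms at the ends. -/
noncomputable def swing {a b : ℂ} (γ : Path a b) (z : ℂ) : ZMod 2 :=
  if h : ∃ l : ℝ → ℂ, Continuous l ∧ ∀ t, exp (l t) = γ.extend t - z then
    turns (h.choose 1 - h.choose 0 - (log (b - z) - log (a - z))) else 0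

theorem exp_diff_eq_one {a b : ℂ} {u v z : ℂ} (hu : exp u = a - z) (hv : exp v = b - z) :
    exp (v - u - (log (b - z) - log (a - z))) = 1 := by
  have ha : a - z ≠ 0 := hu ▸ exp_ne_zero _
  have hb : b - z ≠ 0 := hv ▸ exp_ne_zero _
  rw [exp_sub, exp_sub, exp_sub, hu, hv, exp_log ha, exp_log hb]
  field_simp

/-- The winding class may be computed from any continuous logarithm along the path. -/
theorem swing_eq {a b : ℂ} (γ : Path a b) (z : ℂ) {l : ℝ → ℂ} {k : ℂ}
    (hl : ContinuousOn l (Set.Icc 0 1))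
    (he : ∀ t ∈ Set.Icc (0 : ℝ) 1, exp (l t) = k * (γ.extend t - z)) (hz : z ∉ Set.range γ) :
    swing γ z = turns (l 1 - l 0 - (log (b - z) - log (a - z))) := by
  have h0 : ∀ t, γ.extend t - z ≠ 0 := by
    intro t ht
    apply hz
    rw [← Path.extend_range]
    exact ⟨t, sub_eq_zero.mp ht⟩
  have h : ∃ l : ℝ → ℂ, Continuous l ∧ ∀ t, exp (l t) = γ.extend t - z :=
    exists_log_lift (by fun_prop) h0
  rw [swing, dif_pos h]
  have h2 := exp_lift_unique (isPreconnected_Icc) hl h.choose_spec.1.continuousOn (k := k)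
    (fun x hx => by rw [he x hx, h.choose_spec.2]) (Set.left_mem_Icc.2 zero_le_one)
    (Set.right_mem_Icc.2 (zero_le_one (α := ℝ)))
  congr 1
  linear_combination h2

theorem exists_lift (a b : ℂ) (γ : Path a b) {z : ℂ} (hz : z ∉ Set.range γ) :
    ∃ l : ℝ → ℂ, Continuous l ∧ (∀ t, exp (l t) = γ.extend t - z) ∧
      swing γ z = turns (l 1 - l 0 - (log (b - z) - log (a - z))) ∧
      exp (l 1 - l 0 - (log (b - z) - log (a - z))) = 1 := by
  have h0 : ∀ t, γ.extend t - z ≠ 0 := by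
    intro t ht
    apply hz
    rw [← Path.extend_range]
    exact ⟨t, sub_eq_zero.mp ht⟩
  obtain ⟨l, hl, he⟩ := exists_log_lift (f := fun t => γ.extend t - z) (by fun_prop) h0
  refine ⟨l, hl, he, swing_eq γ z (k := 1) hl.continuousOn (by simp [he]) hz, ?_⟩
  apply exp_diff_eq_one
  · rw [he]; simp
  · rw [he]; simp

theorem swing_symm {a b : ℂ} (γ : Path a b) (z : ℂ) : swing γ.symm z = swing γ z := by
  by_cases hz : z ∈ Set.range γ
  · have hmem : ∀ {a b : ℂ} (γ : Path a b), z ∈ Set.range γ → swing γ z = 0 := by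
      rintro a b γ ⟨t, ht⟩
      refine dif_neg ?_
      rintro ⟨l, -, hl⟩
      apply exp_ne_zero (l t)
      rw [hl, Path.extend_extends', ht, sub_self]
    rw [hmem γ hz, hmem γ.symm (by rwa [Path.symm_range])]
  obtain ⟨l, hl, he, h1, h2⟩ := exists_lift a b γ hz
  rw [h1, swing_eq γ.symm z (l := fun t => l (1 - t)) (k := 1), ← turns_neg h2]
  · congr 1; norm_num; ring
  · exact (hl.comp (by fun_prop)).continuousOn
  · intro t ht
    rw [he, Path.extend_symm_apply, one_mul]
  · simpa using hz

/-- The first half of a path. -/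
noncomputable def Path.fstHalf {a b : ℂ} (γ : Path a b) : Path a (γ.extend (1 / 2)) where
  toFun t := γ.extend (t / 2)
  continuous_toFun := by fun_prop
  source' := by simp
  target' := by simp

/-- The second half of a path. -/
noncomputable def Path.sndHalf {a b : ℂ} (γ : Path a b) : Path (γ.extend (1 / 2)) b where
  toFun t := γ.extend (1 / 2 + t / 2)
  continuous_toFun := by fun_prop
  source' := by simp
  target' := by norm_num

theorem Path.fstHalf_extend {a b : ℂ} (γ : Path a b) {t : ℝ} (ht : t ∈ Set.Icc (0:ℝ) 1) :
    γ.fstHalf.extend t = γ.extend (t / 2) := by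
  rw [Path.extend_apply _ ht]; rfl

theorem Path.sndHalf_extend {a b : ℂ} (γ : Path a b) {t : ℝ} (ht : t ∈ Set.Icc (0:ℝ) 1) :
    γ.sndHalf.extend t = γ.extend (1 / 2 + t / 2) := by
  rw [Path.extend_apply _ ht]; rfl

theorem Path.range_fstHalf {a b : ℂ} (γ : Path a b) :
    Set.range γ.fstHalf = γ.extend '' Set.Icc 0 (1 / 2) := by
  ext z; constructor
  · rintro ⟨t, rfl⟩
    exact ⟨t / 2, ⟨by linarith [t.2.1], by linarith [t.2.2]⟩, rfl⟩
  · rintro ⟨t, ht, rfl⟩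
    refine ⟨⟨2 * t, by linarith [ht.1], by linarith [ht.2]⟩, ?_⟩
    change γ.extend (2 * t / 2) = _
    congr 1; ring

theorem Path.range_sndHalf {a b : ℂ} (γ : Path a b) :
    Set.range γ.sndHalf = γ.extend '' Set.Icc (1 / 2) 1 := by
  ext z; constructor
  · rintro ⟨t, rfl⟩
    exact ⟨1 / 2 + t / 2, ⟨by linarith [t.2.1], by linarith [t.2.2]⟩, rfl⟩
  · rintro ⟨t, ht, rfl⟩
    refine ⟨⟨2 * t - 1, by linarith [ht.1], by linarith [ht.2]⟩, ?_⟩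
    change γ.extend (1 / 2 + (2 * t - 1) / 2) = _
    congr 1; ring

theorem swing_halves {a b : ℂ} (γ : Path a b) {z : ℂ} (hz : z ∉ Set.range γ) :
    swing γ z = swing γ.fstHalf z + swing γ.sndHalf z := by
  obtain ⟨l, hl, he, h1, h2⟩ := exists_lift a b γ hz
  have hz' : z ∉ Set.range γ.extend := by rwa [Path.extend_range]
  have e1 : ∀ t ∈ Set.Icc (0 : ℝ) 1, exp (l (t / 2)) = 1 * (γ.fstHalf.extend t - z) :=
    fun t ht => by rw [he, γ.fstHalf_extend ht, one_mul]
  have e2 : ∀ t ∈ Set.Icc (0 : ℝ) 1, exp (l (1 / 2 + t / 2)) = 1 * (γ.sndHalf.extend t - z) :=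
    fun t ht => by rw [he, γ.sndHalf_extend ht, one_mul]
  rw [h1, swing_eq γ.fstHalf z (hl.comp (by fun_prop : Continuous fun t : ℝ => t / 2)).continuousOn
      e1 ?_, swing_eq γ.sndHalf z
      (hl.comp (by fun_prop : Continuous fun t : ℝ => 1 / 2 + t / 2)).continuousOn e2 ?_,
      ← turns_add]
  · congr 1; simp only [Function.comp]; norm_num; ring
  · apply exp_diff_eq_one <;> simp [he]
  · simp only [Function.comp]
    apply exp_diff_eq_one
    · simp [he]
    · rw [he]; norm_num
  · rw [Path.range_sndHalf]; exact fun h => hz' (Set.image_subset_range _ _ h)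
  · rw [Path.range_fstHalf]; exact fun h => hz' (Set.image_subset_range _ _ h)

/-- Comparison of the winding classes around two points with respect to a logarithm of the
ratio of the distances. -/
theorem swing_compare {a b : ℂ} (γ : Path a b) {z z' : ℂ} {A : Set ℂ} {l : ℂ → ℂ}
    (hA : Set.range γ ⊆ A) (hl : ContinuousOn l A) (hz : z ∉ A) (hz' : z' ∉ A)
    (he : ∀ w ∈ A, exp (l w) * (w - z) = w - z') :
    swing γ z' = swing γ z + turns (l a + log (a - z) - log (a - z')) +
      turns (l b + log (b - z) - log (b - z')) := by
  have hA' : ∀ t, γ.extend t ∈ A := fun t => hA (by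
    rw [← Path.extend_range]; exact ⟨t, rfl⟩)
  have ha : a ∈ A := by simpa using hA' 0
  have hb : b ∈ A := by simpa using hA' 1
  obtain ⟨m, hm, hme, h1, h2⟩ := exists_lift a b γ (fun h => hz (hA h))
  have key : ∀ w ∈ A, exp (l w + log (w - z) - log (w - z')) = 1 := by
    intro w hw
    have h3 : w - z ≠ 0 := fun h => hz (by rwa [← sub_eq_zero.mp h])
    have h4 : w - z' ≠ 0 := fun h => hz' (by rwa [← sub_eq_zero.mp h])
    rw [exp_sub, exp_add, exp_log h3, exp_log h4, he w hw, div_self h4]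
  rw [h1, swing_eq γ z' (l := fun t => m t + l (γ.extend t)) (k := 1),
    add_assoc, add_comm, add_comm (turns _) (turns (l b + _ - _)), ← turns_sub (key b hb) (key a ha),
    ← turns_add h2 (by rw [exp_sub, key b hb, key a ha, div_one])]
  · congr 1
    simp
    ring
  · exact (hm.add (hl.comp_continuous (by fun_prop) hA')).continuousOn
  · intro t _
    rw [exp_add, hme, mul_comm, he _ (hA' t), one_mul]
  · exact fun h => hz' (hA h)

theorem swing_of_log {a b : ℂ} (γ : Path a b) {z k : ℂ} {A : Set ℂ} {l : ℂ → ℂ}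
    (hA : Set.range γ ⊆ A) (hl : ContinuousOn l A) (hz : z ∉ A) (hk : k ≠ 0)
    (he : ∀ w ∈ A, exp (l w) = k * (w - z)) :
    swing γ z = turns (l a - log (a - z) - log k) + turns (l b - log (b - z) - log k) := by
  have hA' : ∀ t, γ.extend t ∈ A := fun t => hA (by
    rw [← Path.extend_range]; exact ⟨t, rfl⟩)
  have ha : a ∈ A := by simpa using hA' 0
  have hb : b ∈ A := by simpa using hA' 1
  have key : ∀ w ∈ A, exp (l w - log (w - z) - log k) = 1 := by
    intro w hw
    have h3 : w - z ≠ 0 := fun h => hz (by rwa [← sub_eq_zero.mp h])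
    rw [exp_sub, exp_sub, exp_log h3, exp_log hk, he w hw]
    field_simp
  rw [swing_eq γ z (l := fun t => l (γ.extend t)) (k := k), add_comm, ← turns_sub (key b hb)
    (key a ha)]
  · congr 1
    simp
    ring
  · exact (hl.comp_continuous (by fun_prop) hA').continuousOn
  · intro t _
    exact he _ (hA' t)
  · exact fun h => hz (hA h)

/-- The side of `v` on which `u` lies, with respect to the branch cut of the logarithm. -/
noncomputable def cutSide (u v : ℂ) : ZMod 2 := turns (log (u - v) - log (v - u) - Real.pi * I)

theorem exp_cutSide {u v : ℂ} (h : u ≠ v) : exp (log (u - v) - log (v - u) - Real.pi * I) = 1 := by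
  have h1 : u - v ≠ 0 := sub_ne_zero.mpr h
  have h2 : v - u ≠ 0 := sub_ne_zero.mpr h.symm
  rw [exp_sub, exp_sub, exp_log h1, exp_log h2, exp_pi_mul_I]
  field_simp
  ring

theorem cutSide_add_comm {u v : ℂ} (h : u ≠ v) : cutSide u v + cutSide v u = 1 := by
  rw [cutSide, cutSide, ← turns_add (exp_cutSide h) (exp_cutSide h.symm), ← turns_two_pi,
    ← turns_neg (u := 2 * Real.pi * I) (by rw [exp_eq_one_iff]; exact ⟨1, by simp⟩)]
  congr 1; ring

theorem swing_exchange {a b c d : ℂ} (A : Path a b) (B : Path c d)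
    (h : Disjoint (Set.range A) (Set.range B)) :
    swing A c + swing A d + swing B a + swing B b =
      cutSide a c + cutSide b c + cutSide a d + cutSide b d := by
  rw [← A.extend_range, ← B.extend_range, Set.disjoint_left] at h
  have h0 : ∀ s t, A.extend s ≠ B.extend t := fun s t e => h ⟨s, rfl⟩ ⟨t, e.symm⟩
  obtain ⟨F, hF, hFe⟩ := exists_log_lift (X := ℝ × ℝ) (f := fun p => A.extend p.1 - B.extend p.2)
    (by fun_prop) (fun p => sub_ne_zero.mpr (h0 _ _))
  have hac : a ≠ c := by simpa using h0 0 0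
  have hbc : b ≠ c := by simpa using h0 1 0
  have had : a ≠ d := by simpa using h0 0 1
  have hbd : b ≠ d := by simpa using h0 1 1
  have nA : ∀ t, B.extend t ∉ Set.range A := by
    intro t ht; rw [← A.extend_range] at ht; obtain ⟨s, hs⟩ := ht; exact h0 s t hs
  have nB : ∀ t, A.extend t ∉ Set.range B := by
    intro t ht; rw [← B.extend_range] at ht; obtain ⟨s, hs⟩ := ht; exact h0 t s hs.symm
  have e00 := hFe (0, 0)
  have e01 := hFe (0, 1)
  have e10 := hFe (1, 0)
  have e11 := hFe (1, 1)
  simp only [Path.extend_zero, Path.extend_one] at e00 e01 e10 e11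
  have ex1 := fun {p q : ℝ × ℝ} {x y z : ℂ} => exp_diff_eq_one (a := x) (b := y) (z := z)
    (u := F p) (v := F q)
  have ex2 : ∀ {p q : ℝ × ℝ} {x y z : ℂ}, exp (F p) = z - x → exp (F q) = z - y →
      exp (F q - F p - (log (y - z) - log (x - z))) = 1 := by
    intro p q x y z h1 h2
    have := exp_diff_eq_one (a := x) (b := y) (z := z) (u := F p + Real.pi * I)
      (v := F q + Real.pi * I) (by rw [exp_add, h1, exp_pi_mul_I]; ring)
      (by rw [exp_add, h2, exp_pi_mul_I]; ring)
    rwa [add_sub_add_right_eq_sub] at this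
  rw [swing_eq A c (l := fun t => F (t, 0)) (k := 1) (by fun_prop) (by simp [hFe])
      (by simpa using nA 0),
    swing_eq A d (l := fun t => F (t, 1)) (k := 1) (by fun_prop) (by simp [hFe])
      (by simpa using nA 1),
    swing_eq B a (l := fun t => F (0, t)) (k := -1) (by fun_prop) (by simp [hFe])
      (by simpa using nB 0),
    swing_eq B b (l := fun t => F (1, t)) (k := -1) (by fun_prop) (by simp [hFe])
      (by simpa using nB 1)]
  unfold cutSide
  rw [← turns_four (ex1 e00 e10) (ex1 e01 e11) (ex2 e00 e01) (ex2 e10 e11),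
    ← turns_four (exp_cutSide hac) (exp_cutSide hbc) (exp_cutSide had) (exp_cutSide hbd)]
  congr 1; ring

/-- `A` carries a continuous logarithm of `w - z`. -/
def HasLog (A : Set ℂ) (z : ℂ) : Prop :=
  ∃ l : ℂ → ℂ, ContinuousOn l A ∧ ∀ w ∈ A, exp (l w) = w - z

theorem HasLog.union {A B : Set ℂ} {z p : ℂ} (hA : IsClosed A) (hB : IsClosed B)
    (hAB : A ∩ B ⊆ {p}) (hpA : p ∈ A) (hpB : p ∈ B) (h1 : HasLog A z) (h2 : HasLog B z) :
    HasLog (A ∪ B) z := by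
  classical
  obtain ⟨l, hl, hle⟩ := h1
  obtain ⟨m, hm, hme⟩ := h2
  let f : ℂ → ℂ := fun w => if w ∈ A then l w else m w + (l p - m p)
  have hfA : Set.EqOn f l A := fun w hw => if_pos hw
  have hfB : Set.EqOn f (fun w => m w + (l p - m p)) B := by
    intro w hw
    by_cases h : w ∈ A
    · have : w = p := hAB ⟨h, hw⟩
      subst this
      rw [hfA h]; ring
    · exact if_neg h
  refine ⟨f, ?_, ?_⟩
  · exact (hl.congr hfA).union_of_isClosed ((hm.add continuousOn_const).congr hfB) hA hB
  · rintro w (hw | hw)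
    · rw [hfA hw, hle w hw]
    · rw [hfB hw]
      simp only
      rw [exp_add, exp_sub, hme w hw, hle p hpA, hme p hpB, div_self, mul_one]
      rw [← hme p hpB]; exact exp_ne_zero _

theorem hasLog_range {a b : ℂ} (γ : Path a b) (hγ : Function.Injective γ) {z : ℂ}
    (hz : z ∉ Set.range γ) : HasLog (Set.range γ) z := by
  obtain ⟨l, hl, he, -⟩ := exists_lift a b γ hz
  have hemb := γ.continuous.isClosedEmbedding hγ
  refine ⟨fun w => l (Function.invFun γ w : unitInterval), ?_, ?_⟩
  · rw [continuousOn_iff_continuous_domRestrict]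
    have h2 : Continuous hemb.isEmbedding.toHomeomorph.symm := Homeomorph.continuous _
    refine (hl.comp (continuous_subtype_val.comp h2)).congr ?_
    rintro ⟨w, t, rfl⟩
    have : hemb.isEmbedding.toHomeomorph.symm ⟨γ t, ⟨t, rfl⟩⟩ = t := by
      rw [Homeomorph.symm_apply_eq]; rfl
    simp only [Function.comp, this, Set.domRestrict_apply, Function.leftInverse_invFun hγ t]
  · rintro w ⟨t, rfl⟩
    simp only [Function.leftInverse_invFun hγ t]
    rw [he, Path.extend_extends']

/-- A point at which a compact set carries a continuous logarithm can be joined to infinity in the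
complement of that set. -/
theorem HasLog.exists_far {A : Set ℂ} {z : ℂ} (hA : IsCompact A) (hz : z ∉ A) (h : HasLog A z)
    (R : ℝ) : ∃ z', R < ‖z'‖ ∧ JoinedIn Aᶜ z z' := by
  classical
  have hAo : IsOpen Aᶜ := hA.isClosed.isOpen_compl
  set U := connectedComponentIn Aᶜ z with hU
  have hUo : IsOpen U := hAo.connectedComponentIn
  have hzU : z ∈ U := mem_connectedComponentIn hz
  have hUA : U ⊆ Aᶜ := connectedComponentIn_subset _ _
  by_contra! hcon
  have hbd : ∀ w ∈ U, ‖w‖ ≤ R := by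
    intro w hw
    by_contra! hlt
    refine hcon w hlt ?_
    have : IsConnected U := isConnected_connectedComponentIn_iff.mpr hz
    have hpc := (hUo.isConnected_iff_isPathConnected).mp this
    exact (hpc.joinedIn z hzU w hw).mono hUA
  obtain ⟨l, hl, hle⟩ := h
  obtain ⟨L, hL⟩ := ContinuousMap.exists_restrict_eq hA.isClosed
    ⟨A.domRestrict l, continuousOn_iff_continuous_domRestrict.mp hl⟩
  have hL' : ∀ w ∈ A, L w = l w := fun w hw => by
    have := congrArg (fun f => f ⟨w, hw⟩) hL
    simpa using this
  have hfr : frontier U ⊆ A := by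
    intro w hw
    by_contra hwA
    have hwU : w ∉ U := by rw [hUo.frontier_eq] at hw; exact hw.2
    have hV : IsOpen (connectedComponentIn Aᶜ w) := hAo.connectedComponentIn
    have hwc : w ∈ closure U := frontier_subset_closure hw
    obtain ⟨y, hy1, hy2⟩ := mem_closure_iff.mp hwc _ hV (mem_connectedComponentIn hwA)
    apply hwU
    rw [hU, connectedComponentIn_eq hy2, ← connectedComponentIn_eq hy1]
    exact mem_connectedComponentIn hwA
  let F : ℂ → ℂ := U.piecewise (fun w => exp (L w)) (fun w => w - z)
  have hF : Continuous F := by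
    refine Continuous.piecewise ?_ (by fun_prop) (by fun_prop)
    intro a ha
    rw [hL' a (hfr ha), hle a (hfr ha)]
  have hF0 : ∀ w, F w ≠ 0 := by
    intro w
    by_cases hw : w ∈ U
    · simp only [F, Set.piecewise_eq_of_mem _ _ _ hw]; exact exp_ne_zero _
    · simp only [F, Set.piecewise_eq_of_notMem _ _ _ hw]
      intro h0
      exact hw (by rwa [sub_eq_zero.mp h0])
  obtain ⟨M, hM, hMe⟩ := exists_log_lift hF hF0
  set r : ℝ := |R| + ‖z‖ + 1 with hr
  have hr0 : 0 < r := by positivity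
  have hfar : ∀ θ : ℝ, z + r * exp (θ * I) ∉ U := by
    intro θ hθ
    have h1 := hbd _ hθ
    have h2 : ‖(r : ℂ) * exp (θ * I)‖ = r := by
      rw [norm_mul, norm_exp_ofReal_mul_I, mul_one, norm_real, Real.norm_of_nonneg hr0.le]
    have h3 := norm_sub_le (z + r * exp (θ * I)) z
    rw [add_sub_cancel_left, h2] at h3
    have := le_abs_self R
    linarith
  have key := exp_lift_unique (isPreconnected_univ (α := ℝ))
    (f := fun θ => M (z + r * exp (θ * I))) (g := fun θ => (θ : ℂ) * I) (k := r)
    (by fun_prop) (by fun_prop) (by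
      intro θ _
      simp only [hMe, F]
      rw [Set.piecewise_eq_of_notMem _ _ _ (hfar θ)]
      ring) (Set.mem_univ 0) (Set.mem_univ (2 * Real.pi))
  simp at key
  exact two_pi_I_ne_zero (by linear_combination key)

end Topology

section Drawing
open Complex

/-- The sum over the edges of a walk of the entries `ε g e`. -/
def wsum {V : Type} (ε : Sym2 V → Sym2 V → ZMod 2) {G : SimpleGraph V} {x y : V} (W : G.Walk x y)
    (e : Sym2 V) : ZMod 2 := (W.edges.map (fun g => ε g e)).sum

/-- A drawing in the complex plane, with a middle point on every edge and the winding class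
`eps g e` of every edge `g` around the middle of every edge `e`. -/
structure Drawing {V : Type} (G : SimpleGraph V) where
  pos : V → ℂ
  path : ∀ {u v : V}, G.Adj u v → Path (pos u) (pos v)
  mid : Sym2 V → ℂ
  eps : Sym2 V → Sym2 V → ZMod 2
  inj : ∀ {u v : V} (h : G.Adj u v), Function.Injective (path h)
  inter : ∀ {u v x y : V} (h : G.Adj u v) (h' : G.Adj x y), s(u, v) ≠ s(x, y) →
    ∀ z ∈ Set.range (path h), z ∈ Set.range (path h') →
    ∃ w, (w = u ∨ w = v) ∧ (w = x ∨ w = y) ∧ z = pos w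
  range_symm : ∀ {u v : V} (h : G.Adj u v), Set.range (path h.symm) = Set.range (path h)
  vert : ∀ {u v : V} (h : G.Adj u v) (w : V), pos w ∈ Set.range (path h) → w = u ∨ w = v
  mid_eq : ∀ {u v : V} (h : G.Adj u v), mid s(u, v) = (path h).extend (1 / 2)
  eps_eq : ∀ {u v : V} (h : G.Adj u v) (e : Sym2 V), eps s(u, v) e = swing (path h) (mid e)

namespace Drawing

variable {V : Type} {G : SimpleGraph V} (D : Drawing G)

/-- The restriction of a drawing to a subgraph. -/
def restrict {H : SimpleGraph V} (hle : H ≤ G) : Drawing H where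
  pos := D.pos
  path h := D.path (hle h)
  mid := D.mid
  eps := D.eps
  inj h := D.inj (hle h)
  inter h h' := D.inter (hle h) (hle h')
  range_symm h := D.range_symm (hle h)
  vert h := D.vert (hle h)
  mid_eq h := D.mid_eq (hle h)
  eps_eq h := D.eps_eq (hle h)

/-- The winding class of a walk around a point. -/
noncomputable def wind : ∀ {x y : V}, G.Walk x y → ℂ → ZMod 2
  | _, _, .nil, _ => 0
  | _, _, .cons h p, z => swing (D.path h) z + wind p z

/-- The points covered by the edges of a walk. -/
def im : ∀ {x y : V}, G.Walk x y → Set ℂ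
  | _, _, .nil => ∅
  | _, _, .cons h p => Set.range (D.path h) ∪ im p

theorem wsum_eq {x y : V} (W : G.Walk x y) (e : Sym2 V) :
    wsum D.eps W e = D.wind W (D.mid e) := by
  induction W with
  | nil => rfl
  | cons h p ih =>
    rw [wind, ← ih, ← D.eps_eq h]
    simp [wsum]

theorem isCompact_range {u v : V} (h : G.Adj u v) : IsCompact (Set.range (D.path h)) :=
  _root_.isCompact_range (D.path h).continuous

theorem isCompact_im {x y : V} (W : G.Walk x y) : IsCompact (D.im W) := by
  induction W with
  | nil => exact isCompact_empty
  | cons h p ih => exact (D.isCompact_range h).union ih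

theorem exists_of_mem_im {x y : V} {W : G.Walk x y} {z : ℂ} (hz : z ∈ D.im W) :
    ∃ u v, ∃ h : G.Adj u v, s(u, v) ∈ W.edges ∧ z ∈ Set.range (D.path h) := by
  induction W with
  | nil => exact absurd hz (Set.notMem_empty z)
  | cons h p ih =>
    rcases hz with hz | hz
    · exact ⟨_, _, h, by simp, hz⟩
    · obtain ⟨u, v, h', h1, h2⟩ := ih hz
      exact ⟨u, v, h', by simp [h1], h2⟩

theorem wind_compare {x y : V} (W : G.Walk x y) {z z' : ℂ} {A : Set ℂ} {l : ℂ → ℂ}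
    (hA : D.im W ⊆ A) (hl : ContinuousOn l A) (hz : z ∉ A) (hz' : z' ∉ A)
    (he : ∀ w ∈ A, exp (l w) * (w - z) = w - z') :
    D.wind W z' = D.wind W z +
      turns (l (D.pos x) + log (D.pos x - z) - log (D.pos x - z')) +
      turns (l (D.pos y) + log (D.pos y - z) - log (D.pos y - z')) := by
  induction W with
  | nil => simp [wind, CharTwo.add_self_eq_zero]
  | cons h p ih =>
    rw [wind, wind, swing_compare (D.path h) (Set.subset_union_left.trans hA) hl hz hz' he,
      ih (Set.subset_union_right.trans hA)]
    rename_i u v w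
    have := CharTwo.add_self_eq_zero
      (turns (l (D.pos v) + log (D.pos v - z) - log (D.pos v - z')))
    linear_combination this

theorem wind_of_log {x y : V} (W : G.Walk x y) {z k : ℂ} {A : Set ℂ} {l : ℂ → ℂ}
    (hA : D.im W ⊆ A) (hl : ContinuousOn l A) (hz : z ∉ A) (hk : k ≠ 0)
    (he : ∀ w ∈ A, exp (l w) = k * (w - z)) :
    D.wind W z = turns (l (D.pos x) - log (D.pos x - z) - log k) +
      turns (l (D.pos y) - log (D.pos y - z) - log k) := by
  induction W with
  | nil => simp [wind, CharTwo.add_self_eq_zero]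
  | cons h p ih =>
    rw [wind, swing_of_log (D.path h) (Set.subset_union_left.trans hA) hl hz hk he,
      ih (Set.subset_union_right.trans hA)]
    rename_i u v w
    have := CharTwo.add_self_eq_zero (turns (l (D.pos v) - log (D.pos v - z) - log k))
    linear_combination this

theorem wind_eventually_eq {x : V} (W : G.Walk x x) {z : ℂ} (hz : z ∉ D.im W) :
    ∀ᶠ z' in nhds z, D.wind W z' = D.wind W z := by
  obtain ⟨δ, hδ, hball⟩ := Metric.isOpen_iff.mp (D.isCompact_im W).isClosed.isOpen_compl z hz
  filter_upwards [Metric.ball_mem_nhds z hδ] with z' hz'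
  have hd : ∀ w ∈ D.im W, ‖z - z'‖ < ‖w - z‖ := by
    intro w hw
    by_contra! hlt
    refine (hball : Metric.ball z δ ⊆ _) (a := w) ?_ hw
    rw [Metric.mem_ball, dist_eq_norm] at hz' ⊢
    rw [norm_sub_rev z z'] at hlt
    linarith
  have hne : ∀ w ∈ D.im W, w - z ≠ 0 := fun w hw h0 => hz (by rwa [← sub_eq_zero.mp h0])
  have hne' : ∀ w ∈ D.im W, w - z' ≠ 0 := fun w hw h0 =>
    hball hz' (by rwa [← sub_eq_zero.mp h0])
  rw [D.wind_compare W (z := z) (z' := z') (l := fun w => log ((w - z') / (w - z)))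
    subset_rfl ?_ hz (hball hz') ?_, add_assoc, CharTwo.add_self_eq_zero, add_zero]
  · refine ContinuousOn.clog (ContinuousOn.div (by fun_prop) (by fun_prop) hne) ?_
    intro w hw
    rw [show (w - z') / (w - z) = 1 + (z - z') / (w - z) by
      have := hne w hw
      field_simp; ring]
    apply mem_slitPlane_of_norm_lt_one
    rw [norm_div, div_lt_one (norm_pos_iff.mpr (hne w hw))]
    exact hd w hw
  · intro w hw
    rw [exp_log (div_ne_zero (hne' w hw) (hne w hw)), div_mul_cancel₀ _ (hne w hw)]

theorem wind_const {x : V} (W : G.Walk x x) {S : Set ℂ} (hS : IsPreconnected S)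
    (hd : Disjoint S (D.im W)) {z z' : ℂ} (hz : z ∈ S) (hz' : z' ∈ S) :
    D.wind W z = D.wind W z' := by
  let _ : TopologicalSpace (ZMod 2) := ⊥
  have : DiscreteTopology (ZMod 2) := ⟨rfl⟩
  refine hS.constant (f := D.wind W) ?_ hz hz'
  intro w hw
  apply ContinuousAt.continuousWithinAt
  exact continuousAt_const.congr
    (Filter.EventuallyEq.symm (D.wind_eventually_eq W (Set.disjoint_left.mp hd hw)))

theorem exists_wind_eq_zero {x : V} (W : G.Walk x x) :
    ∃ R, ∀ z : ℂ, R < ‖z‖ → z ∉ D.im W ∧ D.wind W z = 0 := by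
  obtain ⟨R, hR⟩ := (D.isCompact_im W).isBounded.exists_norm_le
  refine ⟨|R|, fun z hz => ?_⟩
  have hlt : ∀ w ∈ D.im W, ‖w‖ < ‖z‖ := fun w hw =>
    ((hR w hw).trans (le_abs_self R)).trans_lt hz
  have hz0 : z ≠ 0 := norm_pos_iff.mp ((abs_nonneg R).trans_lt hz)
  have hzW : z ∉ D.im W := fun h => (hlt z h).false
  refine ⟨hzW, ?_⟩
  have hsl : ∀ w ∈ D.im W, 1 + -(w / z) ∈ slitPlane := by
    intro w hw
    apply mem_slitPlane_of_norm_lt_one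
    rw [norm_neg, norm_div, div_lt_one (norm_pos_iff.mpr hz0)]
    exact hlt w hw
  rw [D.wind_of_log W (z := z) (k := -1 / z) (l := fun w => log (1 + -(w / z))) subset_rfl ?_
    hzW (by simp [hz0]) ?_, CharTwo.add_self_eq_zero]
  · exact ContinuousOn.clog (by fun_prop) hsl
  · intro w hw
    rw [exp_log (slitPlane_ne_zero (hsl w hw))]
    field_simp
    ring

theorem extend_injOn {u v : V} (h : G.Adj u v) :
    Set.InjOn (D.path h).extend (Set.Icc 0 1) := by
  intro s hs t ht hst
  rw [Path.extend_apply _ hs, Path.extend_apply _ ht] at hst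
  exact congrArg Subtype.val (D.inj h hst)

theorem extend_mem_range {u v : V} (h : G.Adj u v) (t : ℝ) :
    (D.path h).extend t ∈ Set.range (D.path h) := by
  rw [← Path.extend_range]; exact ⟨t, rfl⟩

theorem disjoint_half {v a x y : V} (h : G.Adj v a) {W : G.Walk x y} (hv : v ∉ W.support) :
    Disjoint ((D.path h).extend '' Set.Icc 0 (1 / 2)) (D.im W) := by
  rw [Set.disjoint_left]
  rintro _ ⟨t, ht, rfl⟩ hz
  obtain ⟨p, q, h', h1, h2⟩ := D.exists_of_mem_im hz
  have hp := W.fst_mem_support_of_mem_edges h1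
  have hq := W.snd_mem_support_of_mem_edges h1
  have hne : s(v, a) ≠ s(p, q) := by
    intro he
    rw [Sym2.eq_iff] at he
    rcases he with ⟨rfl, -⟩ | ⟨rfl, -⟩ <;> exact hv ‹_›
  obtain ⟨w, hw1, hw2, hw3⟩ := D.inter h h' hne _ (D.extend_mem_range h t) h2
  have hwW : w ∈ W.support := by rcases hw2 with rfl | rfl <;> assumption
  rcases hw1 with rfl | rfl
  · exact hv hwW
  · have : t = 1 := D.extend_injOn h ⟨ht.1, by linarith [ht.2]⟩ ⟨by norm_num, le_rfl⟩
      (by rw [hw3, Path.extend_one])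
    linarith [ht.2]

theorem wind_half {v a x : V} (h : G.Adj v a) {W : G.Walk x x} (hv : v ∉ W.support) :
    D.wind W (D.pos v) = D.wind W (D.mid s(v, a)) := by
  refine D.wind_const W (S := (D.path h).extend '' Set.Icc 0 (1 / 2))
    (isPreconnected_Icc.image _ (by fun_prop)) (D.disjoint_half h hv) ?_ ?_
  · exact ⟨0, by norm_num, by simp⟩
  · exact ⟨1 / 2, by norm_num, (D.mid_eq h).symm⟩

theorem disjoint_interior {u v x y : V} (h : G.Adj u v) {W : G.Walk x y}
    (he : s(u, v) ∉ W.edges) : Disjoint ((D.path h).extend '' Set.Ioo 0 1) (D.im W) := by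
  rw [Set.disjoint_left]
  rintro _ ⟨t, ht, rfl⟩ hz
  obtain ⟨p, q, h', h1, h2⟩ := D.exists_of_mem_im hz
  have hne : s(u, v) ≠ s(p, q) := fun e => he (e ▸ h1)
  obtain ⟨w, hw1, hw2, hw3⟩ := D.inter h h' hne _ (D.extend_mem_range h t) h2
  have ht' : t ∈ Set.Icc (0 : ℝ) 1 := ⟨ht.1.le, ht.2.le⟩
  rcases hw1 with rfl | rfl
  · have : t = 0 := D.extend_injOn h ht' ⟨le_rfl, by norm_num⟩ (by rw [hw3, Path.extend_zero])
    exact ht.1.ne' this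
  · have : t = 1 := D.extend_injOn h ht' ⟨by norm_num, le_rfl⟩ (by rw [hw3, Path.extend_one])
    exact ht.2.ne this

theorem wind_interior {u v x : V} (h : G.Adj u v) {W : G.Walk x x}
    (he : s(u, v) ∉ W.edges) {t : ℝ} (ht : t ∈ Set.Ioo (0 : ℝ) 1) :
    D.wind W ((D.path h).extend t) = D.wind W (D.mid s(u, v)) := by
  refine D.wind_const W (S := (D.path h).extend '' Set.Ioo 0 1)
    (isPreconnected_Ioo.image _ (by fun_prop)) (D.disjoint_interior h he) ⟨t, ht, rfl⟩
    ⟨1 / 2, by norm_num, (D.mid_eq h).symm⟩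

theorem swing_exchange_walk {a b : ℂ} (A : Path a b) {x y : V} (T : G.Walk x y)
    (hd : Disjoint (Set.range A) (D.im T)) :
    swing A (D.pos x) + swing A (D.pos y) + D.wind T a + D.wind T b =
      cutSide a (D.pos x) + cutSide b (D.pos x) + cutSide a (D.pos y) + cutSide b (D.pos y) := by
  induction T with
  | nil =>
    simp only [wind]
    linear_combination CharTwo.add_self_eq_zero (swing A (D.pos _)) -
      CharTwo.add_self_eq_zero (cutSide a (D.pos _)) - CharTwo.add_self_eq_zero (cutSide b (D.pos _))
  | cons h p ih =>
    rename_i u v w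
    have h1 := ih (hd.mono_right Set.subset_union_right)
    have h2 := swing_exchange A (D.path h) (hd.mono_right Set.subset_union_left)
    simp only [wind]
    linear_combination h1 + h2 - CharTwo.add_self_eq_zero (swing A (D.pos v)) +
      CharTwo.add_self_eq_zero (cutSide a (D.pos v)) + CharTwo.add_self_eq_zero (cutSide b (D.pos v))

theorem theta_pair {x y v w : V} (hv : G.Adj x v) (hw : G.Adj x w) (hvw : v ≠ w)
    (T : G.Walk w y) (hx : x ∉ T.support) :
    swing (D.path hv).fstHalf (D.mid s(x, w)) + swing (D.path hv).fstHalf (D.pos y) +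
      (swing (D.path hw).sndHalf (D.pos x) + D.wind T (D.pos x)) +
      (swing (D.path hw).sndHalf (D.mid s(x, v)) + D.wind T (D.mid s(x, v))) =
    cutSide (D.pos x) (D.mid s(x, w)) + cutSide (D.mid s(x, v)) (D.mid s(x, w)) +
      cutSide (D.pos x) (D.pos y) + cutSide (D.mid s(x, v)) (D.pos y) := by
  have h1 := D.swing_exchange_walk (D.path hv).fstHalf T (by
    rw [Path.range_fstHalf]; exact D.disjoint_half hv hx)
  have h2 := swing_exchange (D.path hv).fstHalf (D.path hw).sndHalf (by
    rw [Path.range_fstHalf, Path.range_sndHalf, Set.disjoint_left]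
    rintro z ⟨s, hs, rfl⟩ ⟨t, ht, hst⟩
    have hne : s(x, v) ≠ s(x, w) := by
      intro he
      rw [Sym2.eq_iff] at he
      rcases he with ⟨-, h⟩ | ⟨h, h'⟩
      · exact hvw h
      · exact hvw (h'.trans h)
    obtain ⟨u, hu1, hu2, hu3⟩ := D.inter hv hw hne _ (D.extend_mem_range hv s)
      (by rw [← hst]; exact D.extend_mem_range hw t)
    have hux : u = x := by
      rcases hu1 with h | h
      · exact h
      · rcases hu2 with h' | h'
        · exact h'
        · exact absurd (h.symm.trans h') hvw
    subst hux
    have : t = 0 := D.extend_injOn hw ⟨by linarith [ht.1], ht.2⟩ ⟨le_rfl, by norm_num⟩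
      (by rw [hst, hu3, Path.extend_zero])
    linarith [ht.1])
  rw [D.mid_eq hv, D.mid_eq hw]
  linear_combination h1 + h2 - CharTwo.add_self_eq_zero (swing (D.path hv).fstHalf (D.pos w)) +
      CharTwo.add_self_eq_zero (cutSide (D.pos x) (D.pos w)) +
      CharTwo.add_self_eq_zero (cutSide ((D.path hv).extend (1 / 2)) (D.pos w))

theorem mid_notMem {u v x y : V} (h : G.Adj u v) (h' : G.Adj x y) (hne : s(u, v) ≠ s(x, y)) :
    D.mid s(u, v) ∉ Set.range (D.path h') := by
  intro hm
  have : s(u, v) ∉ (Walk.cons h' .nil).edges := by simpa using hne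
  refine Set.disjoint_left.mp (D.disjoint_interior h this) ⟨1 / 2, by norm_num, (D.mid_eq h).symm⟩
    (Or.inl hm)

theorem wsum_cons {x y v w : V} (hv : G.Adj x v) (hw : G.Adj x w) (hvw : v ≠ w)
    (T : G.Walk w y) :
    wsum D.eps (.cons hw T) s(x, v) = swing (D.path hw).fstHalf (D.mid s(x, v)) +
      (swing (D.path hw).sndHalf (D.mid s(x, v)) + D.wind T (D.mid s(x, v))) := by
  rw [wsum_eq, wind, swing_halves, add_assoc]
  apply D.mid_notMem hv
  intro he
  rw [Sym2.eq_iff] at he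
  rcases he with ⟨-, h⟩ | ⟨h, h'⟩
  · exact hvw h
  · exact hvw (h'.trans h)

theorem mid_ne {u v x y : V} (h : G.Adj u v) (h' : G.Adj x y) (hne : s(u, v) ≠ s(x, y)) :
    D.mid s(u, v) ≠ D.mid s(x, y) := by
  intro he
  apply D.mid_notMem h h' hne
  rw [he, D.mid_eq h']
  exact D.extend_mem_range h' _

theorem theta {x y v₁ v₂ v₃ : V} (h₁ : G.Adj x v₁) (h₂ : G.Adj x v₂) (h₃ : G.Adj x v₃)
    (h12 : v₁ ≠ v₂) (h13 : v₁ ≠ v₃) (h23 : v₂ ≠ v₃) (T₁ : G.Walk v₁ y) (T₂ : G.Walk v₂ y)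
    (T₃ : G.Walk v₃ y) (hx₁ : x ∉ T₁.support) (hx₂ : x ∉ T₂.support) (hx₃ : x ∉ T₃.support) :
    wsum D.eps (.cons h₁ T₁) s(x, v₂) + wsum D.eps (.cons h₁ T₁) s(x, v₃) +
      (wsum D.eps (.cons h₂ T₂) s(x, v₁) + wsum D.eps (.cons h₂ T₂) s(x, v₃)) +
      (wsum D.eps (.cons h₃ T₃) s(x, v₁) + wsum D.eps (.cons h₃ T₃) s(x, v₂)) = 1 := by
  have hne : ∀ {v w : V}, v ≠ w → s(x, v) ≠ s(x, w) := by
    intro v w hvw he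
    rw [Sym2.eq_iff] at he
    rcases he with ⟨-, h⟩ | ⟨h, h'⟩
    · exact hvw h
    · exact hvw (h'.trans h)
  have p12 := D.theta_pair h₁ h₂ h12 T₂ hx₂
  have p13 := D.theta_pair h₁ h₃ h13 T₃ hx₃
  have p21 := D.theta_pair h₂ h₁ h12.symm T₁ hx₁
  have p23 := D.theta_pair h₂ h₃ h23 T₃ hx₃
  have p31 := D.theta_pair h₃ h₁ h13.symm T₁ hx₁
  have p32 := D.theta_pair h₃ h₂ h23.symm T₂ hx₂
  have c12 := cutSide_add_comm (D.mid_ne h₁ h₂ (hne h12))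
  have c13 := cutSide_add_comm (D.mid_ne h₁ h₃ (hne h13))
  have c23 := cutSide_add_comm (D.mid_ne h₂ h₃ (hne h23))
  rw [D.wsum_cons h₂ h₁ h12.symm, D.wsum_cons h₃ h₁ h13.symm, D.wsum_cons h₁ h₂ h12,
    D.wsum_cons h₃ h₂ h23.symm, D.wsum_cons h₁ h₃ h13, D.wsum_cons h₂ h₃ h23]
  have two : (2 : ZMod 2) = 0 := by decide
  linear_combination (exp := 1) p12 + p13 + p21 + p23 + p31 + p32 + c12 + c13 + c23 + two *
    (-swing (D.path h₁).fstHalf (D.pos y) - swing (D.path h₂).fstHalf (D.pos y) -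
      swing (D.path h₃).fstHalf (D.pos y) - (swing (D.path h₁).sndHalf (D.pos x) +
      D.wind T₁ (D.pos x)) - (swing (D.path h₂).sndHalf (D.pos x) + D.wind T₂ (D.pos x)) -
      (swing (D.path h₃).sndHalf (D.pos x) + D.wind T₃ (D.pos x)) +
      cutSide (D.pos x) (D.mid s(x, v₁)) + cutSide (D.pos x) (D.mid s(x, v₂)) +
      cutSide (D.pos x) (D.mid s(x, v₃)) + 3 * cutSide (D.pos x) (D.pos y) +
      cutSide (D.mid s(x, v₁)) (D.pos y) + cutSide (D.mid s(x, v₂)) (D.pos y) +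
      cutSide (D.mid s(x, v₃)) (D.pos y) + 1)

end Drawing

/-- The combinatorial consequences of planarity of `G`, for winding classes `ε`. -/
structure PlanarAt {V : Type} (ε : Sym2 V → Sym2 V → ZMod 2) (G : SimpleGraph V) : Prop where
  star : ∀ {x : V} (W : G.Walk x x) {v a b : V}, v ∉ W.support → G.Adj v a → G.Adj v b →
    wsum ε W s(v, a) = wsum ε W s(v, b)
  theta : ∀ {x y v₁ v₂ v₃ : V} (h₁ : G.Adj x v₁) (h₂ : G.Adj x v₂) (h₃ : G.Adj x v₃), v₁ ≠ v₂ →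
    v₁ ≠ v₃ → v₂ ≠ v₃ → ∀ (T₁ : G.Walk v₁ y) (T₂ : G.Walk v₂ y) (T₃ : G.Walk v₃ y),
    x ∉ T₁.support → x ∉ T₂.support → x ∉ T₃.support →
    wsum ε (.cons h₁ T₁) s(x, v₂) + wsum ε (.cons h₁ T₁) s(x, v₃) +
      (wsum ε (.cons h₂ T₂) s(x, v₁) + wsum ε (.cons h₂ T₂) s(x, v₃)) +
      (wsum ε (.cons h₃ T₃) s(x, v₁) + wsum ε (.cons h₃ T₃) s(x, v₂)) = 1
  extreme : ∀ {u v : V}, G.Adj u v → ∃ e ∈ G.edgeSet, ∀ {x : V} (W : G.Walk x x), e ∉ W.edges →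
    wsum ε W e = 0
  jordan : ∀ {u v : V} (h : G.Adj u v) (p : G.Walk v u), p.IsPath → s(u, v) ∉ p.edges →
    (∀ g ∈ G.edgeSet, g ∉ (Walk.cons h p).edges → wsum ε (.cons h p) g = 1) →
    ∀ {x : V} (W : G.Walk x x), s(u, v) ∉ W.edges → wsum ε W s(u, v) = 0

/-- All subgraphs of `G` satisfy the combinatorial consequences of planarity. -/
def Planar {V : Type} (ε : Sym2 V → Sym2 V → ZMod 2) (G : SimpleGraph V) : Prop :=
  ∀ H ≤ G, PlanarAt ε H

/-- `v` is on the outer face, in terms of winding classes: no closed walk missing `v` winds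
around the edges at `v`. -/
def Outer {V : Type} (ε : Sym2 V → Sym2 V → ZMod 2) (G : SimpleGraph V) (v : V) : Prop :=
  ∀ ⦃x : V⦄ (W : G.Walk x x), v ∉ W.support → ∀ ⦃a : V⦄, G.Adj v a → wsum ε W s(v, a) = 0

namespace Drawing

variable {V : Type} {G : SimpleGraph V} (D : Drawing G)

theorem pos_mem_im {x y v : V} {W : G.Walk x y} (hv : v ∈ W.support) (hW : ¬ W.Nil) :
    D.pos v ∈ D.im W := by
  induction W with
  | nil => simp at hW
  | cons h p ih =>
    rcases (Walk.mem_support_iff _).mp hv with rfl | hv'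
    · exact Or.inl ⟨0, (D.path h).source⟩
    · by_cases hp : p.Nil
      · obtain rfl := hp.eq
        rw [← Walk.eq_nil_iff_nil] at hp
        subst hp
        simp at hv'
        subst hv'
        exact Or.inl ⟨1, (D.path h).target⟩
      · exact Or.inr (ih (by simpa using hv') hp)

theorem range_subset_im {x y u v : V} {W : G.Walk x y} (h : G.Adj u v) (he : s(u, v) ∈ W.edges) :
    Set.range (D.path h) ⊆ D.im W := by
  induction W with
  | nil => simp at he
  | cons h' p ih =>
    rw [Walk.edges_cons, List.mem_cons] at he
    rcases he with he | he
    · rw [Sym2.eq_iff] at he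
      rcases he with ⟨rfl, rfl⟩ | ⟨rfl, rfl⟩
      · exact Set.subset_union_left
      · rw [← D.range_symm]; exact Set.subset_union_left
    · exact (ih he).trans Set.subset_union_right

theorem hasLog_im {x y : V} {p : G.Walk x y} (hp : p.IsPath) {z : ℂ} (hz : z ∉ D.im p) :
    HasLog (D.im p) z := by
  induction p with
  | nil => exact ⟨0, by simp [im], by simp [im]⟩
  | cons h p ih =>
    rename_i u v w
    have h1 := hasLog_range (D.path h) (D.inj h) (fun hh => hz (Or.inl hh))
    by_cases hn : p.Nil
    · obtain rfl := hn.eq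
      rw [← Walk.eq_nil_iff_nil] at hn
      subst hn
      simpa [im] using h1
    · rw [Walk.cons_isPath_iff] at hp
      refine h1.union (p := D.pos v) (D.isCompact_range h).isClosed (D.isCompact_im p).isClosed ?_
        ⟨1, (D.path h).target⟩ (D.pos_mem_im p.start_mem_support hn)
        (ih hp.1 (fun hh => hz (Or.inr hh)))
      rintro q ⟨hq1, hq2⟩
      obtain ⟨a, b, h', hab, hq3⟩ := D.exists_of_mem_im hq2
      have ha := p.fst_mem_support_of_mem_edges hab
      have hb := p.snd_mem_support_of_mem_edges hab
      have hne : s(u, v) ≠ s(a, b) := by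
        intro he
        rw [Sym2.eq_iff] at he
        rcases he with ⟨rfl, -⟩ | ⟨rfl, -⟩ <;> exact hp.2 ‹_›
      obtain ⟨c, hc1, hc2, hc3⟩ := D.inter h h' hne q hq1 hq3
      have hcp : c ∈ p.support := by rcases hc2 with rfl | rfl <;> assumption
      rcases hc1 with rfl | rfl
      · exact absurd hcp hp.2
      · exact hc3

theorem star {x : V} (W : G.Walk x x) {v a b : V} (hv : v ∉ W.support) (ha : G.Adj v a)
    (hb : G.Adj v b) : wsum D.eps W s(v, a) = wsum D.eps W s(v, b) := by
  rw [wsum_eq, wsum_eq, ← D.wind_half ha hv, ← D.wind_half hb hv]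

theorem jordan {u v : V} (h : G.Adj u v) (p : G.Walk v u) (hp : p.IsPath)
    (he : s(u, v) ∉ p.edges)
    (hK : ∀ g ∈ G.edgeSet, g ∉ (Walk.cons h p).edges → wsum D.eps (.cons h p) g = 1)
    {x : V} (W : G.Walk x x) (hW : s(u, v) ∉ W.edges) : wsum D.eps W s(u, v) = 0 := by
  set K := Walk.cons h p
  have hpn : ¬ p.Nil := fun hn => h.ne hn.eq.symm
  set m := D.mid s(u, v) with hm
  have hmA : m ∉ D.im p := by
    refine Set.disjoint_left.mp (D.disjoint_interior h he) ?_
    exact ⟨1 / 2, by norm_num, (D.mid_eq h).symm⟩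
  obtain ⟨R₁, hR₁⟩ := D.exists_wind_eq_zero K
  obtain ⟨R₂, hR₂⟩ := D.exists_wind_eq_zero W
  obtain ⟨z, hz, γ, hγ⟩ := (D.hasLog_im hp hmA).exists_far (D.isCompact_im p) hmA (max R₁ R₂)
  have hz1 := hR₁ z ((le_max_left _ _).trans_lt hz)
  have hz2 := hR₂ z ((le_max_right _ _).trans_lt hz)
  have hTc : IsCompact (γ ⁻¹' Set.range (D.path h)) :=
    ((D.isCompact_range h).isClosed.preimage γ.continuous).isCompact
  obtain ⟨t, ht, htmax⟩ := hTc.exists_isMaxOn (f := id)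
    ⟨0, by rw [Set.mem_preimage, γ.source, hm, D.mid_eq h]; exact D.extend_mem_range h _⟩
    continuousOn_id
  have hlater : ∀ s, t < s → γ s ∉ D.im K := by
    rintro s hs (hs' | hs')
    · exact (lt_irrefl _) (hs.trans_le (htmax hs'))
    · exact hγ s hs'
  obtain ⟨r, hr, hrt⟩ : ∃ r ∈ Set.Ioo (0 : ℝ) 1, (D.path h).extend r = γ t := by
    obtain ⟨r, hr⟩ := ht
    refine ⟨r, ⟨lt_of_le_of_ne r.2.1 ?_, lt_of_le_of_ne r.2.2 ?_⟩, by
      rw [Path.extend_extends', hr]⟩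
    · intro h0
      refine hγ t ?_
      rw [← hr, show r = 0 from Subtype.ext h0.symm, Path.source]
      exact D.pos_mem_im p.end_mem_support hpn
    · intro h0
      refine hγ t ?_
      rw [← hr, show r = 1 from Subtype.ext h0, Path.target]
      exact D.pos_mem_im p.start_mem_support hpn
  have hconn : ∀ s, IsPreconnected (γ '' Set.Icc s 1) :=
    fun s => isPreconnected_Icc.image _ γ.continuous.continuousOn
  have hzero : ∀ s, t < s → D.wind K (γ s) = 0 := by
    intro s hs
    rw [← hz1.2]
    refine D.wind_const K (hconn s) ?_ ⟨s, ⟨le_rfl, unitInterval.le_one'⟩, rfl⟩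
      ⟨1, ⟨unitInterval.le_one', le_rfl⟩, γ.target⟩
    rw [Set.disjoint_left]
    rintro _ ⟨r, hr, rfl⟩
    exact hlater r (hs.trans_le hr.1)
  rw [wsum_eq, ← D.wind_interior h hW hr, hrt, ← hz2.2]
  refine D.wind_const W (hconn t) ?_ ⟨t, ⟨le_rfl, unitInterval.le_one'⟩, rfl⟩
      ⟨1, ⟨unitInterval.le_one', le_rfl⟩, γ.target⟩
  rw [Set.disjoint_left]
  rintro _ ⟨s, hs, rfl⟩ hsW
  rcases hs.1.eq_or_lt with rfl | hts
  · exact Set.disjoint_left.mp (D.disjoint_interior h hW) ⟨r, hr, hrt⟩ hsW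
  have hsK := hlater s hts
  obtain ⟨a, b, h', hab, hs'⟩ := D.exists_of_mem_im hsW
  have habK : s(a, b) ∉ K.edges := fun hh => hsK (D.range_subset_im h' hh hs')
  have hone := hK s(a, b) h' habK
  have h0 := hzero s hts
  have hKn : ¬ K.Nil := Walk.not_nil_cons
  have hend : ∀ {c d : V} (hcd : G.Adj c d), γ s = D.pos c → s(c, d) = s(a, b) → False := by
    intro c d hcd hc he
    have hcK : c ∉ K.support := fun hh => hsK (hc ▸ D.pos_mem_im hh hKn)
    rw [← he, wsum_eq, ← D.wind_half hcd hcK, ← hc, h0] at hone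
    exact zero_ne_one hone
  obtain ⟨q, hq⟩ := hs'
  by_cases hq0 : q = 0
  · exact hend h' (by rw [← hq, hq0, Path.source]) rfl
  by_cases hq1 : q = 1
  · exact hend h'.symm (by rw [← hq, hq1, Path.target]) Sym2.eq_swap
  have hqI : (q : ℝ) ∈ Set.Ioo (0 : ℝ) 1 :=
    ⟨unitInterval.pos_iff_ne_zero.mpr hq0, unitInterval.lt_one_iff_ne_one.mpr hq1⟩
  rw [wsum_eq, ← D.wind_interior h' habK hqI, Path.extend_extends', hq, h0] at hone
  exact zero_ne_one hone

theorem extreme [Finite V] (hpos : Function.Injective D.pos) {u v : V} (h : G.Adj u v) :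
    ∃ e ∈ G.edgeSet, ∀ {x : V} (W : G.Walk x x), e ∉ W.edges → wsum D.eps W e = 0 := by
  set c : ℂ := I * (starRingEnd ℂ) (D.pos u - D.pos v) with hc
  have hne : D.pos u - D.pos v ≠ 0 := sub_ne_zero.mpr (fun hh => h.ne (hpos hh))
  have hc0 : c ≠ 0 := mul_ne_zero I_ne_zero ((map_ne_zero _).mpr hne)
  have hlt : (c * D.pos v).im < (c * D.pos u).im := by
    have h1 : c * D.pos u - c * D.pos v = I * (normSq (D.pos u - D.pos v) : ℂ) := by
      rw [← mul_sub, hc, mul_assoc, mul_comm ((starRingEnd ℂ) _), mul_conj]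
    have h2 := congrArg Complex.im h1
    have h3 : 0 < normSq (D.pos u - D.pos v) := normSq_pos.mpr hne
    rw [sub_im, I_mul_im, ofReal_re] at h2
    linarith
  obtain ⟨y, hy, hyV⟩ := ((Set.Ioo_infinite hlt).sdiff
    (Set.finite_range fun w => (c * D.pos w).im)).nonempty
  set A : Set ℂ := ⋃ (a : V) (b : V) (h : G.Adj a b), Set.range (D.path h) with hA
  have hAc : IsCompact A := isCompact_iUnion fun a => isCompact_iUnion fun b =>
    isCompact_iUnion fun h => D.isCompact_range h
  have hZc : IsCompact (A ∩ {z | (c * z).im = y}) :=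
    hAc.inter_right (isClosed_eq (by fun_prop) continuous_const)
  have hmemA : ∀ {a b : V} (h : G.Adj a b) {z : ℂ}, z ∈ Set.range (D.path h) → z ∈ A := by
    intro a b h z hz
    simp only [hA, Set.mem_iUnion]
    exact ⟨a, b, h, hz⟩
  have hZne : (A ∩ {z | (c * z).im = y}).Nonempty := by
    have hcont : ContinuousOn (fun t => (c * (D.path h.symm).extend t).im) (Set.Icc 0 1) := by
      fun_prop
    obtain ⟨t, -, ht⟩ := intermediate_value_Icc zero_le_one hcont
      (by rw [Path.extend_zero, Path.extend_one]; exact ⟨hy.1.le, hy.2.le⟩ : y ∈ _)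
    exact ⟨_, hmemA h.symm (D.extend_mem_range _ t), ht⟩
  obtain ⟨q, ⟨hqA, hqy⟩, hqmax⟩ := hZc.exists_isMaxOn hZne
    (f := fun z => (c * z).re) (by fun_prop)
  simp only [hA, Set.mem_iUnion] at hqA
  obtain ⟨a, b, hab, r, hr⟩ := hqA
  have hqV : ∀ w, q ≠ D.pos w := by
    rintro w rfl
    exact hyV ⟨w, hqy⟩
  have hrI : (r : ℝ) ∈ Set.Ioo (0 : ℝ) 1 := by
    refine ⟨unitInterval.pos_iff_ne_zero.mpr ?_, unitInterval.lt_one_iff_ne_one.mpr ?_⟩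
    · rintro rfl; exact hqV a (by rw [← hr, Path.source])
    · rintro rfl; exact hqV b (by rw [← hr, Path.target])
  refine ⟨s(a, b), hab, fun {x} W hW => ?_⟩
  obtain ⟨R, hR⟩ := D.exists_wind_eq_zero W
  set g : ℝ → ℂ := fun s => q + s * (starRingEnd ℂ) c with hg
  have hcg : ∀ s, c * g s = c * q + ((s * normSq c : ℝ) : ℂ) := by
    intro s
    have := mul_conj c
    simp only [hg]
    push_cast
    linear_combination (s : ℂ) * this
  have hcn : 0 < ‖c‖ := norm_pos_iff.mpr hc0
  have hfar : ∃ s, 0 ≤ s ∧ R < ‖g s‖ := by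
    refine ⟨(|R| + ‖q‖ + 1) / ‖c‖, by positivity, ?_⟩
    have h1 : ‖((((|R| + ‖q‖ + 1) / ‖c‖ : ℝ) : ℂ) * (starRingEnd ℂ) c)‖ = |R| + ‖q‖ + 1 := by
      rw [norm_mul, norm_real, Real.norm_of_nonneg (by positivity), norm_conj,
        div_mul_cancel₀ _ hcn.ne']
    have h2 := norm_sub_le (g ((|R| + ‖q‖ + 1) / ‖c‖)) q
    simp only [hg, add_sub_cancel_left] at h2
    rw [h1] at h2
    simp only [hg]
    linarith [le_abs_self R]
  obtain ⟨s, hs0, hs⟩ := hfar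
  rw [wsum_eq, ← D.wind_interior hab hW hrI, Path.extend_extends', hr, ← (hR _ hs).2]
  refine D.wind_const W (S := g '' Set.Ici 0) (isPreconnected_Ici.image _ (by fun_prop)) ?_
    ⟨0, by simp, by simp [hg]⟩ ⟨s, hs0, rfl⟩
  rw [Set.disjoint_left]
  rintro _ ⟨s, hs, rfl⟩ hsW
  rcases (Set.mem_Ici.mp hs).eq_or_lt with rfl | hs
  · refine Set.disjoint_left.mp (D.disjoint_interior hab hW) ⟨r, hrI, ?_⟩ hsW
    rw [Path.extend_extends', hr]
    simp [hg]
  · obtain ⟨a', b', h', -, hh⟩ := D.exists_of_mem_im hsW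
    have h1 : (c * g s).im = y := by rw [hcg, add_im, ofReal_im, add_zero]; exact hqy
    have h2 := hqmax (show g s ∈ _ from ⟨hmemA h' hh, h1⟩)
    simp only [Set.mem_ofPred_eq, hcg, add_re, ofReal_re] at h2
    have := mul_pos hs (normSq_pos.mpr hc0)
    linarith

theorem planar [Finite V] (hpos : Function.Injective D.pos) : Planar D.eps G := fun _ hH =>
  { star := (D.restrict hH).star
    theta := (D.restrict hH).theta
    extreme := (D.restrict hH).extreme hpos
    jordan := (D.restrict hH).jordan }

theorem outer {v : V} (hv : ∀ N ∈ nhds (D.pos v), ∃ z ∈ N, ∃ S : Set ℂ, IsPreconnected S ∧ z ∈ S ∧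
    (∀ {a b : V} (h : G.Adj a b), Disjoint S (Set.range (D.path h))) ∧
    ¬ Bornology.IsBounded S) : Outer D.eps G v := by
  intro x W hvW a ha
  have hvim : D.pos v ∉ D.im W :=
    Set.disjoint_left.mp (D.disjoint_half ha hvW) ⟨0, by norm_num, by simp⟩
  obtain ⟨z, hz, S, hS, hzS, hd, hb⟩ := hv _ (D.wind_eventually_eq W hvim)
  obtain ⟨R, hR⟩ := D.exists_wind_eq_zero W
  obtain ⟨z', hz', hlt⟩ : ∃ z' ∈ S, R < ‖z'‖ := by
    by_contra! hcon
    exact hb (isBounded_iff_forall_norm_le.mpr ⟨R, hcon⟩)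
  have hSW : Disjoint S (D.im W) := by
    rw [Set.disjoint_left]
    intro q hq hqW
    obtain ⟨a, b, h, -, hh⟩ := D.exists_of_mem_im hqW
    exact Set.disjoint_left.mp (hd h) hq hh
  rw [wsum_eq, ← D.wind_half ha hvW, ← (hR _ hlt).2, ← D.wind_const W hS hSW hzS hz']
  exact hz.symm

end Drawing

namespace PlaneEmbedding

variable {V : Type} {G : SimpleGraph V} (emb : PlaneEmbedding G)

/-- The linear identification of the plane with the complex numbers. -/
noncomputable def toC : (ℝ × ℝ) ≃L[ℝ] ℂ := equivRealProdCLM.symm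

/-- The arc of an edge as a path in the complex plane. -/
noncomputable def base {u v : V} (h : G.Adj u v) : Path (toC (emb.pos u)) (toC (emb.pos v)) where
  toFun t := toC (emb.arc h t)
  continuous_toFun := toC.continuous.comp (emb.arc_continuousOn h).domRestrict
  source' := by simp [emb.arc_zero]
  target' := by simp [emb.arc_one]

theorem range_base {u v : V} (h : G.Adj u v) :
    Set.range (emb.base h) = toC '' (emb.arc h '' Set.Icc 0 1) := by
  ext z
  constructor
  · rintro ⟨t, rfl⟩; exact ⟨_, ⟨t, t.2, rfl⟩, rfl⟩
  · rintro ⟨_, ⟨t, ht, rfl⟩, rfl⟩; exact ⟨⟨t, ht⟩, rfl⟩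

theorem base_injective {u v : V} (h : G.Adj u v) : Function.Injective (emb.base h) := by
  intro s t hst
  exact Subtype.ext (emb.arc_injOn h s.2 t.2 (toC.injective hst))

open Classical in
/-- The path of an edge, with the same direction chosen up to reversal for both orientations. -/
noncomputable def edgePath {u v : V} (h : G.Adj u v) :
    Path (toC (emb.pos u)) (toC (emb.pos v)) :=
  if s(u, v).out = (u, v) then emb.base h else (emb.base h.symm).symm

open Classical in
/-- The middle point of an edge. -/
noncomputable def edgeMid (e : Sym2 V) : ℂ :=
  if h : G.Adj e.out.1 e.out.2 then (emb.base h).extend (1 / 2) else 0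

open Classical in
/-- The winding class of an edge around the middle point of an edge. -/
noncomputable def edgeEps (g e : Sym2 V) : ZMod 2 :=
  if h : G.Adj g.out.1 g.out.2 then swing (emb.base h) (emb.edgeMid e) else 0

theorem out_cases (u v : V) : s(u, v).out = (u, v) ∨ s(u, v).out = (v, u) := by
  have h : s(s(u, v).out.1, s(u, v).out.2) = s(u, v) := Quot.out_eq s(u, v)
  have := Sym2.eq_iff.mp h
  simpa [Prod.ext_iff] using this

theorem edgeMid_of_out {u v : V} {e : Sym2 V} (h : G.Adj u v) (he : e.out = (u, v)) :
    emb.edgeMid e = (emb.base h).extend (1 / 2) := by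
  unfold edgeMid
  generalize e.out = q at he
  subst he
  exact dif_pos h

theorem edgeEps_of_out {u v : V} {g : Sym2 V} (h : G.Adj u v) (hg : g.out = (u, v)) (e : Sym2 V) :
    emb.edgeEps g e = swing (emb.base h) (emb.edgeMid e) := by
  unfold edgeEps
  generalize g.out = q at hg
  subst hg
  exact dif_pos h

theorem range_edgePath {u v : V} (h : G.Adj u v) :
    Set.range (emb.edgePath h) = toC '' (emb.arc h '' Set.Icc 0 1) := by
  unfold edgePath
  split_ifs
  · exact emb.range_base h
  · rw [Path.symm_range, range_base, emb.arc_symm]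

/-- The drawing of a plane embedding. -/
noncomputable def toDrawing : Drawing G where
  pos v := toC (emb.pos v)
  path h := emb.edgePath h
  mid := emb.edgeMid
  eps := emb.edgeEps
  inj h := by
    unfold edgePath
    split_ifs
    · exact emb.base_injective h
    · exact (emb.base_injective h.symm).comp unitInterval.symm_bijective.injective
  inter h h' hne z hz hz' := by
    rw [range_edgePath] at hz hz'
    obtain ⟨p, hp, rfl⟩ := hz
    obtain ⟨q, hq, hpq⟩ := hz'
    obtain rfl := toC.injective hpq
    obtain ⟨w, ⟨hw, hw'⟩, rfl⟩ := emb.arc_inter h h' hne ⟨hp, hq⟩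
    exact ⟨w, hw, hw', rfl⟩
  range_symm h := by rw [range_edgePath, range_edgePath, emb.arc_symm]
  vert h w hw := by
    rw [range_edgePath] at hw
    obtain ⟨p, hp, hpw⟩ := hw
    obtain rfl := toC.injective hpw
    exact emb.arc_vertex h w hp
  mid_eq {u v} h := by
    unfold edgePath
    split_ifs with ho
    · exact emb.edgeMid_of_out h ho
    · rw [emb.edgeMid_of_out h.symm ((out_cases u v).resolve_left ho), Path.extend_symm_apply]
      norm_num
  eps_eq {u v} h e := by
    unfold edgePath
    split_ifs with ho
    · exact emb.edgeEps_of_out h ho e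
    · rw [emb.edgeEps_of_out h.symm ((out_cases u v).resolve_left ho), swing_symm]

theorem planar [Finite V] : Planar emb.edgeEps G :=
  emb.toDrawing.planar (toC.injective.comp emb.pos_inj)

theorem outer {v : V} (hv : emb.OuterVertex v) : Outer emb.edgeEps G v := by
  refine emb.toDrawing.outer fun N hN => ?_
  obtain ⟨q, hqN, hq, hb⟩ := mem_closure_iff_nhds.mp hv _
    (toC.continuous.continuousAt.preimage_mem_nhds hN)
  refine ⟨toC q, hqN, toC '' connectedComponentIn emb.drawingᶜ q,
    isPreconnected_connectedComponentIn.image _ toC.continuous.continuousOn,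
    ⟨q, mem_connectedComponentIn hq, rfl⟩, ?_, ?_⟩
  · intro a b h
    change Disjoint _ (Set.range (emb.edgePath h))
    rw [range_edgePath, Set.disjoint_image_iff toC.injective, Set.disjoint_left]
    intro z hz hz'
    refine connectedComponentIn_subset _ _ hz (Or.inr ?_)
    simp only [Set.mem_iUnion]
    exact ⟨a, b, h, hz'⟩
  · intro hbd
    apply hb
    have := toC.symm.lipschitz.isBounded_image hbd
    rwa [Set.image_image, show (fun x => toC.symm (toC x)) = id from funext fun x => by simp,
      Set.image_id] at this

end PlaneEmbedding
end Drawing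

section Combinatorial

variable {V : Type} {ε : Sym2 V → Sym2 V → ZMod 2} {G H : SimpleGraph V}

theorem wsum_append {x y z : V} (p : G.Walk x y) (q : G.Walk y z) (e : Sym2 V) :
    wsum ε (p.append q) e = wsum ε p e + wsum ε q e := by
  simp [wsum]

theorem wsum_reverse {x y : V} (p : G.Walk x y) (e : Sym2 V) :
    wsum ε p.reverse e = wsum ε p e := by
  simp [wsum, List.sum_reverse]

theorem wsum_eq_of_perm {x y x' y' : V} {p : G.Walk x y} {q : H.Walk x' y'}
    (h : p.edges.Perm q.edges) (e : Sym2 V) : wsum ε p e = wsum ε q e :=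
  (h.map _).sum_eq

theorem wsum_transfer {x y : V} (p : G.Walk x y) (hp) (e : Sym2 V) :
    wsum ε (p.transfer H hp) e = wsum ε p e := by
  simp [wsum]

/-- A vertex incident with an edge. -/
def Used (G : SimpleGraph V) (v : V) : Prop := ∃ a, G.Adj v a

theorem Used.mono {v : V} (h : H ≤ G) (hv : Used H v) : Used G v :=
  let ⟨a, ha⟩ := hv; ⟨a, h ha⟩

theorem Planar.mono (h : H ≤ G) (hG : Planar ε G) : Planar ε H :=
  fun K hK => hG K (hK.trans h)

theorem Planar.at (hG : Planar ε G) : PlanarAt ε G := hG G le_rfl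

theorem Outer.mono {v : V} (h : H ≤ G) (hv : Outer ε G v) : Outer ε H v := by
  intro x W hW a ha
  have := hv (W.mapLe h) (by simpa using hW) (h ha)
  rwa [wsum_eq_of_perm (q := W) (by simp)] at this

theorem PlanarAt.path_const (hG : PlanarAt ε G) {r : V} (W : G.Walk r r) {x y : V}
    {R : G.Walk x y} (hR : R.IsPath)
    (hW : ∀ v ∈ R.support, v = x ∨ v = y ∨ v ∉ W.support) :
    ∃ c, ∀ e ∈ R.edges, wsum ε W e = c := by
  induction R with
  | nil => exact ⟨0, by simp⟩
  | cons h p ih =>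
    rename_i u v w
    rw [Walk.cons_isPath_iff] at hR
    cases p with
    | nil => exact ⟨wsum ε W s(u, v), by simp⟩
    | cons h' p' =>
      rename_i v'
      obtain ⟨c, hc⟩ := ih hR.1 (fun t ht => by
        rcases hW t (by rw [Walk.support_cons]; exact List.mem_cons_of_mem _ ht) with rfl | h | h
        · exact absurd ht hR.2
        · exact Or.inr (Or.inl h)
        · exact Or.inr (Or.inr h))
      refine ⟨c, fun e he => ?_⟩
      rw [Walk.edges_cons, List.mem_cons] at he
      rcases he with rfl | he
      · rw [← hc s(v, v') (by simp), Sym2.eq_swap]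
        refine hG.star W ?_ h.symm h'
        rcases hW v (by simp) with rfl | rfl | h
        · exact absurd rfl h.ne
        · have := (Walk.cons_isPath_iff _ _).mp hR.1
          exact absurd p'.end_mem_support this.2
        · exact h
      · exact hc e he

/-- Two walks that share no edge and no vertex apart from the ends. -/
structure IntDisjoint {x y : V} (R R' : G.Walk x y) : Prop where
  supp : ∀ v ∈ R.support, v ∈ R'.support → v = x ∨ v = y
  edge : ∀ e ∈ R.edges, e ∉ R'.edges

theorem IntDisjoint.symm {x y : V} {R R' : G.Walk x y} (h : IntDisjoint R R') :
    IntDisjoint R' R :=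
  ⟨fun v h1 h2 => h.supp v h2 h1, fun e h1 h2 => h.edge e h2 h1⟩

theorem IntDisjoint.fst_ne {x y v w : V} {hv : G.Adj x v} {hw : G.Adj x w} {p : G.Walk v y}
    {q : G.Walk w y} (h : IntDisjoint (.cons hv p) (.cons hw q)) : v ≠ w := by
  rintro rfl
  exact h.edge s(x, v) (by simp) (by simp)

theorem PlanarAt.intDisjoint_const (hG : PlanarAt ε G) {x y : V} {A B C : G.Walk x y}
    (hA : A.IsPath) (hB : IntDisjoint A B) (hC : IntDisjoint A C) :
    ∃ c, ∀ e ∈ A.edges, wsum ε B e + wsum ε C e = c := by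
  obtain ⟨c, hc⟩ := hG.path_const (B.append C.reverse) hA (fun v hv => by
    by_cases hx : v = x
    · exact Or.inl hx
    by_cases hy : v = y
    · exact Or.inr (Or.inl hy)
    refine Or.inr (Or.inr fun hv' => ?_)
    rw [Walk.mem_support_append_iff, Walk.support_reverse, List.mem_reverse] at hv'
    rcases hv' with h | h
    · exact (hB.supp v hv h).elim hx hy
    · exact (hC.supp v hv h).elim hx hy)
  refine ⟨c, fun e he => ?_⟩
  have := hc e he
  rwa [wsum_append, wsum_reverse] at this

/-- The winding classes of the three cycles of a theta graph around the respective third paths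
sum up to one. -/
theorem PlanarAt.theta_sum (hG : PlanarAt ε G) {x y : V} (hxy : x ≠ y) {R₁ R₂ R₃ : G.Walk x y}
    (p₁ : R₁.IsPath) (p₂ : R₂.IsPath) (p₃ : R₃.IsPath) (h₁₂ : IntDisjoint R₁ R₂)
    (h₁₃ : IntDisjoint R₁ R₃) (h₂₃ : IntDisjoint R₂ R₃) {e₁ e₂ e₃ : Sym2 V}
    (m₁ : e₁ ∈ R₁.edges) (m₂ : e₂ ∈ R₂.edges) (m₃ : e₃ ∈ R₃.edges) :
    wsum ε R₂ e₁ + wsum ε R₃ e₁ + (wsum ε R₁ e₂ + wsum ε R₃ e₂) +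
      (wsum ε R₁ e₃ + wsum ε R₂ e₃) = 1 := by
  have key : ∀ {A B C : G.Walk x y}, A.IsPath → IntDisjoint A B → IntDisjoint A C →
      ∀ e ∈ A.edges, ∀ e' ∈ A.edges, wsum ε B e + wsum ε C e = wsum ε B e' + wsum ε C e' := by
    intro A B C hA hB hC e he e' he'
    obtain ⟨c, hc⟩ := hG.intDisjoint_const hA hB hC
    rw [hc e he, hc e' he']
  have k₁ := key p₁ h₁₂ h₁₃ e₁ m₁
  have k₂ := key p₂ h₁₂.symm h₂₃ e₂ m₂
  have k₃ := key p₃ h₁₃.symm h₂₃.symm e₃ m₃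
  cases R₁ with
  | nil => exact absurd rfl hxy
  | cons a₁ q₁ =>
  cases R₂ with
  | nil => exact absurd rfl hxy
  | cons a₂ q₂ =>
  cases R₃ with
  | nil => exact absurd rfl hxy
  | cons a₃ q₃ =>
  rw [k₁ _ (by simp [-Walk.edges_eq_nil]; left; rfl), k₂ _ (by simp; left; rfl), k₃ _ (by simp; left; rfl)]
  have t := hG.theta a₁ a₂ a₃ h₁₂.fst_ne h₁₃.fst_ne h₂₃.fst_ne q₁ q₂ q₃
    ((Walk.cons_isPath_iff _ _).mp p₁).2 ((Walk.cons_isPath_iff _ _).mp p₂).2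
    ((Walk.cons_isPath_iff _ _).mp p₃).2
  rw [← t]
  ring

/-- Not all three cycles of a theta graph wind around the respective third path. -/
theorem Planar.theta_not_all (hG : Planar ε G) {x y : V} (hxy : x ≠ y) {R₁ R₂ R₃ : G.Walk x y}
    (h₁ : ∀ e ∈ R₁.edges, wsum ε R₂ e + wsum ε R₃ e = 1)
    (h₂ : ∀ e ∈ R₂.edges, wsum ε R₁ e + wsum ε R₃ e = 1)
    (h₃ : ∀ e ∈ R₃.edges, wsum ε R₁ e + wsum ε R₂ e = 1)
    (h₁₂ : IntDisjoint R₁ R₂) (h₁₃ : IntDisjoint R₁ R₃) (h₂₃ : IntDisjoint R₂ R₃) : False := by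
  set H : SimpleGraph V := fromEdgeSet {e | e ∈ R₁.edges ∨ e ∈ R₂.edges ∨ e ∈ R₃.edges} with hH
  have hmem : ∀ {e}, (e ∈ R₁.edges ∨ e ∈ R₂.edges ∨ e ∈ R₃.edges) ↔ e ∈ H.edgeSet := by
    intro e
    rw [hH, edgeSet_fromEdgeSet]
    refine ⟨fun h => ⟨h, fun hd => ?_⟩, fun h => h.1⟩
    have : e ∈ G.edgeSet := by
      rcases h with h | h | h <;> exact Walk.edges_subset_edgeSet _ h
    exact G.not_isDiag_of_mem_edgeSet this hd
  have hle : H ≤ G := by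
    rw [← edgeSet_subset_edgeSet]
    intro e he
    rcases hmem.mpr he with h | h | h <;> exact Walk.edges_subset_edgeSet _ h
  have t₁ : ∀ e ∈ R₁.edges, e ∈ H.edgeSet := fun e h => hmem.mp (Or.inl h)
  have t₂ : ∀ e ∈ R₂.edges, e ∈ H.edgeSet := fun e h => hmem.mp (Or.inr (Or.inl h))
  have t₃ : ∀ e ∈ R₃.edges, e ∈ H.edgeSet := fun e h => hmem.mp (Or.inr (Or.inr h))
  obtain ⟨u, v, huv⟩ : ∃ u v, H.Adj u v := by
    cases R₁ with
    | nil => exact absurd rfl hxy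
    | cons h p => exact ⟨_, _, t₁ _ (by simp; left; rfl)⟩
  obtain ⟨e, he, hW⟩ := (hG H hle).extreme huv
  have key : ∀ {A B : G.Walk x y} (hA : ∀ e ∈ A.edges, e ∈ H.edgeSet)
      (hB : ∀ e ∈ B.edges, e ∈ H.edgeSet), e ∉ A.edges → e ∉ B.edges →
      wsum ε A e + wsum ε B e = 0 := by
    intro A B hA hB hA' hB'
    have := hW ((A.transfer H hA).append (B.transfer H hB).reverse) (by simp [hA', hB'])
    rwa [wsum_append, wsum_reverse, wsum_transfer, wsum_transfer] at this
  rcases hmem.mpr he with h | h | h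
  · have := key t₂ t₃ (h₁₂.edge e h) (h₁₃.edge e h)
    rw [h₁ e h] at this; exact one_ne_zero this
  · have := key t₁ t₃ (h₁₂.symm.edge e h) (h₂₃.edge e h)
    rw [h₂ e h] at this; exact one_ne_zero this
  · have := key t₁ t₂ (h₁₃.symm.edge e h) (h₂₃.symm.edge e h)
    rw [h₃ e h] at this; exact one_ne_zero this

/-- `G` is not a union of two nonempty graphs that share at most one vertex. -/
def NoSep (G : SimpleGraph V) : Prop :=
  ∀ G₁ G₂ : SimpleGraph V, G₁ ⊔ G₂ = G →
    (∀ u v, Used G₁ u → Used G₂ u → Used G₁ v → Used G₂ v → u = v) → G₁ = ⊥ ∨ G₂ = ⊥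

/-- The subgraph of the edges that satisfy `p`. -/
def sub (G : SimpleGraph V) (p : Sym2 V → Prop) : SimpleGraph V where
  Adj u v := G.Adj u v ∧ p s(u, v)
  symm := ⟨fun u v h => ⟨h.1.symm, by rw [Sym2.eq_swap]; exact h.2⟩⟩
  loopless := ⟨fun u h => h.1.ne rfl⟩

theorem sub_le (p : Sym2 V → Prop) : sub G p ≤ G := fun _ _ h => h.1

/-- A path leaving the vertex set `S`, starting with a given edge that is not an edge of `S`. -/
theorem NoSep.bridge (hG : PlanarAt ε G) (hN : NoSep G) (S : Set V) {a b x y : V}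
    (hab : G.Adj a b) (hxy : G.Adj x y) (hx : x ∈ S) (hy : y ∈ S) :
    ∃ q₀ q₁, ∃ Q : G.Walk q₀ q₁, q₀ ∈ S ∧ q₁ ∈ S ∧ q₀ ≠ q₁ ∧ Q.IsPath ∧
      (∀ v ∈ Q.support, v ∈ S → v = q₀ ∨ v = q₁) ∧
      (∀ e ∈ Q.edges, e = s(a, b) ∨ ∃ t ∈ e, t ∉ S) ∧
      ∀ {r : V} (W : G.Walk r r), (∀ v ∈ W.support, v ∈ S) →
        ∀ e ∈ Q.edges, wsum ε W e = wsum ε W s(a, b) := by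
  have main : ∀ {a b : V}, G.Adj a b → a ∉ S → ∃ q₀ q₁, ∃ Q : G.Walk q₀ q₁, q₀ ∈ S ∧ q₁ ∈ S ∧
      q₀ ≠ q₁ ∧ Q.IsPath ∧ (∀ v ∈ Q.support, v ∈ S → v = q₀ ∨ v = q₁) ∧
      (∀ e ∈ Q.edges, e = s(a, b) ∨ ∃ t ∈ e, t ∉ S) ∧
      ∀ {r : V} (W : G.Walk r r), (∀ v ∈ W.support, v ∈ S) →
        ∀ e ∈ Q.edges, wsum ε W e = wsum ε W s(a, b) := by
    intro a b hab ha
    set T : Set V := {t | ∃ p : G.Walk a t, ∀ v ∈ p.support, v ∉ S} with hT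
    have haT : a ∈ T := ⟨.nil, by simpa using ha⟩
    have hTS : ∀ t ∈ T, t ∉ S := fun t ⟨p, hp⟩ => hp t p.end_mem_support
    have hstep : ∀ t ∈ T, ∀ u, G.Adj t u → u ∉ S → u ∈ T := by
      rintro t ⟨p, hp⟩ u htu hu
      refine ⟨p.concat htu, fun v hv => ?_⟩
      rw [Walk.support_concat, List.mem_append] at hv
      rcases hv with hv | hv
      · exact hp v hv
      · rw [List.mem_singleton] at hv; exact hv ▸ hu
    have hedge : ∀ {r : V} (W : G.Walk r r), (∀ v ∈ W.support, v ∈ S) → ∀ t ∈ T, ∀ u, G.Adj t u →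
        wsum ε W s(t, u) = wsum ε W s(a, b) := by
      rintro r W hW t ⟨p, hp⟩
      have : ∀ {a' t : V} (p : G.Walk a' t), (∀ v ∈ p.support, v ∉ S) → ∀ b', G.Adj a' b' →
          ∀ u, G.Adj t u → wsum ε W s(t, u) = wsum ε W s(a', b') := by
        intro a' t p
        induction p with
        | nil =>
          intro hp b' hb u hu
          exact hG.star W (fun h => hp _ (by simp) (hW _ h)) hu hb
        | cons h p ih =>
          intro hp b' hb u hu
          rw [ih (fun v hv => hp v (by simp [hv])) _ h.symm u hu, Sym2.eq_swap]
          exact hG.star W (fun h => hp _ (by simp) (hW _ h)) h hb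
      exact this p hp b hab
    have hatt : ∃ q₀ ∈ S, ∃ q₁ ∈ S, q₀ ≠ q₁ ∧ (∃ t ∈ T, G.Adj q₀ t) ∧ ∃ t ∈ T, G.Adj q₁ t := by
      by_contra hcon
      push Not at hcon
      have hsup : (sub G fun e => ∃ t ∈ e, t ∈ T) ⊔ (sub G fun e => ¬ ∃ t ∈ e, t ∈ T) = G := by
        ext u v
        exact ⟨fun h => h.elim (fun h => h.1) (fun h => h.1), fun h =>
          (em _).imp (fun h' => ⟨h, h'⟩) (fun h' => ⟨h, h'⟩)⟩
      have key : ∀ u, Used (sub G fun e => ∃ t ∈ e, t ∈ T) u →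
            Used (sub G fun e => ¬ ∃ t ∈ e, t ∈ T) u → u ∈ S ∧ ∃ t ∈ T, G.Adj u t := by
          rintro u ⟨v, huv, t, ht, htT⟩ ⟨w, huw, hno⟩
          have huT : u ∉ T := fun h => hno ⟨u, by simp, h⟩
          rw [Sym2.mem_iff] at ht
          rcases ht with rfl | rfl
          · exact absurd htT huT
          · refine ⟨?_, t, htT, huv⟩
            by_contra hu
            exact huT (hstep t htT u huv.symm hu)
      refine absurd (hN _ _ hsup ?_) ?_
      · intro u v hu1 hu2 hv1 hv2
        by_contra huv
        obtain ⟨h1, t, h2, h3⟩ := key u hu1 hu2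
        obtain ⟨h4, t', h5, h6⟩ := key v hv1 hv2
        exact hcon u h1 v h4 huv ⟨t, h2, h3⟩ t' h5 h6
      rintro (h | h)
      · have : (sub G fun e => ∃ t ∈ e, t ∈ T).Adj a b := ⟨hab, a, by simp, haT⟩
        rw [h] at this; exact this
      · have : (sub G fun e => ¬ ∃ t ∈ e, t ∈ T).Adj x y := by
          refine ⟨hxy, ?_⟩
          rintro ⟨t, ht, htT⟩
          rw [Sym2.mem_iff] at ht
          rcases ht with rfl | rfl
          · exact hTS _ htT hx
          · exact hTS _ htT hy
        rw [h] at this; exact this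
    classical
    obtain ⟨q₀, h0, q₁, h1, hne, ⟨t₀, ⟨p₀, hp₀⟩, ha₀⟩, t₁, ⟨p₁, hp₁⟩, ha₁⟩ := hatt
    set P := (p₀.reverse.append p₁).bypass with hP
    have hPS : ∀ v ∈ P.support, v ∉ S := by
      intro v hv
      have := Walk.support_bypass_subset_support _ hv
      rw [Walk.mem_support_append_iff, Walk.support_reverse, List.mem_reverse] at this
      rcases this with h | h
      · exact hp₀ v h
      · exact hp₁ v h
    have hPT : ∀ v ∈ P.support, v ∈ T := by
      intro v hv
      have hv' := Walk.support_bypass_subset_support _ hv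
      rw [Walk.mem_support_append_iff, Walk.support_reverse, List.mem_reverse] at hv'
      rcases hv' with h | h
      · exact ⟨p₀.takeUntil v h, fun w hw => hp₀ w (Walk.support_takeUntil_subset_support _ h hw)⟩
      · exact ⟨p₁.takeUntil v h, fun w hw => hp₁ w (Walk.support_takeUntil_subset_support _ h hw)⟩
    have hPp : P.IsPath := Walk.bypass_isPath _
    have hsup : ∀ v ∈ (Walk.cons ha₀ (P.concat ha₁.symm)).support, v = q₀ ∨ v ∈ P.support ∨ v = q₁ := by
      intro v hv
      rwa [Walk.support_cons, List.mem_cons, Walk.support_concat, List.mem_append,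
        List.mem_singleton] at hv
    have hedges : ∀ e ∈ (Walk.cons ha₀ (P.concat ha₁.symm)).edges, ∃ t u, t ∈ T ∧ G.Adj t u ∧
        e = s(t, u) := by
      intro e he
      rw [Walk.edges_cons, List.mem_cons, Walk.edges_concat, List.concat_eq_append,
        List.mem_append,
        List.mem_singleton] at he
      rcases he with rfl | he | rfl
      · exact ⟨t₀, q₀, ⟨p₀, hp₀⟩, ha₀.symm, Sym2.eq_swap⟩
      · induction e with | _ u v =>
        exact ⟨u, v, hPT u (P.fst_mem_support_of_mem_edges he), P.adj_of_mem_edges he, rfl⟩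
      · exact ⟨t₁, q₁, ⟨p₁, hp₁⟩, ha₁.symm, rfl⟩
    refine ⟨q₀, q₁, .cons ha₀ (P.concat ha₁.symm), h0, h1, hne, ?_, ?_, ?_, ?_⟩
    · rw [Walk.cons_isPath_iff]
      refine ⟨hPp.concat (fun h => hPS _ h h1) _, ?_⟩
      rw [Walk.support_concat, List.mem_append, List.mem_singleton]
      rintro (h | h)
      · exact hPS _ h h0
      · exact hne h
    · intro v hv hvS
      rcases hsup v hv with h | h | h
      · exact Or.inl h
      · exact absurd hvS (hPS v h)
      · exact Or.inr h
    · intro e he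
      obtain ⟨t, u, ht, -, rfl⟩ := hedges e he
      exact Or.inr ⟨t, by simp, hTS t ht⟩
    · intro r W hW e he
      obtain ⟨t, u, ht, htu, rfl⟩ := hedges e he
      exact hedge W hW t ht u htu
  by_cases ha : a ∈ S
  · by_cases hb : b ∈ S
    · refine ⟨a, b, hab.toWalk, ha, hb, hab.ne, hab.isPath_toWalk, ?_, ?_, ?_⟩ <;> simp
    · obtain ⟨q₀, q₁, Q, h⟩ := main hab.symm hb
      rw [Sym2.eq_swap] at h
      exact ⟨q₀, q₁, Q, h⟩
  · exact main hab ha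

theorem IntDisjoint.isCycle {x y : V} {R S : G.Walk x y} (hR : R.IsPath) (hS : S.IsPath)
    (hxy : x ≠ y) (h : IntDisjoint R S) : (R.append S.reverse).IsCycle := by
  refine hR.isCycle_append hS.reverse ?_ ?_
  · intro v hv hv'
    have h1 := List.mem_of_mem_tail hv
    have h2 := List.mem_of_mem_tail hv'
    rw [Walk.support_reverse, List.mem_reverse] at h2
    rcases h.supp v h1 h2 with rfl | rfl
    · have := hR.support_nodup
      rw [← Walk.cons_tail_support, List.nodup_cons] at this
      exact this.1 hv
    · have := hS.reverse.support_nodup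
      rw [← Walk.cons_tail_support, List.nodup_cons] at this
      exact this.1 hv'
  · by_contra hcon
    push Not at hcon
    cases R with
    | nil => exact hxy rfl
    | cons a R =>
    cases S with
    | nil => exact hxy rfl
    | cons b S =>
    cases R with
    | cons => simp at hcon
    | nil =>
    cases S with
    | cons => simp at hcon
    | nil => exact h.edge _ (by simp; rfl) (by simp)

/-- Two distinct vertices of a cycle cut it into two paths. -/
theorem exists_cut {r : V} {K : G.Walk r r} (hK : K.IsCycle) {x y : V} (hx : x ∈ K.support)
    (hy : y ∈ K.support) (hxy : x ≠ y) : ∃ R S : G.Walk x y, R.IsPath ∧ S.IsPath ∧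
      IntDisjoint R S ∧ K.edges.Perm (R.edges ++ S.edges) ∧
      ∀ v, v ∈ K.support ↔ v ∈ R.support ∨ v ∈ S.support := by
  classical
  set K' := K.rotate x hx with hK'
  have hc : K'.IsCycle := hK.rotate hx
  have hy' : y ∈ K'.support := by rwa [hK', Walk.mem_support_rotate_iff]
  have hspec := K'.take_spec hy'
  have hp1 : (K'.takeUntil y hy').IsPath := hc.isPath_takeUntil hy'
  have hp2 : (K'.dropUntil y hy').IsPath := by
    rw [← hspec] at hc
    exact hc.isPath_of_append_right (fun h => hxy h.eq)
  refine ⟨K'.takeUntil y hy', (K'.dropUntil y hy').reverse, hp1, hp2.reverse, ?_, ?_, ?_⟩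
  · constructor
    · intro v hv hv'
      rw [Walk.support_reverse, List.mem_reverse] at hv'
      by_contra hcon
      push Not at hcon
      have := hc.support_nodup
      rw [← hspec, Walk.tail_support_append, List.nodup_append'] at this
      rw [Walk.mem_support_iff] at hv hv'
      exact this.2.2 (hv.resolve_left hcon.1) (hv'.resolve_left hcon.2)
    · intro e he he'
      rw [Walk.edges_reverse, List.mem_reverse] at he'
      have := hc.isTrail.edges_nodup
      rw [← hspec, Walk.edges_append, List.nodup_append'] at this
      exact this.2.2 he he'
  · have h1 : K'.edges.Perm K.edges := (K.rotate_edges x hx).perm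
    refine h1.symm.trans ?_
    conv_lhs => rw [← hspec, Walk.edges_append]
    rw [Walk.edges_reverse]
    exact List.Perm.append_left _ (List.reverse_perm _).symm
  · intro v
    rw [← Walk.mem_support_rotate_iff (h := hx), ← hK', Walk.support_reverse, List.mem_reverse,
      ← Walk.mem_support_append_iff, hspec]

theorem wsum_of_perm_append {x y x' y' x'' y'' : V} {K : G.Walk x y} {R : G.Walk x' y'}
    {S : G.Walk x'' y''} (h : K.edges.Perm (R.edges ++ S.edges)) (e : Sym2 V) :
    wsum ε K e = wsum ε R e + wsum ε S e := by
  unfold wsum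
  rw [(h.map _).sum_eq, List.map_append, List.sum_append]

theorem exists_edge {x y : V} (R : G.Walk x y) (hxy : x ≠ y) : ∃ e, e ∈ R.edges := by
  cases R with
  | nil => exact absurd rfl hxy
  | cons h p => exact ⟨_, List.mem_cons_self⟩

theorem exists_edge_at {x y v : V} {R : G.Walk x y} (hxy : x ≠ y) (hv : v ∈ R.support) :
    ∃ a, G.Adj v a ∧ s(v, a) ∈ R.edges := by
  have hn : ¬ R.Nil := fun h => hxy h.eq
  obtain ⟨e, he, hve⟩ := (Walk.mem_support_iff_exists_mem_edges_of_not_nil hn).mp hv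
  obtain ⟨a, rfl⟩ := hve
  exact ⟨a, R.adj_of_mem_edges he, he⟩

theorem eq_one_of_ne_zero {a : ZMod 2} (h : a ≠ 0) : a = 1 := by revert a; decide

theorem path_edges_eq_of_mem {u v : V} {R : G.Walk u v} (hR : R.IsPath) (h : s(u, v) ∈ R.edges) :
    R.edges = [s(u, v)] := by
  cases R with
  | nil => simp at h
  | cons a q =>
    rename_i w
    rw [Walk.cons_isPath_iff] at hR
    rw [Walk.edges_cons, List.mem_cons] at h
    rcases h with h | h
    · rw [Sym2.congr_right] at h
      subst h
      rw [Walk.isPath_iff_nil, ← Walk.eq_nil_iff_nil] at hR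
      rw [hR.1]; simp
    · exact absurd (q.fst_mem_support_of_mem_edges h) hR.2

theorem NoSep.improve (hG : Planar ε G) (hN : NoSep G) {f : Sym2 V}
    (hf : ∀ {x : V} (W : G.Walk x x), f ∉ W.edges → wsum ε W f = 0) {r : V} {K : G.Walk r r}
    (hK : K.IsCycle) (hfK : f ∈ K.edges) {g : Sym2 V} (hg : g ∈ G.edgeSet) (hgK : g ∉ K.edges)
    (hg0 : wsum ε K g = 0) :
    ∃ (r' : V) (K' : G.Walk r' r'), K'.IsCycle ∧ f ∈ K'.edges ∧
      (∀ e ∈ G.edgeSet, e ∈ K.edges ∨ wsum ε K e = 1 → e ∈ K'.edges ∨ wsum ε K' e = 1) ∧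
      ∃ e ∈ G.edgeSet, (e ∈ K'.edges ∨ wsum ε K' e = 1) ∧ ¬ (e ∈ K.edges ∨ wsum ε K e = 1) := by
  induction g with | _ a b =>
  rw [mem_edgeSet] at hg
  have hedgeK : ∀ e ∈ K.edges, ∀ t ∈ e, t ∈ K.support := fun e he t ht =>
    Walk.mem_support_of_mem_edges he ht
  obtain ⟨z, hz, hrz⟩ : ∃ z ∈ K.support, G.Adj r z := by
    cases K with
    | nil => exact absurd hK (Walk.not_isCycle_nil)
    | cons h p => exact ⟨_, by simp, h⟩
  obtain ⟨q₀, q₁, Q, h0, h1, hne, hQp, hQs, hQe, hQW⟩ :=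
    hN.bridge hG.at {v | v ∈ K.support} hg hrz K.start_mem_support hz
  obtain ⟨R₁, R₂, hR₁, hR₂, hdis, hperm, hsupp, hfR⟩ : ∃ R S : G.Walk q₀ q₁, R.IsPath ∧ S.IsPath ∧
      IntDisjoint R S ∧ K.edges.Perm (R.edges ++ S.edges) ∧
      (∀ v, v ∈ K.support ↔ v ∈ R.support ∨ v ∈ S.support) ∧ f ∈ R.edges := by
    obtain ⟨R, S, h1, h2, h3, h4, h5⟩ := exists_cut hK h0 h1 hne
    have := h4.mem_iff.mp hfK
    rw [List.mem_append] at this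
    rcases this with h | h
    · exact ⟨R, S, h1, h2, h3, h4, h5, h⟩
    · exact ⟨S, R, h2, h1, h3.symm, h4.trans List.perm_append_comm, fun v => (h5 v).trans or_comm, h⟩
  have hKsum : ∀ e, wsum ε K e = wsum ε R₁ e + wsum ε R₂ e := wsum_of_perm_append hperm
  have hKmem : ∀ e, e ∈ K.edges ↔ e ∈ R₁.edges ∨ e ∈ R₂.edges := fun e => by
    rw [hperm.mem_iff, List.mem_append]
  have hQ0 : ∀ e ∈ Q.edges, wsum ε K e = 0 := fun e he => by rw [hQW K (fun _ h => h) e he, hg0]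
  have hQK : ∀ e ∈ Q.edges, e ∉ K.edges := by
    intro e he heK
    rcases hQe e he with rfl | ⟨t, hte, ht⟩
    · exact hgK heK
    · exact ht (hedgeK e heK t hte)
  have hd1 : IntDisjoint R₁ Q := ⟨fun v h h' => hQs v h' ((hsupp v).mpr (Or.inl h)),
    fun e h h' => hQK e h' ((hKmem e).mpr (Or.inl h))⟩
  have hd2 : IntDisjoint R₂ Q := ⟨fun v h h' => hQs v h' ((hsupp v).mpr (Or.inr h)),
    fun e h h' => hQK e h' ((hKmem e).mpr (Or.inr h))⟩
  have hpair : ∀ {A B : G.Walk q₀ q₁}, f ∉ A.edges → f ∉ B.edges →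
      wsum ε A f + wsum ε B f = 0 := by
    intro A B hA hB
    have := hf (A.append B.reverse) (by simp [hA, hB])
    rwa [wsum_append, wsum_reverse] at this
  have hR2Q : ∀ e ∈ R₁.edges, wsum ε R₂ e + wsum ε Q e = 0 := by
    obtain ⟨c, hc⟩ := hG.at.intDisjoint_const hR₁ hdis hd1
    intro e he
    rw [hc e he, ← hc f hfR]
    exact hpair (hdis.edge f hfR) (hd1.edge f hfR)
  obtain ⟨e₃, he₃⟩ := exists_edge Q hne
  obtain ⟨e₂, he₂⟩ := exists_edge R₂ hne
  have hR1Q : ∀ e ∈ R₂.edges, wsum ε R₁ e + wsum ε Q e = 1 := by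
    intro e he
    have := hG.at.theta_sum hne hR₁ hR₂ hQp hdis hd1 hd2 hfR he he₃
    rwa [hR2Q f hfR, ← hKsum, hQ0 e₃ he₃, zero_add, add_zero] at this
  refine ⟨q₀, R₁.append Q.reverse, hd1.isCycle hR₁ hQp hne, by simp [hfR], ?_, ?_⟩
  · intro e he hext
    rw [wsum_append, wsum_reverse, Walk.edges_append, List.mem_append, Walk.edges_reverse,
      List.mem_reverse]
    by_contra hcon
    push Not at hcon
    obtain ⟨⟨hn1, hnQ⟩, hs1⟩ := hcon
    have hs0 : wsum ε R₁ e + wsum ε Q e = 0 := by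
      by_contra h; exact hs1 (eq_one_of_ne_zero h)
    have heK : e ∉ K.edges := by
      rw [hKmem]
      rintro (h | h)
      · exact hn1 h
      · exact hs1 (hR1Q e h)
    have hK1 := hext.resolve_left heK
    induction e with | _ c d =>
    obtain ⟨s₀, s₁, S, k0, k1, kne, hSp, hSs, hSe, hSW⟩ :=
      hN.bridge hG.at {v | v ∈ K.support ∨ v ∈ Q.support} he hrz (Or.inl K.start_mem_support)
        (Or.inl hz)
    have hA : ∀ e ∈ S.edges, wsum ε R₁ e + wsum ε R₂ e = 1 := by
      intro e he
      rw [← hKsum, hSW K (fun v hv => Or.inl hv) e he, hK1]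
    have hB : ∀ e ∈ S.edges, wsum ε R₁ e + wsum ε Q e = 0 := by
      intro e he
      have := hSW (R₁.append Q.reverse) (fun v hv => by
        rw [Walk.mem_support_append_iff, Walk.support_reverse, List.mem_reverse] at hv
        exact hv.imp (fun h => (hsupp v).mpr (Or.inl h)) id) e he
      rwa [wsum_append, wsum_reverse, wsum_append, wsum_reverse, hs0] at this
    have hC : ∀ e ∈ S.edges, wsum ε R₂ e + wsum ε Q e = 1 := by
      have : ∀ a b c : ZMod 2, a + b = 1 → a + c = 0 → b + c = 1 := by decide
      exact fun e he => this _ _ _ (hA e he) (hB e he)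
    have hloc : ∀ v a, s(v, a) ∈ S.edges → v ∈ K.support ∨ v ∈ Q.support → v = q₀ ∨ v = q₁ := by
      intro v a hva hv
      by_contra hno
      push Not at hno
      have hadj := S.adj_of_mem_edges hva
      have hpr : ∀ {A B : G.Walk q₀ q₁}, v ∉ A.support → v ∉ B.support → ∀ a', G.Adj v a' →
          wsum ε A s(v, a') + wsum ε B s(v, a') = wsum ε A s(v, a) + wsum ε B s(v, a) := by
        intro A B hA hB a' ha'
        have := hG.at.star (A.append B.reverse) (v := v) (by simp [hA, hB]) ha' hadj
        rwa [wsum_append, wsum_reverse, wsum_append, wsum_reverse] at this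
      have hno' : ¬ (v = q₀ ∨ v = q₁) := by tauto
      rw [hsupp, or_assoc] at hv
      rcases hv with h | h | h
      · obtain ⟨a', ha', hm⟩ := exists_edge_at hne h
        have := hpr (fun h' => hno' (hdis.supp v h h')) (fun h' => hno' (hd1.supp v h h')) a' ha'
        rw [hR2Q _ hm, hC _ hva] at this
        exact zero_ne_one this
      · obtain ⟨a', ha', hm⟩ := exists_edge_at hne h
        have := hpr (fun h' => hno' (hdis.symm.supp v h h')) (fun h' => hno' (hd2.supp v h h'))
          a' ha'
        rw [hR1Q _ hm, hB _ hva] at this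
        exact one_ne_zero this
      · obtain ⟨a', ha', hm⟩ := exists_edge_at hne h
        have := hpr (fun h' => hno' (hd1.symm.supp v h h')) (fun h' => hno' (hd2.symm.supp v h h'))
          a' ha'
        rw [← hKsum, hQ0 _ hm, hA _ hva] at this
        exact zero_ne_one this
    have hs₀ : s₀ = q₀ ∨ s₀ = q₁ := by
      obtain ⟨a, -, ha⟩ := exists_edge_at kne S.start_mem_support
      exact hloc s₀ a ha k0
    have hs₁ : s₁ = q₀ ∨ s₁ = q₁ := by
      obtain ⟨a, -, ha⟩ := exists_edge_at kne S.end_mem_support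
      exact hloc s₁ a ha k1
    have hSK : ∀ e' ∈ S.edges, e' ∉ K.edges ∧ e' ∉ Q.edges := by
      intro e' he'
      rcases hSe e' he' with rfl | ⟨t, hte, ht⟩
      · exact ⟨heK, hnQ⟩
      · exact ⟨fun h => ht (Or.inl (hedgeK e' h t hte)),
          fun h => ht (Or.inr (Walk.mem_support_of_mem_edges h hte))⟩
    obtain ⟨T, hTp, hTs, hTe⟩ : ∃ T : G.Walk q₀ q₁, T.IsPath ∧
        (∀ v ∈ T.support, v ∈ K.support ∨ v ∈ Q.support → v = q₀ ∨ v = q₁) ∧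
        ∀ e, e ∈ T.edges ↔ e ∈ S.edges := by
      rcases hs₀ with rfl | rfl <;> rcases hs₁ with rfl | rfl
      · exact absurd rfl kne
      · exact ⟨S, hSp, hSs, fun _ => Iff.rfl⟩
      · refine ⟨S.reverse, hSp.reverse, ?_, fun e => by simp⟩
        intro v hv hv'
        rw [Walk.support_reverse, List.mem_reverse] at hv
        exact (hSs v hv hv').symm
      · exact absurd rfl kne
    have hT1 : IntDisjoint R₁ T := ⟨fun v h h' => hTs v h' (Or.inl ((hsupp v).mpr (Or.inl h))),
      fun e h h' => (hSK e ((hTe e).mp h')).1 ((hKmem e).mpr (Or.inl h))⟩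
    have hT2 : IntDisjoint R₂ T := ⟨fun v h h' => hTs v h' (Or.inl ((hsupp v).mpr (Or.inr h))),
      fun e h h' => (hSK e ((hTe e).mp h')).1 ((hKmem e).mpr (Or.inr h))⟩
    have hTQ : IntDisjoint Q T := ⟨fun v h h' => hTs v h' (Or.inr h),
      fun e h h' => (hSK e ((hTe e).mp h')).2 h⟩
    obtain ⟨t, ht⟩ := exists_edge T hne
    have ht' := (hTe t).mp ht
    have e1 := hG.at.theta_sum hne hR₂ hQp hTp hd2 hT2 hTQ he₂ he₃ ht
    have e2 := hG.at.theta_sum hne hR₁ hQp hTp hd1 hT1 hTQ hfR he₃ ht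
    rw [hpair (hd1.edge f hfR) (hT1.edge f hfR), hB t ht'] at e2
    have e3 := hQ0 e₃ he₃
    rw [hKsum] at e3
    rw [hC t ht'] at e1
    have e4 : ¬ (wsum ε R₂ e₃ + wsum ε T e₃ = 1) := by
      intro e4
      obtain ⟨c2, hc2⟩ := hG.at.intDisjoint_const hR₂ hd2 hT2
      obtain ⟨c3, hc3⟩ := hG.at.intDisjoint_const hQp hd2.symm hTQ
      have hc3' : c3 = 1 := by rw [← hc3 e₃ he₃, e4]
      have hc2' : c2 = 1 := by
        rw [← hc2 e₂ he₂]
        rw [e4] at e1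
        revert e1; generalize wsum ε Q e₂ + wsum ε T e₂ = a; revert a; decide
      exact hG.theta_not_all hne (fun e he => by rw [hc2 e he, hc2'])
        (fun e he => by rw [hc3 e he, hc3']) (fun e he => hC e ((hTe e).mp he)) hd2 hT2 hTQ
    have : ∀ a b c : ZMod 2, 0 + (a + c) + 0 = 1 → a + b = 0 → b + c = 1 := by decide
    exact e4 (this _ _ _ e2 e3)
  · refine ⟨e₃, Walk.edges_subset_edgeSet _ he₃, Or.inl (by simp [he₃]), ?_⟩
    rintro (h | h)
    · exact hQK _ he₃ h
    · rw [hQ0 _ he₃] at h; exact zero_ne_one h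

/-- The boundary cycle of the outer face. -/
theorem NoSep.exists_boundary [Finite V] (hG : Planar ε G) (hN : NoSep G) {e e' : Sym2 V}
    (he : e ∈ G.edgeSet) (he' : e' ∈ G.edgeSet) (hee : e ≠ e') :
    ∃ (r : V) (K : G.Walk r r), K.IsCycle ∧ ∀ e ∈ G.edgeSet, e ∉ K.edges → wsum ε K e = 1 := by
  obtain ⟨f, hf, hext⟩ : ∃ f ∈ G.edgeSet, ∀ {x : V} (W : G.Walk x x), f ∉ W.edges →
      wsum ε W f = 0 := by
    induction e with | _ a b => exact hG.at.extreme he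
  obtain ⟨g, hg, hgf⟩ : ∃ g ∈ G.edgeSet, g ≠ f := by
    by_cases h : e = f
    · exact ⟨e', he', fun h' => hee (h.trans h'.symm)⟩
    · exact ⟨e, he, h⟩
  set C : Set (Set (Sym2 V)) := {E | ∃ (r : V) (K : G.Walk r r), K.IsCycle ∧ f ∈ K.edges ∧
    E = {e | e ∈ G.edgeSet ∧ (e ∈ K.edges ∨ wsum ε K e = 1)}} with hC
  have hCne : C.Nonempty := by
    induction f with | _ x y =>
    induction g with | _ a b =>
    rw [mem_edgeSet] at hf hg
    obtain ⟨q₀, q₁, Q, h0, h1, hne, hQp, -, hQe, -⟩ :=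
      hN.bridge hG.at {x, y} hg hf (by simp) (by simp)
    have hQf : s(x, y) ∉ Q.edges := by
      intro h
      rcases hQe _ h with h | ⟨t, ht, ht'⟩
      · exact hgf h.symm
      · exact ht' (by simpa using ht)
    have main : ∀ {x y : V} (h : G.Adj x y) (Q : G.Walk x y), Q.IsPath → s(x, y) ∉ Q.edges →
        ∃ (r : V) (K : G.Walk r r), K.IsCycle ∧ s(x, y) ∈ K.edges := by
      intro x y h Q hQ hQf
      refine ⟨_, .cons h Q.reverse, ?_, by simp⟩
      rw [Walk.cons_isCycle_iff]
      exact ⟨hQ.reverse, by simpa using hQf⟩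
    have : ∃ (r : V) (K : G.Walk r r), K.IsCycle ∧ s(x, y) ∈ K.edges := by
      rcases h0 with rfl | rfl <;> rcases h1 with rfl | rfl
      · exact absurd rfl hne
      · exact main hf Q hQp hQf
      · rw [Sym2.eq_swap] at hQf ⊢
        exact main hf.symm Q hQp hQf
      · exact absurd rfl hne
    obtain ⟨r, K, hK, hfK⟩ := this
    exact ⟨_, r, K, hK, hfK, rfl⟩
  obtain ⟨E, ⟨r, K, hK, hfK, rfl⟩, hmax⟩ := C.toFinite.exists_maximal hCne
  refine ⟨r, K, hK, fun g hg hgK => ?_⟩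
  by_contra hg1
  have hg0 : wsum ε K g = 0 := by
    by_contra h; exact hg1 (eq_one_of_ne_zero h)
  obtain ⟨r', K', hK', hfK', hsub, e, heG, he1, he2⟩ := hN.improve hG hext hK hfK hg hgK hg0
  have := hmax ⟨r', K', hK', hfK', rfl⟩ (fun e he => ⟨he.1, hsub e he.1 he.2⟩)
  exact he2 (this ⟨heG, he1⟩).2

/-- If a cycle winds around all other edges, then its edges are on the outer face. -/
theorem PlanarAt.cycle_extreme (hG : PlanarAt ε G) {r : V} {K : G.Walk r r} (hK : K.IsCycle)
    (h : ∀ e ∈ G.edgeSet, e ∉ K.edges → wsum ε K e = 1) {e : Sym2 V} (he : e ∈ K.edges)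
    {x : V} (W : G.Walk x x) (hW : e ∉ W.edges) : wsum ε W e = 0 := by
  induction e with | _ u v =>
  have huv := K.adj_of_mem_edges he
  have main : ∀ R S : G.Walk u v, R.IsPath → S.IsPath → IntDisjoint R S →
      K.edges.Perm (R.edges ++ S.edges) → s(u, v) ∈ R.edges → wsum ε W s(u, v) = 0 := by
    intro R S hR hS hRS hp hm
    rw [path_edges_eq_of_mem hR hm] at hp
    have hp' : K.edges.Perm (Walk.cons huv S.reverse).edges := by
      rw [Walk.edges_cons, Walk.edges_reverse]
      exact hp.trans ((List.reverse_perm _).symm.cons _)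
    refine hG.jordan huv S.reverse hS.reverse (by simpa using hRS.edge _ hm) ?_ W hW
    intro g hg hgK
    rw [← wsum_eq_of_perm hp']
    exact h g hg (fun h => hgK (hp'.mem_iff.mp h))
  obtain ⟨R, S, h1, h2, h3, h4, -⟩ := exists_cut hK (K.fst_mem_support_of_mem_edges he)
    (K.snd_mem_support_of_mem_edges he) huv.ne
  have := h4.mem_iff.mp he
  rw [List.mem_append] at this
  rcases this with h | h
  · exact main R S h1 h2 h3 h4 h
  · exact main S R h2 h1 h3.symm (h4.trans List.perm_append_comm) h

theorem exists_adj_mem_edges {r : V} {K : G.Walk r r} (hK : K.IsCycle) {v : V}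
    (hv : v ∈ K.support) : ∃ a, G.Adj v a ∧ s(v, a) ∈ K.edges := by
  obtain ⟨e, he, hve⟩ := (Walk.mem_support_iff_exists_mem_edges_of_not_nil hK.not_nil).mp hv
  obtain ⟨a, rfl⟩ := hve
  exact ⟨a, K.adj_of_mem_edges he, he⟩

theorem PlanarAt.cycle_outer (hG : PlanarAt ε G) {r : V} {K : G.Walk r r} (hK : K.IsCycle)
    (h : ∀ e ∈ G.edgeSet, e ∉ K.edges → wsum ε K e = 1) {v : V} (hv : v ∈ K.support) :
    Outer ε G v := by
  intro x W hW a ha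
  obtain ⟨b, hb, hm⟩ := exists_adj_mem_edges hK hv
  rw [hG.star W hW ha hb]
  exact hG.cycle_extreme hK h hm W fun h => hW (W.fst_mem_support_of_mem_edges h)

theorem Planar.cycle_outer_sub (hG : Planar ε G) {r : V} {K : G.Walk r r} (hK : K.IsCycle)
    {p : Sym2 V → Prop} (hp : ∀ e ∈ K.edges, p e)
    (h : ∀ e ∈ G.edgeSet, p e → e ∉ K.edges → wsum ε K e = 1) {v : V} (hv : v ∈ K.support) :
    Outer ε (sub G p) v := by
  have hmem : ∀ e ∈ K.edges, e ∈ (sub G p).edgeSet := by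
    intro e he
    induction e with | _ a b => exact ⟨K.adj_of_mem_edges he, hp _ he⟩
  refine (hG _ (sub_le p)).cycle_outer (K := K.transfer _ hmem) (hK.transfer hmem) ?_ (by simpa)
  intro e he heK
  rw [wsum_transfer]
  induction e with | _ a b => exact h _ he.1 he.2 (by simpa using heK)

theorem sup_sub_eq (p q : Sym2 V → Prop) (h : ∀ e ∈ G.edgeSet, p e ∨ q e) :
    sub G p ⊔ sub G q = G := by
  ext u v
  exact ⟨fun h => h.elim And.left And.left, fun h' => (h s(u, v) h').imp (⟨h', ·⟩) (⟨h', ·⟩)⟩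

/-- A cycle separates its inside from its outside. -/
theorem Planar.inside (hG : Planar ε G) {r : V} {K : G.Walk r r} (hK : K.IsCycle) :
    ∃ G₁ G₂ : SimpleGraph V, G₁ ⊔ G₂ = G ∧ (∀ v, Used G₁ v → Used G₂ v → v ∈ K.support) ∧
      (∀ v ∈ K.support, Outer ε G₁ v) ∧ (∀ e ∈ K.edges, e ∈ G₁.edgeSet ∧ e ∈ G₂.edgeSet) ∧
      (∀ e ∈ G.edgeSet, e ∉ K.edges → (wsum ε K e = 1 ↔ e ∈ G₁.edgeSet) ∧
        (wsum ε K e = 1 ↔ e ∉ G₂.edgeSet)) := by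
  refine ⟨sub G fun e => e ∈ K.edges ∨ wsum ε K e = 1, sub G fun e => e ∈ K.edges ∨ wsum ε K e = 0,
    ?_, ?_, ?_, ?_, ?_⟩
  · refine sup_sub_eq _ _ fun e _ => ?_
    by_cases h : wsum ε K e = 0
    · exact Or.inr (Or.inr h)
    · exact Or.inl (Or.inr (eq_one_of_ne_zero h))
  · rintro v ⟨a, ha, ha'⟩ ⟨b, hb, hb'⟩
    by_contra hv
    have h1 := ha'.resolve_left fun h => hv (K.fst_mem_support_of_mem_edges h)
    have h2 := hb'.resolve_left fun h => hv (K.fst_mem_support_of_mem_edges h)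
    rw [hG.at.star K hv ha hb, h2] at h1
    exact zero_ne_one h1
  · intro v hv
    exact hG.cycle_outer_sub hK (fun e he => Or.inl he) (fun e _ h h' => h.resolve_left h') hv
  · intro e he
    induction e with | _ a b =>
    exact ⟨⟨K.adj_of_mem_edges he, Or.inl he⟩, ⟨K.adj_of_mem_edges he, Or.inl he⟩⟩
  · intro e he heK
    induction e with | _ a b =>
    refine ⟨⟨fun h => ⟨he, Or.inr h⟩, fun h => h.2.resolve_left heK⟩, ⟨fun h h' => ?_, fun h => ?_⟩⟩
    · have := h'.2.resolve_left heK
      rw [h] at this; exact one_ne_zero this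
    · by_contra h'
      refine h ⟨he, Or.inr ?_⟩
      by_contra h0
      exact h' (eq_one_of_ne_zero h0)

/-- A path inside the outer cycle splits the graph. -/
theorem Planar.split (hG : Planar ε G) {x y : V} (hxy : x ≠ y) {A B Q : G.Walk x y}
    (hA : A.IsPath) (hB : B.IsPath) (hQ : Q.IsPath) (hAQ : IntDisjoint A Q) (hBQ : IntDisjoint B Q)
    (hAB : IntDisjoint A B)
    (hin : ∀ e ∈ G.edgeSet, e ∉ A.edges → e ∉ B.edges → wsum ε A e + wsum ε B e = 1)
    (hAo : ∀ e ∈ A.edges, ∀ {r : V} (W : G.Walk r r), e ∉ W.edges → wsum ε W e = 0)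
    (hBo : ∀ e ∈ B.edges, ∀ {r : V} (W : G.Walk r r), e ∉ W.edges → wsum ε W e = 0) :
    ∃ G₁ G₂ : SimpleGraph V, G₁ ⊔ G₂ = G ∧ (∀ v, Used G₁ v → Used G₂ v → v ∈ Q.support) ∧
      (∀ e ∈ Q.edges, e ∈ G₁.edgeSet ∧ e ∈ G₂.edgeSet) ∧
      (∀ e ∈ A.edges, e ∈ G₁.edgeSet ∧ e ∉ G₂.edgeSet) ∧
      (∀ e ∈ B.edges, e ∉ G₁.edgeSet ∧ e ∈ G₂.edgeSet) ∧
      (∀ v, v ∈ A.support ∨ v ∈ Q.support → Outer ε G₁ v) ∧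
      (∀ v, v ∈ B.support ∨ v ∈ Q.support → Outer ε G₂ v) := by
  have hadd : ∀ {A : G.Walk x y} (e), wsum ε (A.append Q.reverse) e = wsum ε A e + wsum ε Q e :=
    fun e => by rw [wsum_append, wsum_reverse]
  have hmem : ∀ {A : G.Walk x y} {e}, e ∈ (A.append Q.reverse).edges ↔ e ∈ A.edges ∨ e ∈ Q.edges :=
    fun {A e} => by simp
  have hmems : ∀ {A : G.Walk x y} {v}, v ∈ (A.append Q.reverse).support ↔
      v ∈ A.support ∨ v ∈ Q.support :=
    fun {A v} => by rw [Walk.mem_support_append_iff, Walk.support_reverse, List.mem_reverse]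
  have hA0 : ∀ e ∈ A.edges, wsum ε B e + wsum ε Q e = 0 := fun e he => by
    rw [← hadd]
    exact hAo e he _ (by rw [hmem]; exact fun h => h.elim (hAB.edge e he) (hAQ.edge e he))
  have hB0 : ∀ e ∈ B.edges, wsum ε A e + wsum ε Q e = 0 := fun e he => by
    rw [← hadd]
    exact hBo e he _ (by rw [hmem]; exact fun h => h.elim (hAB.symm.edge e he) (hBQ.edge e he))
  have hex : ∀ a b q : ZMod 2, a + b = 1 → a + q = 1 ∨ b + q = 1 := by decide
  have hex' : ∀ a b q : ZMod 2, a + b = 1 → a + q = 1 → b + q = 1 → False := by decide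
  refine ⟨sub G fun e => (e ∈ A.edges ∨ e ∈ Q.edges) ∨ wsum ε A e + wsum ε Q e = 1,
    sub G fun e => (e ∈ B.edges ∨ e ∈ Q.edges) ∨ wsum ε B e + wsum ε Q e = 1,
    ?_, ?_, ?_, ?_, ?_, ?_, ?_⟩
  · refine sup_sub_eq _ _ fun e he => ?_
    by_cases h1 : e ∈ A.edges
    · exact Or.inl (Or.inl (Or.inl h1))
    by_cases h2 : e ∈ B.edges
    · exact Or.inr (Or.inl (Or.inl h2))
    exact (hex _ _ (wsum ε Q e) (hin e he h1 h2)).imp Or.inr Or.inr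
  · rintro v ⟨a, ha, ha'⟩ ⟨b, hb, hb'⟩
    by_contra hv
    have k1 : v ∉ A.support → ∀ c, G.Adj v c → wsum ε A s(v, c) + wsum ε Q s(v, c) = 1 := by
      intro hvA c hc
      have := hG.at.star (A.append Q.reverse) (v := v) (by rw [hmems]; tauto) hc ha
      rw [hadd, hadd] at this
      rw [this]
      refine ha'.resolve_left ?_
      rintro (h | h)
      · exact hvA (A.fst_mem_support_of_mem_edges h)
      · exact hv (Q.fst_mem_support_of_mem_edges h)
    have k2 : v ∉ B.support → ∀ c, G.Adj v c → wsum ε B s(v, c) + wsum ε Q s(v, c) = 1 := by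
      intro hvA c hc
      have := hG.at.star (B.append Q.reverse) (v := v) (by rw [hmems]; tauto) hc hb
      rw [hadd, hadd] at this
      rw [this]
      refine hb'.resolve_left ?_
      rintro (h | h)
      · exact hvA (B.fst_mem_support_of_mem_edges h)
      · exact hv (Q.fst_mem_support_of_mem_edges h)
    have kAB : v ∈ A.support → v ∈ B.support → False := by
      intro h1 h2
      rcases hAB.supp v h1 h2 with rfl | rfl
      · exact hv Q.start_mem_support
      · exact hv Q.end_mem_support
    by_cases h1 : v ∈ A.support
    · obtain ⟨c, hc, hm⟩ := exists_edge_at hxy h1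
      have := k2 (kAB h1) c hc
      rw [hA0 _ hm] at this; exact zero_ne_one this
    by_cases h2 : v ∈ B.support
    · obtain ⟨c, hc, hm⟩ := exists_edge_at hxy h2
      have := k1 h1 c hc
      rw [hB0 _ hm] at this; exact zero_ne_one this
    exact hex' _ _ _ (hin s(v, a) ha (fun h => h1 (A.fst_mem_support_of_mem_edges h))
      (fun h => h2 (B.fst_mem_support_of_mem_edges h))) (k1 h1 a ha) (k2 h2 a ha)
  · intro e he
    induction e with | _ a b =>
    have := Q.adj_of_mem_edges he
    exact ⟨⟨this, Or.inl (Or.inr he)⟩, ⟨this, Or.inl (Or.inr he)⟩⟩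
  · intro e he
    induction e with | _ a b =>
    refine ⟨⟨A.adj_of_mem_edges he, Or.inl (Or.inl he)⟩, ?_⟩
    rintro ⟨-, (h | h) | h⟩
    · exact hAB.edge _ he h
    · exact hAQ.edge _ he h
    · rw [hA0 _ he] at h; exact zero_ne_one h
  · intro e he
    induction e with | _ a b =>
    refine ⟨?_, ⟨B.adj_of_mem_edges he, Or.inl (Or.inl he)⟩⟩
    rintro ⟨-, (h | h) | h⟩
    · exact hAB.edge _ h he
    · exact hBQ.edge _ he h
    · rw [hB0 _ he] at h; exact zero_ne_one h
  · intro v hv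
    refine hG.cycle_outer_sub (hAQ.isCycle hA hQ hxy) (fun e he => ?_) (fun e he h h' => ?_)
      (hmems.mpr hv)
    · exact Or.inl (hmem.mp he)
    · rw [hadd]; exact h.resolve_left (fun h => h' (hmem.mpr h))
  · intro v hv
    refine hG.cycle_outer_sub (hBQ.isCycle hB hQ hxy) (fun e he => ?_) (fun e he h h' => ?_)
      (hmems.mpr hv)
    · exact Or.inl (hmem.mp he)
    · rw [hadd]; exact h.resolve_left (fun h => h' (hmem.mpr h))

/-- A periodic enumeration of the boundary cycle of the outer face. -/
structure OuterCycle (ε : Sym2 V → Sym2 V → ZMod 2) (G : SimpleGraph V) (n : ℕ) (c : ℕ → V) :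
    Prop where
  three : 3 ≤ n
  per : ∀ i, c (i + n) = c i
  inj : ∀ i j, i < n → j < n → c i = c j → i = j
  adj : ∀ i, G.Adj (c i) (c (i + 1))
  inside : ∀ e ∈ G.edgeSet, (∀ i, e ≠ s(c i, c (i + 1))) →
    ∑ t ∈ Finset.range n, ε s(c t, c (t + 1)) e = 1
  extreme : ∀ i, ∀ {x : V} (W : G.Walk x x), s(c i, c (i + 1)) ∉ W.edges →
    wsum ε W s(c i, c (i + 1)) = 0

/-- The walk along consecutive vertices of a sequence. -/
def seg {c : ℕ → V} (h : ∀ i, G.Adj (c i) (c (i + 1))) (i : ℕ) : ∀ l, G.Walk (c i) (c (i + l))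
  | 0 => .nil
  | l + 1 => (seg h i l).concat (h (i + l))

section seg

variable {c : ℕ → V} (h : ∀ i, G.Adj (c i) (c (i + 1)))

theorem mem_seg_support {i l : ℕ} {v : V} :
    v ∈ (seg h i l).support ↔ ∃ t ≤ l, v = c (i + t) := by
  induction l with
  | zero => simp [seg]
  | succ l ih =>
    rw [seg, Walk.support_concat, List.mem_append, List.mem_singleton, ih]
    constructor
    · rintro (⟨t, ht, rfl⟩ | rfl)
      · exact ⟨t, by omega, rfl⟩
      · exact ⟨l + 1, le_rfl, rfl⟩
    · rintro ⟨t, ht, rfl⟩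
      rcases Nat.lt_or_ge l t with h | h
      · obtain rfl : t = l + 1 := by omega
        exact Or.inr rfl
      · exact Or.inl ⟨t, h, rfl⟩

theorem mem_seg_edges {i l : ℕ} {e : Sym2 V} :
    e ∈ (seg h i l).edges ↔ ∃ t < l, e = s(c (i + t), c (i + t + 1)) := by
  induction l with
  | zero => simp [seg]
  | succ l ih =>
    rw [seg, Walk.edges_concat, List.concat_eq_append, List.mem_append, List.mem_singleton, ih]
    constructor
    · rintro (⟨t, ht, rfl⟩ | rfl)
      · exact ⟨t, by omega, rfl⟩
      · exact ⟨l, by omega, rfl⟩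
    · rintro ⟨t, ht, rfl⟩
      rcases Nat.lt_or_ge t l with h | h
      · exact Or.inl ⟨t, h, rfl⟩
      · obtain rfl : t = l := by omega
        exact Or.inr rfl

theorem wsum_seg (i l : ℕ) (e : Sym2 V) :
    wsum ε (seg h i l) e = ∑ t ∈ Finset.range l, ε s(c (i + t), c (i + t + 1)) e := by
  induction l with
  | zero => simp [seg, wsum]
  | succ l ih =>
    rw [Finset.sum_range_succ, ← ih, seg]
    simp [wsum, Walk.edges_concat, List.concat_eq_append]
    rfl

theorem seg_isPath {i l : ℕ} (hinj : ∀ t ≤ l, ∀ t' ≤ l, c (i + t) = c (i + t') → t = t') :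
    (seg h i l).IsPath := by
  induction l with
  | zero => simp [seg]
  | succ l ih =>
    refine Walk.IsPath.concat (ih fun t ht t' ht' => hinj t (by omega) t' (by omega)) ?_ _
    rw [mem_seg_support]
    rintro ⟨t, ht, he⟩
    have := hinj (l + 1) le_rfl t (by omega) he
    omega

end seg

theorem wsum_eq_sum_getVert {x y : V} (W : G.Walk x y) (e : Sym2 V) :
    wsum ε W e = ∑ t ∈ Finset.range W.length, ε s(W.getVert t, W.getVert (t + 1)) e := by
  induction W with
  | nil => simp [wsum]
  | cons h p ih =>
    rw [Walk.length_cons, Finset.sum_range_succ']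
    simp only [Walk.getVert_cons_succ, Walk.getVert_zero]
    rw [← ih]
    simp [wsum, add_comm]

theorem mem_edges_iff_getVert {x y : V} (W : G.Walk x y) (e : Sym2 V) :
    e ∈ W.edges ↔ ∃ t < W.length, e = s(W.getVert t, W.getVert (t + 1)) := by
  induction W with
  | nil => simp
  | cons h p ih =>
    rw [Walk.edges_cons, List.mem_cons, ih]
    constructor
    · rintro (rfl | ⟨t, ht, rfl⟩)
      · exact ⟨0, by simp, by simp⟩
      · exact ⟨t + 1, by simpa using ht, by simp⟩
    · rintro ⟨t, ht, rfl⟩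
      cases t with
      | zero => exact Or.inl (by simp)
      | succ t => exact Or.inr ⟨t, by simpa using ht, by simp⟩

theorem NoSep.exists_outerCycle [Finite V] (hG : Planar ε G) (hN : NoSep G) {e e' : Sym2 V}
    (he : e ∈ G.edgeSet) (he' : e' ∈ G.edgeSet) (hee : e ≠ e') :
    ∃ n c, OuterCycle ε G n c := by
  obtain ⟨r, K, hK, hin⟩ := hN.exists_boundary hG he he' hee
  set n := K.length with hn
  have h3 : 3 ≤ n := hK.three_le_length
  have hs : ∀ i, K.getVert ((i + 1) % n) = K.getVert (i % n + 1) := by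
    intro i
    have hlt := Nat.mod_lt i (show 0 < n by omega)
    rcases Nat.lt_or_ge (i % n + 1) n with h | h
    · rw [← Nat.mod_add_mod, Nat.mod_eq_of_lt h]
    · have : i % n + 1 = n := by omega
      rw [← Nat.mod_add_mod, this, Nat.mod_self, Walk.getVert_zero, hn, Walk.getVert_length]
  have hmem : ∀ e, e ∈ K.edges ↔ ∃ i, e = s(K.getVert (i % n), K.getVert ((i + 1) % n)) := by
    intro e
    rw [mem_edges_iff_getVert]
    constructor
    · rintro ⟨t, ht, rfl⟩
      refine ⟨t, ?_⟩
      rw [hs, Nat.mod_eq_of_lt ht]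
    · rintro ⟨i, rfl⟩
      exact ⟨i % n, Nat.mod_lt i (by omega), by rw [hs]⟩
  refine ⟨n, fun i => K.getVert (i % n), h3, ?_, ?_, ?_, ?_, ?_⟩
  · intro i; simp
  · intro i j hi hj h
    simp only [Nat.mod_eq_of_lt hi, Nat.mod_eq_of_lt hj] at h
    exact hK.getVert_injOn' (by simp; omega) (by simp; omega) h
  · intro i
    rw [hs]
    exact K.adj_getVert_succ (Nat.mod_lt i (by omega))
  · intro e he hne
    have heK : e ∉ K.edges := fun h => by
      obtain ⟨i, hi⟩ := (hmem e).mp h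
      exact hne i hi
    rw [← hin e he heK, wsum_eq_sum_getVert]
    refine Finset.sum_congr rfl fun t ht => ?_
    rw [Finset.mem_range] at ht
    rw [hs, Nat.mod_eq_of_lt ht]
  · intro i x W hW
    exact hG.at.cycle_extreme hK hin ((hmem _).mpr ⟨i, rfl⟩) W hW

namespace OuterCycle

variable {n : ℕ} {c : ℕ → V} (hC : OuterCycle ε G n c)
include hC

theorem mod (i : ℕ) : c (i % n) = c i := by
  conv_rhs => rw [← Nat.mod_add_div i n]
  generalize i / n = k
  induction k with
  | zero => simp
  | succ k ih => rw [Nat.mul_succ, ← add_assoc, hC.per, ← ih]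

theorem eq_iff {i j : ℕ} : c i = c j ↔ i % n = j % n := by
  constructor
  · intro h
    have := hC.three
    refine hC.inj _ _ (Nat.mod_lt _ (by omega)) (Nat.mod_lt _ (by omega)) ?_
    rw [hC.mod, hC.mod, h]
  · intro h
    rw [← hC.mod i, h, hC.mod]

theorem add_eq_iff {i s t : ℕ} (hs : s < n) (ht : t < n) : c (i + s) = c (i + t) ↔ s = t := by
  rw [hC.eq_iff]
  constructor
  · intro h
    have := Nat.ModEq.add_left_cancel' i h
    rwa [Nat.ModEq, Nat.mod_eq_of_lt hs, Nat.mod_eq_of_lt ht] at this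
  · rintro rfl; rfl

theorem exists_lt (i k : ℕ) : ∃ t < n, c k = c (i + t) := by
  have := hC.three
  refine ⟨(k + (n - i % n)) % n, Nat.mod_lt _ (by omega), ?_⟩
  rw [hC.eq_iff, Nat.add_mod_mod]
  have h1 := Nat.mod_lt i (show 0 < n by omega)
  have h2 := Nat.mod_add_div i n
  have : i + (k + (n - i % n)) = k + n * (i / n + 1) := by rw [Nat.mul_succ]; omega
  rw [this, Nat.add_mul_mod_self_left]

theorem outer (hG : Planar ε G) (i : ℕ) : Outer ε G (c i) := by
  intro x W hW a ha
  rw [hG.at.star W hW ha (hC.adj i)]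
  exact hC.extreme i W fun h => hW (W.fst_mem_support_of_mem_edges h)

theorem not_outer {v : V} (hv : ∀ i, v ≠ c i) (hu : Used G v) : ¬ Outer ε G v := by
  intro ho
  obtain ⟨a, ha⟩ := hu
  have h1 := hC.inside s(v, a) ha (fun i hi => by
    have : v ∈ s(c i, c (i + 1)) := hi ▸ Sym2.mem_mk_left _ _
    rw [Sym2.mem_iff] at this
    exact this.elim (hv i) (hv (i + 1)))
  have h0 := ho ((seg hC.adj 0 n).copy rfl (by rw [hC.per])) (by
    rw [Walk.support_copy, mem_seg_support]
    rintro ⟨t, -, ht⟩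
    exact hv _ ht) ha
  unfold wsum at h0
  rw [Walk.edges_copy] at h0
  change wsum ε _ _ = 0 at h0
  rw [wsum_seg] at h0
  simp only [zero_add] at h0
  rw [h0] at h1
  exact zero_ne_one h1

theorem edge_ne {i s t : ℕ} (hs : s < n) (ht : t < n) (hst : s ≠ t) :
    s(c (i + s), c (i + s + 1)) ≠ s(c (i + t), c (i + t + 1)) := by
  have h3 := hC.three
  intro h
  rw [Sym2.eq_iff] at h
  rcases h with ⟨h, -⟩ | ⟨h1, h2⟩
  · exact hst ((hC.add_eq_iff hs ht).mp h)
  · have key : ∀ s < n, ∀ t < n, c (i + s) = c (i + t + 1) → s = t + 1 ∨ (s = 0 ∧ t + 1 = n) := by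
      intro s hs t ht h
      rcases Nat.lt_or_ge (t + 1) n with h' | h'
      · exact Or.inl ((hC.add_eq_iff hs h').mp (by rw [h, add_assoc]))
      · have e : t + 1 = n := by omega
        have h0 : c (i + s) = c (i + 0) := by rw [h, add_assoc, e, hC.per, add_zero]
        exact Or.inr ⟨(hC.add_eq_iff hs (by omega)).mp h0, e⟩
    have k1 := key s hs t ht h1
    have k2 := key t ht s hs h2.symm
    omega

theorem sum_shift (f : Sym2 V → ZMod 2) (i : ℕ) :
    ∑ t ∈ Finset.range n, f s(c (i + t), c (i + t + 1)) =
      ∑ t ∈ Finset.range n, f s(c t, c (t + 1)) := by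
  induction i with
  | zero => simp
  | succ i ih =>
    rw [← ih]
    have h1 := Finset.sum_range_succ (fun t => f s(c (i + t), c (i + t + 1))) n
    have h2 := Finset.sum_range_succ' (fun t => f s(c (i + t), c (i + t + 1))) n
    rw [h1] at h2
    have h3 : c (i + n) = c i := hC.per i
    have h4 : c (i + n + 1) = c (i + 1) := by
      rw [show i + n + 1 = i + 1 + n by omega, hC.per]
    rw [h3, h4, add_zero] at h2
    rw [add_right_cancel h2]
    refine Finset.sum_congr rfl fun t _ => ?_
    rw [show i + 1 + t = i + (t + 1) by omega]

theorem shift (k : ℕ) : OuterCycle ε G n fun i => c (i + k) where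
  three := hC.three
  per i := by rw [show i + n + k = i + k + n by omega, hC.per]
  inj i j hi hj h := by
    rw [add_comm i, add_comm j] at h
    exact (hC.add_eq_iff hi hj).mp h
  adj i := by rw [show i + 1 + k = i + k + 1 by omega]; exact hC.adj _
  inside e he hne := by
    rw [← hC.inside e he fun i => ?_, ← hC.sum_shift (fun g => ε g e) k]
    · refine Finset.sum_congr rfl fun t _ => ?_
      rw [show t + 1 + k = k + t + 1 by omega, add_comm t]
    · obtain ⟨t, -, ht⟩ := hC.exists_lt k i
      have := hne t
      rw [show t + 1 + k = k + t + 1 by omega, add_comm t, ← ht] at this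
      have h2 : c (i + 1) = c (k + t + 1) := by
        rw [hC.eq_iff] at ht ⊢
        exact Nat.ModEq.add_right 1 ht
      rwa [h2]
  extreme i {x} W := by
    rw [show i + 1 + k = i + k + 1 by omega]
    exact hC.extreme (i + k) W

end OuterCycle

/-- A path `Q` splits `G` into two graphs with boundary segments `A` and `B`. -/
structure Splits (ε : Sym2 V → Sym2 V → ZMod 2) (G G₁ G₂ : SimpleGraph V) {x y : V}
    (Q : G.Walk x y) (c : ℕ → V) (i a b : ℕ) : Prop where
  sup : G₁ ⊔ G₂ = G
  common : ∀ v, Used G₁ v → Used G₂ v → v ∈ Q.support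
  edge : ∀ e ∈ Q.edges, e ∈ G₁.edgeSet ∧ e ∈ G₂.edgeSet
  left : ∀ t < a, G₁.Adj (c (i + t)) (c (i + t + 1)) ∧ ¬ G₂.Adj (c (i + t)) (c (i + t + 1))
  right : ∀ t < b, ¬ G₁.Adj (c (i + a + t)) (c (i + a + t + 1)) ∧
    G₂.Adj (c (i + a + t)) (c (i + a + t + 1))
  outer : ∀ v ∈ Q.support, Outer ε G₁ v ∧ Outer ε G₂ v

theorem OuterCycle.split {n : ℕ} {c : ℕ → V} (hC : OuterCycle ε G n c) (hG : Planar ε G)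
    {i a b : ℕ} (hab : a + b = n) (ha : 0 < a) (hb : 0 < b) {Q : G.Walk (c i) (c (i + a))}
    (hQ : Q.IsPath) (hQs : ∀ t, c t ∈ Q.support → c t = c i ∨ c t = c (i + a))
    (hQe : ∀ t, s(c t, c (t + 1)) ∉ Q.edges) : ∃ G₁ G₂, Splits ε G G₁ G₂ Q c i a b := by
  have hend : c (i + a + b) = c i := by rw [add_assoc, hab, hC.per]
  set A := seg hC.adj i a with hA
  set B := (seg hC.adj (i + a) b).reverse.copy hend rfl with hB
  have hAs : ∀ {v}, v ∈ A.support ↔ ∃ t ≤ a, v = c (i + t) := mem_seg_support _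
  have hAe : ∀ {e}, e ∈ A.edges ↔ ∃ t < a, e = s(c (i + t), c (i + t + 1)) := mem_seg_edges _
  have hBs : ∀ {v}, v ∈ B.support ↔ ∃ t ≤ b, v = c (i + a + t) := fun {v} => by
    rw [hB, Walk.support_copy, Walk.support_reverse, List.mem_reverse, mem_seg_support]
  have hBe : ∀ {e}, e ∈ B.edges ↔ ∃ t < b, e = s(c (i + a + t), c (i + a + t + 1)) := fun {e} => by
    rw [hB, Walk.edges_copy, Walk.edges_reverse, List.mem_reverse, mem_seg_edges]
  have hAB : IntDisjoint A B := by
    constructor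
    · intro v h1 h2
      obtain ⟨t, ht, rfl⟩ := hAs.mp h1
      obtain ⟨t', ht', h⟩ := hBs.mp h2
      rcases Nat.lt_or_ge t' b with hlt | hge
      · rw [add_assoc] at h
        have := (hC.add_eq_iff (i := i) (s := t) (t := a + t') (by omega) (by omega)).mp h
        right; congr 1; omega
      · obtain rfl : t' = b := by omega
        left; rw [h, hend]
    · intro e h1 h2
      obtain ⟨t, ht, rfl⟩ := hAe.mp h1
      obtain ⟨t', ht', h⟩ := hBe.mp h2
      rw [add_assoc i a] at h
      exact hC.edge_ne (s := t) (t := a + t') (by omega) (by omega) (by omega) h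
  have hAQ : IntDisjoint A Q := by
    refine ⟨fun v h1 h2 => ?_, fun e h1 h2 => ?_⟩
    · obtain ⟨t, ht, rfl⟩ := hAs.mp h1
      exact hQs _ h2
    · obtain ⟨t, ht, rfl⟩ := hAe.mp h1
      exact hQe _ h2
  have hBQ : IntDisjoint B Q := by
    refine ⟨fun v h1 h2 => ?_, fun e h1 h2 => ?_⟩
    · obtain ⟨t, ht, rfl⟩ := hBs.mp h1
      exact hQs _ h2
    · obtain ⟨t, ht, rfl⟩ := hBe.mp h1
      exact hQe _ h2
  have hxy : c i ≠ c (i + a) := fun h => by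
    have := (hC.add_eq_iff (i := i) (s := 0) (t := a) (by omega) (by omega)).mp h
    omega
  obtain ⟨G₁, G₂, h1, h2, h3, h4, h5, h6, h7⟩ := hG.split hxy (A := A) (B := B)
    (seg_isPath _ fun t ht t' ht' h => (hC.add_eq_iff (by omega) (by omega)).mp h)
    (by rw [hB, Walk.isPath_copy]
        exact (seg_isPath _ fun t ht t' ht' h =>
          (hC.add_eq_iff (by omega) (by omega)).mp h).reverse)
    hQ hAQ hBQ hAB
    (by
      intro e he hA' hB'
      have : wsum ε A e + wsum ε B e = ∑ t ∈ Finset.range n, ε s(c (i + t), c (i + t + 1)) e := by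
        rw [← hab, Finset.sum_range_add, hA, wsum_seg]
        congr 1
        rw [hB]
        unfold wsum
        rw [Walk.edges_copy]
        change wsum ε _ _ = _
        rw [wsum_reverse, wsum_seg]
        exact Finset.sum_congr rfl fun t _ => by rw [add_assoc i]
      rw [this, hC.sum_shift (fun g => ε g e) i]
      refine hC.inside e he fun k hk => ?_
      obtain ⟨t, ht, hkt⟩ := hC.exists_lt i k
      have hkt' : c (k + 1) = c (i + t + 1) := by
        rw [hC.eq_iff] at hkt ⊢
        exact Nat.ModEq.add_right 1 hkt
      rw [hkt, hkt'] at hk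
      rcases Nat.lt_or_ge t a with hlt | hge
      · exact hA' (hAe.mpr ⟨t, hlt, hk⟩)
      · refine hB' (hBe.mpr ⟨t - a, by omega, ?_⟩)
        rw [hk, show i + a + (t - a) = i + t by omega])
    (by
      intro e he
      obtain ⟨t, ht, rfl⟩ := hAe.mp he
      exact hC.extreme _)
    (by
      intro e he
      obtain ⟨t, ht, rfl⟩ := hBe.mp he
      exact hC.extreme _)
  exact ⟨G₁, G₂, h1, h2, h3, fun t ht => h4 _ (hAe.mpr ⟨t, ht, rfl⟩),
    fun t ht => h5 _ (hBe.mpr ⟨t, ht, rfl⟩), fun v hv => ⟨h6 v (Or.inr hv), h7 v (Or.inr hv)⟩⟩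

theorem PlanarAt.star_walk (hG : PlanarAt ε G) {r : V} (W : G.Walk r r) {x u : V} (p : G.Walk x u)
    (hp : ∀ v ∈ p.support, v ∉ W.support) {b a : V} (hb : G.Adj x b) (ha : G.Adj u a) :
    wsum ε W s(u, a) = wsum ε W s(x, b) := by
  induction p generalizing b with
  | nil => exact hG.star W (hp _ (by simp)) ha hb
  | cons h p ih =>
    rw [ih (fun v hv => hp v (by simp [hv])) h.symm ha, Sym2.eq_swap]
    exact hG.star W (hp _ (by simp)) h hb

theorem used_of_mem_support {x y v : V} {W : G.Walk x y} (hW : ¬ W.Nil) (hv : v ∈ W.support) :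
    Used G v := by
  obtain ⟨e, he, a, rfl⟩ := (Walk.mem_support_iff_exists_mem_edges_of_not_nil hW).mp hv
  exact ⟨a, W.adj_of_mem_edges he⟩

/-- A vertex joined to the outer face by deleted vertices is on the outer face. -/
theorem Planar.outer_of_walk (hG : Planar ε G) (hle : H ≤ G) {x u : V} (p : G.Walk x u)
    (hx : Outer ε G x) (hp : ∀ v ∈ p.support, v ≠ u → ¬ Used H v) : Outer ε H u := by
  intro r W hW a ha
  by_cases hn : W.Nil
  · rw [← Walk.eq_nil_iff_nil] at hn
    rw [hn]; simp [wsum]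
  have hp' : ∀ v ∈ p.support, v ∉ (W.mapLe hle).support := by
    intro v hv hvW
    have hvW' : v ∈ W.support := by simpa using hvW
    by_cases h : v = u
    · exact hW (h ▸ hvW')
    · exact hp v hv h (used_of_mem_support hn hvW')
  obtain ⟨b, hb⟩ : Used G x := by
    cases p with
    | nil => exact ⟨a, hle ha⟩
    | cons h p => exact ⟨_, h⟩
  have h1 := hG.at.star_walk (W.mapLe hle) p hp' hb (hle ha)
  rw [hx _ (hp' x p.start_mem_support) hb] at h1
  rwa [wsum_eq_of_perm (q := W) (by simp)] at h1

/-- Cycles of length five have no edges inside. -/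
def NoIn (ε : Sym2 V → Sym2 V → ZMod 2) (G : SimpleGraph V) : Prop :=
  ∀ {r : V} (K : G.Walk r r), K.IsCycle → K.length = 5 → ∀ e ∈ G.edgeSet, e ∉ K.edges →
    wsum ε K e = 0

/-- Two adjacent faces of length five whose common part is a path with middle vertex `k₂`. -/
theorem NoIn.hexagon (hG : Planar ε G) (hN : NoIn ε G) {k₁ k₂ k₃ k₄ k₅ y y' : V}
    (hnd : [k₁, k₂, k₃, k₄, k₅, y, y'].Nodup) (h12 : G.Adj k₁ k₂) (h23 : G.Adj k₂ k₃)
    (h34 : G.Adj k₃ k₄) (h45 : G.Adj k₄ k₅) (h51 : G.Adj k₅ k₁) (hy : G.Adj k₁ y)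
    (hyy : G.Adj y y') (hy' : G.Adj y' k₃) :
    (∃ (r : V) (W : G.Walk r r), s(k₁, k₂) ∉ W.edges ∧ wsum ε W s(k₁, k₂) = 1) ∧
      ∀ t, G.Adj k₂ t → t = k₁ ∨ t = k₃ := by
  set A : G.Walk k₁ k₃ := .cons h12 (.cons h23 .nil) with hA
  set B : G.Walk k₁ k₃ := .cons h51.symm (.cons h45.symm (.cons h34.symm .nil)) with hB
  set C : G.Walk k₁ k₃ := .cons hy (.cons hyy (.cons hy' .nil)) with hC
  simp only [List.nodup_cons, List.mem_cons, List.not_mem_nil, or_false, not_or, not_false_eq_true,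
    List.nodup_nil, and_true] at hnd
  have hAB : IntDisjoint A B := by
    constructor <;> simp [hA, hB] <;> grind
  have hAC : IntDisjoint A C := by
    constructor <;> simp [hA, hC] <;> grind
  have hBC : IntDisjoint B C := by
    constructor <;> simp [hB, hC] <;> grind
  have pA : A.IsPath := by simp [hA]; grind
  have pB : B.IsPath := by simp [hB]; grind
  have pC : C.IsPath := by simp [hC]; grind
  have hne : k₁ ≠ k₃ := by grind
  have h1 : ∀ e ∈ G.edgeSet, e ∉ A.edges → e ∉ B.edges → wsum ε A e + wsum ε B e = 0 := by
    intro e he h h'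
    rw [← hN _ (hAB.isCycle pA pB hne) (by simp [hA, hB]) e he (by simp [h, h']), wsum_append,
      wsum_reverse]
  have h2 : ∀ e ∈ G.edgeSet, e ∉ A.edges → e ∉ C.edges → wsum ε A e + wsum ε C e = 0 := by
    intro e he h h'
    rw [← hN _ (hAC.isCycle pA pC hne) (by simp [hA, hC]) e he (by simp [h, h']), wsum_append,
      wsum_reverse]
  have m1 : s(k₁, k₂) ∈ A.edges := by simp [hA]
  have m2 : s(k₁, k₅) ∈ B.edges := by simp [hB]
  have m3 : s(k₁, y) ∈ C.edges := by simp [hC]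
  have ht := hG.at.theta_sum hne pA pB pC hAB hAC hBC m1 m2 m3
  rw [h2 _ h51.symm (hAB.symm.edge _ m2) (hBC.edge _ m2),
    h1 _ hy (hAC.symm.edge _ m3) (hBC.symm.edge _ m3), add_zero, add_zero] at ht
  have hwBC : ∀ e, wsum ε (B.append C.reverse) e = wsum ε B e + wsum ε C e := fun e => by
    rw [wsum_append, wsum_reverse]
  refine ⟨⟨k₁, B.append C.reverse, ?_, by rw [hwBC, ht]⟩, fun t ht2 => ?_⟩
  · have := hAB.edge _ m1
    have := hAC.edge _ m1
    simp_all
  · by_contra hcon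
    have n0 : k₂ ∉ (B.append C.reverse).support := by
      rw [Walk.mem_support_append_iff, Walk.support_reverse, List.mem_reverse]
      simp [hB, hC]; grind
    have hs := hG.at.star (B.append C.reverse) n0 ht2 h12.symm
    rw [hwBC, hwBC, Sym2.eq_swap (a := k₂) (b := k₁), ht] at hs
    have nA : s(k₂, t) ∉ A.edges := by simp [hA]; grind
    have nB : s(k₂, t) ∉ B.edges := by simp [hB]; grind
    have nC : s(k₂, t) ∉ C.edges := by simp [hC]; grind
    have e1 := h1 _ ht2 nA nB
    have e2 := h2 _ ht2 nA nC
    have : ∀ a b c : ZMod 2, b + c = 1 → a + b = 0 → a + c = 0 → False := by decide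
    exact this _ _ _ hs e1 e2

/-- No triangles and no cycles of length four. -/
structure G5 (G : SimpleGraph V) : Prop where
  tri : ∀ {a b c : V}, G.Adj a b → G.Adj b c → ¬ G.Adj a c
  sq : ∀ {a b c d : V}, G.Adj b a → G.Adj b c → G.Adj d a → G.Adj d c → a ≠ c → b = d

theorem G5.mono (hle : H ≤ G) (hG : G5 G) : G5 H :=
  ⟨fun h1 h2 h3 => hG.tri (hle h1) (hle h2) (hle h3),
    fun h1 h2 h3 h4 h => hG.sq (hle h1) (hle h2) (hle h3) (hle h4) h⟩

/-- A vertex with two neighbors on a path with at most four vertices sees both its ends. -/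
theorem G5.ends (hG : G5 G) {P : List V} (hlen : P.length ≤ 4) (hc : P.IsChain G.Adj)
    (hn : P.Nodup) {z p q : V} (hz : z ∉ P) (hp : p ∈ P) (hq : q ∈ P) (hpq : p ≠ q)
    (hzp : G.Adj z p) (hzq : G.Adj z q) :
    ∃ a b c d, P = [a, b, c, d] ∧ G.Adj z a ∧ G.Adj z d := by
  have t := fun a b c => @G5.tri _ _ hG a b c
  have s := fun a b c d => @G5.sq _ _ hG a b c d
  have sy := fun a b => @SimpleGraph.Adj.symm _ G a b
  match P, hlen with
  | [], _ => simp at hp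
  | [a], _ => grind
  | [a, b], _ => simp at hc hp hq; grind
  | [a, b, c], _ => simp at hc hp hq hn hz; grind
  | [a, b, c, d], _ => simp at hc hp hq hn hz ⊢; grind
  | _ :: _ :: _ :: _ :: _ :: _, h => simp at h; omega

/-- A path with at most four vertices has no chords. -/
theorem G5.adj_of_chain (hG : G5 G) {R : V → V → Prop} (hR : ∀ u v, R u v → G.Adj u v)
    (hs : ∀ u v, R u v → R v u) {P : List V} (hlen : P.length ≤ 4) (hc : P.IsChain R)
    (hn : P.Nodup) {u v : V} (hu : u ∈ P) (hv : v ∈ P) (huv : G.Adj u v) : R u v := by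
  have t := fun a b c => @G5.tri _ _ hG a b c
  have s := fun a b c d => @G5.sq _ _ hG a b c d
  have sy := fun a b => @SimpleGraph.Adj.symm _ G a b
  have ir := fun a => G.irrefl (v := a)
  match P, hlen with
  | [], _ => simp at hu
  | [a], _ => simp at hu hv; grind
  | [a, b], _ => simp at hc hu hv; grind
  | [a, b, c], _ => simp at hc hu hv hn; grind
  | [a, b, c, d], _ =>
    simp at hc hu hv hn
    obtain ⟨h1, h2, h3⟩ := hc
    have nac : ¬ G.Adj a c := t _ _ _ (hR _ _ h1) (hR _ _ h2)
    have nbd : ¬ G.Adj b d := t _ _ _ (hR _ _ h2) (hR _ _ h3)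
    have nad : ¬ G.Adj a d := fun h => hn.2.1.2 <| s a b c d (sy _ _ (hR _ _ h1)) (hR _ _ h2)
      (sy _ _ h) (sy _ _ (hR _ _ h3)) hn.1.2.1
    rcases hu with rfl | rfl | rfl | rfl <;> rcases hv with rfl | rfl | rfl | rfl <;> grind
  | _ :: _ :: _ :: _ :: _ :: _, h => simp at h; omega

/-- A list assignment on a plane graph with a precolored path `P` on the outer face. -/
structure Inst (ε : Sym2 V → Sym2 V → ZMod 2) (G : SimpleGraph V) (P : List V)
    (L : V → Finset ℕ) : Prop where
  planar : Planar ε G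
  g5 : G5 G
  len : P.length ≤ 4
  nodup : P.Nodup
  chain : P.IsChain G.Adj
  outP : ∀ v ∈ P, Outer ε G v
  cardP : ∀ v ∈ P, (L v).card = 1
  proper : ∀ u ∈ P, ∀ v ∈ P, G.Adj u v → ∀ α ∈ L u, α ∉ L v
  two : ∀ v ∉ P, Used G v → 2 ≤ (L v).card
  three : ∀ v ∉ P, Used G v → ¬ Outer ε G v → 3 ≤ (L v).card
  indep : ∀ u ∉ P, ∀ v ∉ P, G.Adj u v → 3 ≤ (L u).card ∨ 3 ≤ (L v).card
  q : ∀ z ∉ P, ∃ α ∈ L z, ∀ p ∈ P, G.Adj z p → α ∉ L p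

variable {P : List V} {L : V → Finset ℕ}

theorem Inst.nonempty (hI : Inst ε G P L) (v : V) : ∃ α, α ∈ L v := by
  by_cases h : v ∈ P
  · exact Finset.card_pos.mp (by rw [hI.cardP v h]; simp)
  · obtain ⟨α, h, -⟩ := hI.q v h; exact ⟨α, h⟩

theorem Inst.mono (hI : Inst ε G P L) (hle : H ≤ G) {P' : List V} (hs : P'.Sublist P)
    (hc : P'.IsChain H.Adj) (hu : ∀ v ∈ P, v ∉ P' → ¬ Used H v) : Inst ε H P' L where
  planar := hI.planar.mono hle
  g5 := hI.g5.mono hle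
  len := hs.length_le.trans hI.len
  nodup := hI.nodup.sublist hs
  chain := hc
  outP v hv := (hI.outP v (hs.subset hv)).mono hle
  cardP v hv := hI.cardP v (hs.subset hv)
  proper u hu v hv h := hI.proper u (hs.subset hu) v (hs.subset hv) (hle h)
  two v hv h := hI.two v (fun hp => hu v hp hv h) (h.mono hle)
  three v hv h ho := hI.three v (fun hp => hu v hp hv h) (h.mono hle) fun h' => ho (h'.mono hle)
  indep u hu' v hv h := hI.indep u (fun hp => hu u hp hu' ⟨v, h⟩) v
    (fun hp => hu v hp hv ⟨u, h.symm⟩) (hle h)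
  q z hz := by
    by_cases hzP : z ∈ P
    · obtain ⟨α, hα⟩ := hI.nonempty z
      exact ⟨α, hα, fun p _ h => absurd ⟨p, h⟩ (hu z hzP hz)⟩
    · obtain ⟨α, hα, h⟩ := hI.q z hzP
      exact ⟨α, hα, fun p hp hzp => h p (hs.subset hp) (hle hzp)⟩

/-- Colors at the neighbors of `z` on a short path leave a color at `z`. -/
theorem G5.exists_color (hG : G5 G) {P : List V} (hlen : P.length ≤ 4) (hc : P.IsChain G.Adj)
    (hn : P.Nodup) {z : V} (hz : z ∉ P) {S : Finset ℕ} (hS : S.Nonempty) (hS2 : Used G z → 2 ≤ S.card)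
    (h3 : ∀ a b c d, P = [a, b, c, d] → G.Adj z a → G.Adj z d → 3 ≤ S.card) (φ : V → ℕ) :
    ∃ α ∈ S, ∀ p ∈ P, G.Adj z p → α ≠ φ p := by
  by_cases h : ∃ p ∈ P, G.Adj z p
  · obtain ⟨p, hp, hzp⟩ := h
    by_cases h' : ∃ q ∈ P, G.Adj z q ∧ p ≠ q
    · obtain ⟨q, hq, hzq, hpq⟩ := h'
      obtain ⟨a, b, c, d, rfl, ha, hd⟩ := hG.ends hlen hc hn hz hp hq hpq hzp hzq
      have hcard : ({φ a, φ d} : Finset ℕ).card < S.card :=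
        Finset.card_le_two.trans_lt (h3 _ _ _ _ rfl ha hd)
      obtain ⟨α, hα, hα'⟩ := Finset.exists_mem_notMem_of_card_lt_card hcard
      refine ⟨α, hα, fun r hr hzr => ?_⟩
      simp at hc hr hα'
      rcases hr with rfl | rfl | rfl | rfl
      · exact hα'.1
      · exact absurd hzr (hG.tri ha hc.1)
      · exact absurd hzr (hG.tri hd hc.2.2.symm)
      · exact hα'.2
    · have hcard : ({φ p} : Finset ℕ).card < S.card := by
        rw [Finset.card_singleton]; exact hS2 ⟨p, hzp⟩
      obtain ⟨α, hα, hα'⟩ := Finset.exists_mem_notMem_of_card_lt_card hcard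
      refine ⟨α, hα, fun r hr hzr => ?_⟩
      have : p = r := by by_contra hpr; exact h' ⟨r, hr, hzr, hpr⟩
      subst this; simpa using hα'
  · obtain ⟨α, hα⟩ := hS
    exact ⟨α, hα, fun p hp hzp => absurd ⟨p, hp, hzp⟩ h⟩

open Classical in
/-- Precoloring a path by a coloring of another part of the graph. -/
theorem Inst.precolor (hI : Inst ε G P L) (hle : H ≤ G) {P' : List V} (hlen : P'.length ≤ 4)
    (hn : P'.Nodup) (hc : P'.IsChain H.Adj) (ho : ∀ v ∈ P', Outer ε H v)
    (hu : ∀ v ∈ P, v ∉ P' → ¬ Used H v) {φ : V → ℕ}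
    (hφ : ∀ u ∈ P', ∀ v ∈ P', H.Adj u v → φ u ≠ φ v)
    (h3 : ∀ a b c d, P' = [a, b, c, d] → ∀ z, z ∉ P' → H.Adj z a → H.Adj z d → 3 ≤ (L z).card) :
    Inst ε H P' (fun v => if v ∈ P' then {φ v} else L v) where
  planar := hI.planar.mono hle
  g5 := hI.g5.mono hle
  len := hlen
  nodup := hn
  chain := hc
  outP := ho
  cardP v hv := by simp [hv]
  proper u hu v hv h := by simpa [hu, hv] using hφ u hu v hv h
  two v hv h := by simpa [hv] using hI.two v (fun hp => hu v hp hv h) (h.mono hle)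
  three v hv h ho := by
    simpa [hv] using hI.three v (fun hp => hu v hp hv h) (h.mono hle) fun h' => ho (h'.mono hle)
  indep u hu' v hv h := by
    simpa [hu', hv] using hI.indep u (fun hp => hu u hp hu' ⟨v, h⟩) v
      (fun hp => hu v hp hv ⟨u, h.symm⟩) (hle h)
  q z hz := by
    obtain ⟨α, hα, h⟩ := (hI.g5.mono hle).exists_color hlen hc hn hz (hI.nonempty z)
      (fun h => hI.two z (fun hp => hu z hp hz h) (h.mono hle))
      (fun a b c d h => h3 a b c d h z hz) φ
    exact ⟨α, by simpa [hz], fun p hp hzp => by simpa [hp] using h p hp hzp⟩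

open Classical in
theorem glue {G₁ G₂ : SimpleGraph V} (hsup : G₁ ⊔ G₂ = G) {φ₁ φ₂ : V → ℕ}
    (h1 : IsLColoring G₁ L φ₁) (h2 : IsLColoring G₂ L φ₂)
    (h : ∀ v, Used G₁ v → Used G₂ v → φ₁ v = φ₂ v) : LColorable G L := by
  refine ⟨fun v => if Used G₁ v then φ₁ v else φ₂ v, fun v => ?_, fun u v huv => ?_⟩
  · dsimp only; split
    · exact h1.1 v
    · exact h2.1 v
  · rw [← hsup] at huv
    rcases huv with huv | huv
    · simpa [show Used G₁ u from ⟨v, huv⟩, show Used G₁ v from ⟨u, huv.symm⟩] using h1.2 huv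
    · have e : ∀ w, Used G₂ w → (if Used G₁ w then φ₁ w else φ₂ w) = φ₂ w := fun w hw => by
        split
        · exact h w ‹_› hw
        · rfl
      dsimp only
      rw [e u ⟨v, huv⟩, e v ⟨u, huv.symm⟩]
      exact h2.2 huv

/-- Deleting all edges at the vertices of `X`. -/
def del (G : SimpleGraph V) (X : Set V) : SimpleGraph V where
  Adj u v := G.Adj u v ∧ u ∉ X ∧ v ∉ X
  symm := ⟨fun _ _ h => ⟨h.1.symm, h.2.2, h.2.1⟩⟩
  loopless := ⟨fun _ h => h.1.ne rfl⟩

theorem del_le (X : Set V) : del G X ≤ G := fun _ _ h => h.1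

theorem del_lt {X : Set V} {x y : V} (hx : x ∈ X) (h : G.Adj x y) : del G X < G :=
  lt_of_le_of_ne (del_le X) fun he => by
    rw [← he] at h; exact h.2.1 hx

open Classical in
/-- Coloring the vertices of `X` and removing their colors from the lists of the vertices in
`D`. -/
theorem Inst.delete (hI : Inst ε G P L) (X D : Set V) (ψ : V → ℕ) {P' : List V}
    (hs : P'.Sublist P) (hc : P'.IsChain G.Adj) (hPX : ∀ v ∈ P, v ∉ P' → v ∈ X)
    (hP'X : ∀ v ∈ P', v ∉ X) (hψ : ∀ x ∈ X, ψ x ∈ L x)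
    (hψ' : ∀ x ∈ X, ∀ y ∈ X, G.Adj x y → ψ x ≠ ψ y)
    (hψP : ∀ p ∈ P', ∀ x ∈ X, G.Adj p x → ψ x ∉ L p)
    (hDP : ∀ v ∈ D, v ∉ P' ∧ v ∉ X)
    (hsafe : ∀ v, v ∉ X → v ∉ P' → v ∉ D → ∀ x ∈ X, G.Adj v x →
      ψ x ∉ L v ∨ ∃ p ∈ P', G.Adj v p ∧ L p = {ψ x})
    (hD3 : ∀ v ∈ D, 3 ≤ (L v).card)
    (hD1 : ∀ v ∈ D, ∀ x ∈ X, ∀ y ∈ X, G.Adj v x → G.Adj v y → x = y)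
    (hDout : ∀ v ∈ D, ∃ x ∈ X, G.Adj v x ∧ (Outer ε G x ∨ ∃ y ∈ X, G.Adj x y ∧ Outer ε G y))
    (hDind : ∀ v ∈ D, ∀ w, w ∉ X → w ∉ P' → G.Adj v w → w ∉ D ∧ 3 ≤ (L w).card)
    (hone : ∀ z, z ∉ X → z ∉ P' → ∀ p ∈ P', ∀ q ∈ P', G.Adj z p → G.Adj z q → p = q) :
    ∃ L', Inst ε (del G X) P' L' ∧
      (LColorable (del G X) L' → ∃ φ, IsLColoring G L φ ∧ ∀ x ∈ X, φ x = ψ x) := by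
  have hPP' : ∀ v, v ∉ X → v ∉ P' → v ∉ P := fun v h h' h'' => h (hPX v h'' h')
  have hex : ∀ v, ∃ S ⊆ L v, (v ∉ D → S = L v) ∧ (∀ x ∈ X, v ∈ D → G.Adj v x → ψ x ∉ S) ∧
      (L v).card ≤ S.card + 1 := by
    intro v
    by_cases hv : v ∈ D
    · obtain ⟨x, hx, hvx, -⟩ := hDout v hv
      refine ⟨(L v).erase (ψ x), Finset.erase_subset _ _, fun h => absurd hv h, ?_, ?_⟩
      · intro y hy _ hvy
        rw [hD1 v hv y hy x hx hvy hvx]; simp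
      · exact Nat.le_add_of_sub_le Finset.pred_card_le_card_erase
    · exact ⟨L v, subset_rfl, fun _ => rfl, fun _ _ h => absurd h hv, Nat.le_succ _⟩
  choose L' hsub heq havoid hcard using hex
  have hL'P : ∀ v ∈ P', L' v = L v := fun v hv => heq v fun h => (hDP v h).1 hv
  have hX : ∀ {v}, Used (del G X) v → v ∉ X := fun ⟨_, h⟩ => h.2.1
  have htwo : ∀ v ∉ P', v ∉ X → Used G v → 2 ≤ (L' v).card := by
    intro v hv hvX h
    by_cases hvD : v ∈ D
    · have := hcard v; have := hD3 v hvD; omega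
    · rw [heq v hvD]; exact hI.two v (hPP' v hvX hv) h
  refine ⟨L', ⟨hI.planar.mono (del_le X), hI.g5.mono (del_le X), hs.length_le.trans hI.len,
    hI.nodup.sublist hs, ?_, fun v hv => (hI.outP v (hs.subset hv)).mono (del_le X),
    fun v hv => by rw [hL'P v hv]; exact hI.cardP v (hs.subset hv), ?_,
    fun v hv h => htwo v hv (hX h) (h.mono (del_le X)), ?_, ?_, ?_⟩, ?_⟩
  · exact hc.imp_of_mem_imp fun u v hu hv h => ⟨h, hP'X u hu, hP'X v hv⟩
  · intro u hu v hv h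
    rw [hL'P u hu, hL'P v hv]
    exact hI.proper u (hs.subset hu) v (hs.subset hv) h.1
  · intro v hv hu ho
    by_cases hvD : v ∈ D
    · exfalso
      apply ho
      obtain ⟨x, hx, hvx, h | ⟨y, hy, hxy, h⟩⟩ := hDout v hvD
      · refine hI.planar.outer_of_walk (del_le X) (.cons hvx.symm .nil) h ?_
        intro w hw hwv hu
        simp [hwv] at hw
        exact hX hu (hw ▸ hx)
      · refine hI.planar.outer_of_walk (del_le X) (.cons hxy.symm (.cons hvx.symm .nil)) h ?_
        intro w hw hwv hu
        simp [hwv] at hw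
        rcases hw with rfl | rfl
        · exact hX hu hy
        · exact hX hu hx
    · rw [heq v hvD]
      exact hI.three v (hPP' v (hX hu) hv) (hu.mono (del_le X)) fun h => ho (h.mono (del_le X))
  · intro u hu v hv h
    by_cases huD : u ∈ D
    · have := hDind u huD v h.2.2 hv h.1
      rw [heq v this.1]; exact Or.inr this.2
    · by_cases hvD : v ∈ D
      · have := hDind v hvD u h.2.1 hu h.1.symm
        rw [heq u this.1]; exact Or.inl this.2
      · rw [heq u huD, heq v hvD]
        exact hI.indep u (hPP' u h.2.1 hu) v (hPP' v h.2.2 hv) h.1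
  · intro z hz
    have hne : (L' z).Nonempty := by
      by_cases hzD : z ∈ D
      · apply Finset.card_pos.mp
        have := hcard z; have := hD3 z hzD; omega
      · rw [heq z hzD]; exact hI.nonempty z
    by_cases h : ∃ p ∈ P', (del G X).Adj z p
    · obtain ⟨p, hp, hzp⟩ := h
      have h1 : (L p).card < (L' z).card := by
        rw [hI.cardP p (hs.subset hp)]
        exact htwo z hz hzp.2.1 ⟨p, hzp.1⟩
      obtain ⟨α, hα, hα'⟩ := Finset.exists_mem_notMem_of_card_lt_card h1
      refine ⟨α, hα, fun r hr hzr => ?_⟩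
      rw [hL'P r hr, ← hone z hzp.2.1 hz p hp r hr hzp.1 hzr.1]
      exact hα'
    · obtain ⟨α, hα⟩ := hne
      exact ⟨α, hα, fun p hp hzp => absurd ⟨p, hp, hzp⟩ h⟩
  · rintro ⟨φ, hφ, hφ'⟩
    have key : ∀ x ∈ X, ∀ v ∉ X, G.Adj v x → ψ x ≠ φ v := by
      intro x hx v hv hvx heq'
      by_cases hvP : v ∈ P'
      · exact hψP v hvP x hx hvx (heq' ▸ hsub v (hφ v))
      by_cases hvD : v ∈ D
      · exact havoid v x hx hvD hvx (heq' ▸ hφ v)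
      · rcases hsafe v hv hvP hvD x hx hvx with h | ⟨p, hp, hvp, h⟩
        · exact h (heq' ▸ hsub v (hφ v))
        · have h1 := hsub p (hφ p)
          rw [h, Finset.mem_singleton] at h1
          exact hφ' (show (del G X).Adj v p from ⟨hvp, hv, hP'X p hp⟩) (by rw [h1, heq'])
    refine ⟨fun v => if v ∈ X then ψ v else φ v, ⟨fun v => ?_, fun u v huv => ?_⟩, fun x hx => by
      simp [hx]⟩
    · dsimp only; split
      · exact hψ v ‹_›
      · exact hsub v (hφ v)
    · dsimp only
      split <;> split
      · exact hψ' u ‹_› v ‹_› huv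
      · exact key u ‹_› v ‹_› huv.symm
      · exact (key v ‹_› u ‹_› huv).symm
      · exact hφ' (show (del G X).Adj u v from ⟨huv, ‹_›, ‹_›⟩)

/-- An instance without a coloring all of whose proper subgraphs satisfy the theorem. -/
structure MinCE (ε : Sym2 V → Sym2 V → ZMod 2) (G : SimpleGraph V) (P : List V)
    (L : V → Finset ℕ) : Prop extends Inst ε G P L where
  ih : ∀ H < G, ∀ P' L', Inst ε H P' L' → LColorable H L'
  no : ¬ LColorable G L
  used : ∀ v ∈ P, Used G v

theorem Inst.reverse (hI : Inst ε G P L) : Inst ε G P.reverse L where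
  planar := hI.planar
  g5 := hI.g5
  len := by simpa using hI.len
  nodup := List.nodup_reverse.mpr hI.nodup
  chain := List.isChain_reverse.mpr (hI.chain.imp fun _ _ h => h.symm)
  outP v hv := hI.outP v (by simpa using hv)
  cardP v hv := hI.cardP v (by simpa using hv)
  proper u hu v hv := hI.proper u (by simpa using hu) v (by simpa using hv)
  two v hv := hI.two v (by simpa using hv)
  three v hv := hI.three v (by simpa using hv)
  indep u hu v hv := hI.indep u (by simpa using hu) v (by simpa using hv)
  q z hz := by simpa using hI.q z (by simpa using hz)

namespace MinCE

theorem reverse (hM : MinCE ε G P L) : MinCE ε G P.reverse L :=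
  ⟨hM.toInst.reverse, hM.ih, hM.no, fun v hv => hM.used v (by simpa using hv)⟩

/-- The second part of a separation cannot be colored after the first one. -/
theorem no_split (hM : MinCE ε G P L) {G₁ G₂ : SimpleGraph V} (hsup : G₁ ⊔ G₂ = G)
    (hlt : G₂ < G) (h1 : LColorable G₁ L) {P' : List V} (hlen : P'.length ≤ 4)
    (hn : P'.Nodup) (hc : P'.IsChain fun u v => G₂.Adj u v ∧ (G₁.Adj u v ∨ u ∈ P ∧ v ∈ P))
    (ho : ∀ v ∈ P', Outer ε G₂ v) (hcommon : ∀ v, Used G₁ v → Used G₂ v → v ∈ P')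
    (hu : ∀ v ∈ P, v ∉ P' → ¬ Used G₂ v)
    (h3 : ∀ a b c d, P' = [a, b, c, d] → ∀ z, z ∉ P' → G₂.Adj z a → G₂.Adj z d →
      3 ≤ (L z).card) : False := by
  classical
  obtain ⟨φ, hφ, hφ'⟩ := h1
  have hg := hM.g5.mono hlt.le
  have hI := hM.toInst.precolor hlt.le (φ := φ) hlen hn (hc.imp fun _ _ h => h.1) ho hu ?_ h3
  · obtain ⟨φ₂, h2, h2'⟩ := hM.ih _ hlt _ _ hI
    refine hM.no (glue hsup ⟨hφ, hφ'⟩ ⟨fun v => ?_, h2'⟩ fun v hv hv' => ?_)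
    · have : φ₂ v ∈ if v ∈ P' then {φ v} else L v := h2 v
      split at this
      · rw [Finset.mem_singleton] at this; rw [this]; exact hφ v
      · exact this
    · have : φ₂ v ∈ if v ∈ P' then {φ v} else L v := h2 v
      rw [if_pos (hcommon v hv hv'), Finset.mem_singleton] at this
      exact this.symm
  · intro u hu v hv huv heq
    have := hg.adj_of_chain (R := fun u v => G₂.Adj u v ∧ (G₁.Adj u v ∨ u ∈ P ∧ v ∈ P))
      (fun _ _ h => h.1) (fun u v h => ⟨h.1.symm, h.2.imp (fun h => h.symm) fun h => h.symm⟩)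
      hlen hc hn hu hv huv
    rcases this.2 with h | ⟨hu, hv⟩
    · exact hφ' h heq
    · exact hM.proper u hu v hv (hlt.le huv) _ (hφ u) (heq ▸ hφ v)

theorem isChain_filter {G₁ G₂ : SimpleGraph V} (hsup : G₁ ⊔ G₂ = G)
    (hone : ∀ u v, Used G₁ u → Used G₂ u → Used G₁ v → Used G₂ v → u = v) {P : List V}
    (hc : P.IsChain G.Adj) (hn : P.Nodup) [DecidablePred (Used G₁)] :
    (P.filter (Used G₁)).IsChain G₁.Adj := by
  have key : ∀ u v, G.Adj u v → Used G₁ u → Used G₁ v → G₁.Adj u v := by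
    intro u v h hu hv
    rw [← hsup] at h
    rcases h with h | h
    · exact h
    · exact absurd (hone u v hu ⟨v, h⟩ hv ⟨u, h.symm⟩) h.ne
  have key2 : ∀ u v, G.Adj u v → ¬ Used G₁ v → Used G₂ u := by
    intro u v h hv
    rw [← hsup] at h
    rcases h with h | h
    · exact absurd ⟨u, h.symm⟩ hv
    · exact ⟨v, h⟩
  have aux : ∀ (Q : List V) (p : V), (p :: Q).IsChain G.Adj → (p :: Q).Nodup → Used G₂ p →
      ¬ Used G₁ p → ∀ r, Used G₁ r → Used G₂ r → r ∉ Q → Q.filter (Used G₁) = [] := by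
    intro Q
    induction Q with
    | nil => simp
    | cons q Q ih =>
      intro p hc hn hp hp' r hr hr' hrQ
      simp only [List.isChain_cons_cons, List.nodup_cons, List.mem_cons, not_or] at hc hn hrQ
      have hq := key2 q p hc.1.symm hp'
      have hq' : ¬ Used G₁ q := fun h => hrQ.1 (hone _ _ hr hr' h hq)
      rw [List.filter_cons_of_neg (by simpa using hq')]
      exact ih q hc.2 (by simp [hn]) hq hq' r hr hr' hrQ.2
  induction P with
  | nil => simp
  | cons p Q ih =>
    have ih := ih hc.tail hn.of_cons
    by_cases hp : Used G₁ p
    · rw [List.filter_cons_of_pos (by simpa using hp)]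
      rcases Q with _ | ⟨q, Q⟩
      · simp
      simp only [List.isChain_cons_cons] at hc
      by_cases hq : Used G₁ q
      · rw [List.filter_cons_of_pos (by simpa using hq)] at ih ⊢
        exact List.isChain_cons_cons.mpr ⟨key p q hc.1 hp hq, ih⟩
      · rw [List.filter_cons_of_neg (by simpa using hq)]
        have hpq := key2 p q hc.1 hq
        have hq2 : Used G₂ q := by
          have h := hc.1
          rw [← hsup] at h
          rcases h with h | h
          · exact absurd ⟨p, h.symm⟩ hq
          · exact ⟨p, h.symm⟩
        rw [aux Q q hc.2 hn.of_cons hq2 hq p hp hpq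
          (fun h => (List.nodup_cons.mp hn).1 (List.mem_cons_of_mem _ h))]
        simp
    · rw [List.filter_cons_of_neg (by simpa using hp)]
      exact ih

theorem lt_of_sep {G₁ G₂ : SimpleGraph V} (hsup : G₁ ⊔ G₂ = G) (h1 : G₂ ≠ ⊥)
    (hone : ∀ u v, Used G₁ u → Used G₂ u → Used G₁ v → Used G₂ v → u = v) : G₁ < G := by
  refine lt_of_le_of_ne (hsup ▸ le_sup_left) fun h => ?_
  obtain ⟨u, v, huv⟩ := ne_bot_iff_exists_adj.mp h1
  have h' : G₁.Adj u v := by rw [h, ← hsup]; exact Or.inr huv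
  exact huv.ne (hone _ _ ⟨v, h'⟩ ⟨v, huv⟩ ⟨u, h'.symm⟩ ⟨u, huv.symm⟩)

theorem colorable_left (hM : MinCE ε G P L) {G₁ G₂ : SimpleGraph V} (hsup : G₁ ⊔ G₂ = G)
    (h2 : G₂ ≠ ⊥) (hone : ∀ u v, Used G₁ u → Used G₂ u → Used G₁ v → Used G₂ v → u = v) :
    LColorable G₁ L := by
  classical
  have hlt := lt_of_sep hsup h2 hone
  refine hM.ih _ hlt _ _ (hM.toInst.mono hlt.le List.filter_sublist
    (isChain_filter hsup hone hM.chain hM.nodup) fun v hv hv' h => hv' ?_)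
  simp [hv, h]

theorem no_sep_in (hM : MinCE ε G P L) {G₁ G₂ : SimpleGraph V} (hsup : G₁ ⊔ G₂ = G)
    (h1 : G₁ ≠ ⊥) (h2 : G₂ ≠ ⊥)
    (hone : ∀ u v, Used G₁ u → Used G₂ u → Used G₁ v → Used G₂ v → u = v)
    (hin : ∀ v, Used G₁ v → Used G₂ v → v ∈ P) : False := by
  obtain ⟨φ₁, h₁⟩ := hM.colorable_left hsup h2 hone
  obtain ⟨φ₂, h₂⟩ := hM.colorable_left ((sup_comm _ _).trans hsup) h1
    fun u v a b c d => hone u v b a d c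
  refine hM.no (glue hsup h₁ h₂ fun v hv hv' => ?_)
  exact Finset.card_le_one.mp (hM.cardP v (hin v hv hv')).le _ (h₁.1 v) _ (h₂.1 v)

theorem no_sep_out (hM : MinCE ε G P L) {G₁ G₂ : SimpleGraph V} (hsup : G₁ ⊔ G₂ = G)
    (h2 : G₂ ≠ ⊥)
    (hone : ∀ u v, Used G₁ u → Used G₂ u → Used G₁ v → Used G₂ v → u = v) {x : V}
    (hx : Used G₁ x) (hxo : Outer ε G x) (hP : ∀ p ∈ P, ¬ Used G₂ p) : False := by
  have h1 : G₁ ≠ ⊥ := by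
    rintro rfl
    obtain ⟨a, ha⟩ := hx
    exact ha
  by_cases hw : ∃ w, Used G₁ w ∧ Used G₂ w
  swap
  · exact hM.no_sep_in hsup h1 h2 hone fun v hv hv' => absurd ⟨v, hv, hv'⟩ hw
  obtain ⟨w, hw1, hw2⟩ := hw
  by_cases hr : G₁.Reachable x w
  · obtain ⟨p⟩ := hr
    have hle2 : G₂ ≤ G := hsup ▸ le_sup_right
    have hle1 : G₁ ≤ G := hsup ▸ le_sup_left
    have how : Outer ε G₂ w := by
      refine hM.planar.outer_of_walk hle2 (p.mapLe hle1) hxo fun v hv hvw hvu => hvw ?_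
      have hv1 : Used G₁ v := by
        by_cases hn : p.Nil
        · simp [Walk.nil_iff_support_eq.mp hn] at hv
          exact hv ▸ hx
        · exact used_of_mem_support hn (by simpa using hv)
      exact hone _ _ hv1 hvu hw1 hw2
    exact hM.no_split hsup (lt_of_sep ((sup_comm _ _).trans hsup) h1
      fun u v a b c d => hone u v b a d c) (hM.colorable_left hsup h2 hone) (P' := [w]) (by simp)
      (by simp) (by simp) (by simpa using how)
      (fun v hv hv' => by simpa using hone _ _ hv hv' hw1 hw2) (fun v hv _ => hP v hv) (by simp)
  · set R : Set V := {v | G₁.Reachable x v} with hR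
    have hstep : ∀ u v, G₁.Adj u v → u ∈ R → v ∈ R := fun u v h hu => hu.trans h.reachable
    set A := _root_.sub G₁ fun e => ∃ v ∈ e, v ∈ R with hA
    set B := _root_.sub G₁ fun e => ¬ ∃ v ∈ e, v ∈ R with hB
    have hAR : ∀ v, Used A v → v ∈ R := by
      rintro v ⟨u, h, z, hz, hzR⟩
      rw [Sym2.mem_iff] at hz
      rcases hz with rfl | rfl
      · exact hzR
      · exact hstep _ _ h.symm hzR
    have hno : ∀ v, Used A v → ¬ Used (B ⊔ G₂) v := by
      rintro v hv ⟨u, h | h⟩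
      · exact h.2 ⟨v, by simp, hAR v hv⟩
      · have : v = w := hone _ _ (hv.mono (sub_le _)) ⟨u, h⟩ hw1 hw2
        exact hr (this ▸ hAR v hv)
    refine hM.no_sep_in (G₁ := A) (G₂ := B ⊔ G₂) ?_ ?_ ?_ (fun u _ h h' => absurd h' (hno u h))
      (fun u h h' => absurd h' (hno u h))
    · rw [← sup_assoc, sup_sub_eq _ _ fun e _ => em _, hsup]
    · obtain ⟨a, ha⟩ := hx
      intro h
      have : A.Adj x a := ⟨ha, x, by simp, Reachable.rfl⟩
      rw [h] at this; exact this
    · intro h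
      exact h2 (le_bot_iff.mp (h ▸ le_sup_right))

theorem noSep (hM : MinCE ε G P L) : NoSep G := by
  intro G₁ G₂ hsup hone
  by_contra hcon
  push Not at hcon
  obtain ⟨h1, h2⟩ := hcon
  have hone' : ∀ u v, Used G₂ u → Used G₁ u → Used G₂ v → Used G₁ v → u = v :=
    fun u v a b c d => hone u v b a d c
  have hsup' : G₂ ⊔ G₁ = G := (sup_comm _ _).trans hsup
  have hus : ∀ v, Used G v → Used G₁ v ∨ Used G₂ v := by
    rintro v ⟨a, h⟩
    rw [← hsup] at h
    exact h.imp (fun h => ⟨a, h⟩) fun h => ⟨a, h⟩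
  by_cases hin : ∀ v, Used G₁ v → Used G₂ v → v ∈ P
  · exact hM.no_sep_in hsup h1 h2 hone hin
  push Not at hin
  obtain ⟨w, hw1, hw2, hwP⟩ := hin
  by_cases hPn : P = []
  · subst hPn
    obtain ⟨u, v, huv⟩ := ne_bot_iff_exists_adj.mp h1
    obtain ⟨e, he, hext⟩ := hM.planar.at.extreme
      (show G.Adj u v by rw [← hsup]; exact Or.inl huv)
    induction e with | _ a b
    have hab : G.Adj a b := he
    have ho : Outer ε G a := by
      intro x W hW t ht
      rw [hM.planar.at.star W hW ht hab]
      exact hext W fun h => hW (W.fst_mem_support_of_mem_edges h)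
    rcases hus a ⟨b, hab⟩ with h | h
    · exact hM.no_sep_out hsup h2 hone h ho (by simp)
    · exact hM.no_sep_out hsup' h1 hone' h ho (by simp)
  · have hex : ∀ p ∈ P, Used G₁ p → ¬ Used G₂ p := fun p hp h h' =>
      hwP (hone _ _ h h' hw1 hw2 ▸ hp)
    have hall : ∀ (Q : List V), Q.IsChain G.Adj → (∀ q ∈ Q, q ∈ P) →
        (∀ q ∈ Q, ¬ Used G₂ q) ∨ ∀ q ∈ Q, ¬ Used G₁ q := by
      intro Q
      induction Q with
      | nil => simp
      | cons q Q ih =>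
        intro hc hQ
        rcases Q with _ | ⟨r, Q⟩
        · by_cases h : Used G₁ q
          · simpa [h] using hex q (hQ q (by simp)) h
          · simp [h]
        rw [List.isChain_cons_cons] at hc
        have hqr := hc.1
        rw [← hsup] at hqr
        have hq := hex q (hQ q (by simp))
        have hr := hex r (hQ r (by simp))
        rcases ih hc.2 fun t ht => hQ t (List.mem_cons_of_mem _ ht) with h | h
        · left
          rcases hqr with h' | h'
          · exact List.forall_mem_cons.mpr ⟨hq ⟨r, h'⟩, h⟩
          · exact absurd ⟨q, h'.symm⟩ (h r (by simp))
        · right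
          rcases hqr with h' | h'
          · exact absurd ⟨q, h'.symm⟩ (h r (by simp))
          · exact List.forall_mem_cons.mpr ⟨fun h => hq h ⟨r, h'⟩, h⟩
    obtain ⟨x, hx⟩ := List.exists_mem_of_ne_nil _ hPn
    rcases hall P hM.chain (fun _ h => h) with h | h
    · exact hM.no_sep_out hsup h2 hone ((hus x (hM.used x hx)).resolve_right (h x hx))
        (hM.outP x hx) h
    · exact hM.no_sep_out hsup' h1 hone' ((hus x (hM.used x hx)).resolve_left (h x hx))
        (hM.outP x hx) h

theorem card_le (hM : MinCE ε G P L) {v : V} (hv : v ∉ P) (hu : Used G v) {S : Finset V}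
    (hS : ∀ a, G.Adj v a → a ∈ S) : (L v).card ≤ S.card := by
  classical
  by_contra hlt
  push Not at hlt
  obtain ⟨a, ha⟩ := hu
  obtain ⟨φ, hφ, hφ'⟩ := hM.ih _ (del_lt (X := {v}) rfl ha) _ _ (hM.toInst.mono (P' := P)
    (del_le {v}) (List.Sublist.refl _) (hM.chain.imp_of_mem_imp fun u w hu hw h =>
      ⟨h, fun h => hv (h ▸ hu), fun h => hv (h ▸ hw)⟩) fun _ h h' => absurd h h')
  obtain ⟨α, hα, hα'⟩ := Finset.exists_mem_notMem_of_card_lt_card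
    ((Finset.card_image_le (s := S) (f := φ)).trans_lt hlt)
  have key : ∀ w, G.Adj v w → α ≠ φ w := fun w hw h => hα' (h ▸ Finset.mem_image_of_mem φ (hS w hw))
  refine hM.no ⟨fun w => if w = v then α else φ w, fun w => ?_, fun u w huw => ?_⟩
  · dsimp only; split
    · subst w; exact hα
    · exact hφ w
  · dsimp only; split <;> split
    · subst u w; exact absurd huw (G.irrefl)
    · subst u; exact key w huw
    · subst w; exact (key u huw.symm).symm
    · exact hφ' (show (del G {v}).Adj u w from ⟨huw, by simpa, by simpa⟩)

/-- The color of a neighbor on the precolored path is in the list. -/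
theorem exists_common (hM : MinCE ε G P L) {z p : V} (hz : z ∉ P) (hp : p ∈ P)
    (h : G.Adj z p) : L p ⊆ L z := by
  by_contra hsub
  obtain ⟨α, hα⟩ := Finset.card_eq_one.mp (hM.cardP p hp)
  have hαz : α ∉ L z := by simpa [hα] using hsub
  set H := _root_.sub G fun e => e ≠ s(z, p) with hH
  have hlt : H < G := lt_of_le_of_ne (sub_le _) fun he => by
    rw [← he] at h; exact h.2 rfl
  obtain ⟨φ, hφ, hφ'⟩ := hM.ih _ hlt _ _ (hM.toInst.mono (P' := P) hlt.le (List.Sublist.refl _)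
    (hM.chain.imp_of_mem_imp fun u w hu hw huw => ⟨huw, fun he => by
      rw [Sym2.eq_iff] at he
      rcases he with ⟨rfl, -⟩ | ⟨-, rfl⟩
      · exact hz hu
      · exact hz hw⟩) fun _ h h' => absurd h h')
  have hne : φ z ≠ φ p := fun he => hαz <| by
    have := hφ p
    rw [hα, Finset.mem_singleton] at this
    rw [← this, ← he]; exact hφ z
  refine hM.no ⟨φ, hφ, fun u w huw => ?_⟩
  by_cases he : s(u, w) = s(z, p)
  · rw [Sym2.eq_iff] at he
    rcases he with ⟨rfl, rfl⟩ | ⟨rfl, rfl⟩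
    · exact hne
    · exact hne.symm
  · exact hφ' (show H.Adj u w from ⟨huw, he⟩)

theorem exists_outerCycle [Finite V] (hM : MinCE ε G P L) : ∃ n c, OuterCycle ε G n c := by
  have hex : ∃ u v, G.Adj u v ∧ u ∉ P := by
    by_contra hcon
    push Not at hcon
    choose φ hφ using hM.toInst.nonempty
    refine hM.no ⟨φ, hφ, fun u v huv he => ?_⟩
    exact hM.proper u (hcon u v huv) v (hcon v u huv.symm) huv _ (hφ u) (he ▸ hφ v)
  obtain ⟨u, v, huv, hu⟩ := hex
  have hex' : ∃ w, G.Adj u w ∧ w ≠ v := by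
    by_contra hcon
    push Not at hcon
    have h1 := hM.card_le hu ⟨v, huv⟩ (S := {v}) (by simpa using hcon)
    have h2 := hM.two u hu ⟨v, huv⟩
    simp at h1; omega
  obtain ⟨w, huw, hwv⟩ := hex'
  exact hM.noSep.exists_outerCycle hM.planar (e := s(u, v)) (e' := s(u, w)) huv huw
    (by simp [hwv.symm, huv.ne'])

theorem not_chord_of_path (hM : MinCE ε G P L) {G₁ G₂ : SimpleGraph V} (hsup : G₁ ⊔ G₂ = G)
    (hlt₁ : G₁ < G) (hlt₂ : G₂ < G) {x y : V}
    (hcommon : ∀ v, Used G₁ v → Used G₂ v → v = x ∨ v = y)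
    (h1 : G₁.Adj x y) (h2 : G₂.Adj x y) (hx₂ : Outer ε G₂ x) (hy₂ : Outer ε G₂ y)
    (hP : ∀ p ∈ P, Used G₂ p → p = x ∨ p = y) : False := by
  refine hM.no_split hsup hlt₂ (hM.ih _ hlt₁ P L (hM.toInst.mono hlt₁.le (List.Sublist.refl _)
    ?_ fun _ h h' => absurd h h')) (P' := [x, y]) (by simp) (by simpa using h1.ne)
    (by simp [h1, h2]) (by simp [hx₂, hy₂]) (by simpa using hcommon)
    (fun v hv hv' h => hv' (by simpa using hP v hv h)) (by simp)
  refine hM.chain.imp_of_mem_imp fun u v hu hv h => ?_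
  have h' := h
  rw [← hsup] at h'
  rcases h' with h' | h'
  · exact h'
  · rcases hP u hu ⟨v, h'⟩ with rfl | rfl <;> rcases hP v hv ⟨u, h'.symm⟩ with rfl | rfl
    · exact absurd rfl h.ne
    · exact h1
    · exact h1.symm
    · exact absurd rfl h.ne

theorem not_chord_of_head {p r : V} {Q : List V} (hM : MinCE ε G (p :: r :: Q) L)
    {G₁ G₂ : SimpleGraph V} (hsup : G₁ ⊔ G₂ = G)
    (hlt₁ : G₁ < G) (hlt₂ : G₂ < G) {x y : V}
    (hcommon : ∀ v, Used G₁ v → Used G₂ v → v = x ∨ v = y)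
    (h1 : G₁.Adj x y) (h2 : G₂.Adj x y) (hx₁ : Outer ε G₁ x) (hy₁ : Outer ε G₁ y)
    (hp : ¬ Used G₂ p) (hr : r = x) (hP : ∀ q ∈ r :: Q, Used G₁ q → q = x ∨ q = y) : False := by
  subst hr
  have hpr : G.Adj p r := (List.isChain_cons_cons.mp hM.chain).1
  have hpr1 : G₁.Adj p r := by
    have := hpr
    rw [← hsup] at this
    exact this.resolve_right fun h => hp ⟨r, h⟩
  have hpy : p ≠ y := by rintro rfl; exact hp ⟨r, h2.symm⟩
  refine hM.no_split ((sup_comm _ _).trans hsup) hlt₁ (hM.ih _ hlt₂ (r :: Q) L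
    (hM.toInst.mono hlt₂.le (List.sublist_cons_self _ _) ?_ ?_)) (P' := [y, r, p]) (by simp)
    (by simp [h1.ne', hpy.symm, hpr.ne'])
    (by simp [h1.symm, h2.symm, hpr1.symm])
    (by simpa using ⟨hy₁, hx₁, (hM.outP p (by simp)).mono hlt₁.le⟩)
    (fun v h h' => by rcases hcommon v h' h with rfl | rfl <;> simp)
    (fun v hv hv' h => ?_) (by simp)
  · refine hM.chain.tail.imp_of_mem_imp fun u v hu hv h => ?_
    have h' := h
    rw [← hsup] at h'
    rcases h' with h' | h'
    · rcases hP u hu ⟨v, h'⟩ with rfl | rfl <;> rcases hP v hv ⟨u, h'.symm⟩ with rfl | rfl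
      · exact absurd rfl h.ne
      · exact h2
      · exact h2.symm
      · exact absurd rfl h.ne
    · exact h'
  · intro v hv hv'
    rw [List.mem_cons] at hv
    exact (hv.resolve_right hv') ▸ hp
  · rw [List.mem_cons] at hv
    rcases hv with rfl | hv
    · simp at hv'
    · rcases hP v hv h with rfl | rfl <;> simp at hv'

theorem not_chord (hM : MinCE ε G P L) {G₁ G₂ : SimpleGraph V} (hsup : G₁ ⊔ G₂ = G)
    (hlt₁ : G₁ < G) (hlt₂ : G₂ < G) {x y : V}
    (hcommon : ∀ v, Used G₁ v → Used G₂ v → v = x ∨ v = y)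
    (h1 : G₁.Adj x y) (h2 : G₂.Adj x y) (hx₁ : Outer ε G₁ x) (hy₁ : Outer ε G₁ y)
    (hx₂ : Outer ε G₂ x) (hy₂ : Outer ε G₂ y) : False := by
  have hsup' : G₂ ⊔ G₁ = G := (sup_comm _ _).trans hsup
  have hcommon' : ∀ v, Used G₂ v → Used G₁ v → v = x ∨ v = y := fun v a b => hcommon v b a
  have A1 : ¬ ∀ p ∈ P, Used G₂ p → p = x ∨ p = y := fun h =>
    hM.not_chord_of_path hsup hlt₁ hlt₂ hcommon h1 h2 hx₂ hy₂ h
  have A2 : ¬ ∀ p ∈ P, Used G₁ p → p = x ∨ p = y := fun h =>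
    hM.not_chord_of_path hsup' hlt₂ hlt₁ hcommon' h2 h1 hx₁ hy₁ h
  have hadj : ∀ p r, G.Adj p r → ¬ Used G₂ p → Used G₁ r := by
    intro p r h hp
    rw [← hsup] at h
    rcases h with h | h
    · exact ⟨p, h.symm⟩
    · exact absurd ⟨r, h⟩ hp
  have hadj' : ∀ p r, G.Adj p r → ¬ Used G₁ p → Used G₂ r := by
    intro p r h hp
    rw [← hsup] at h
    rcases h with h | h
    · exact absurd ⟨r, h⟩ hp
    · exact ⟨p, h.symm⟩
  have B1 : ∀ {P}, MinCE ε G P L → ∀ {p r Q}, P = p :: r :: Q → ¬ Used G₂ p →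
      (∀ q ∈ r :: Q, Used G₁ q → q = x ∨ q = y) → False := by
    rintro P hM p r Q rfl hp hP
    rcases hP r (by simp) (hadj p r (List.isChain_cons_cons.mp hM.chain).1 hp) with h | h
    · exact hM.not_chord_of_head hsup hlt₁ hlt₂ hcommon h1 h2 hx₁ hy₁ hp h hP
    · exact hM.not_chord_of_head hsup hlt₁ hlt₂ (fun v a b => (hcommon v a b).symm) h1.symm h2.symm
        hy₁ hx₁ hp h fun q a b => (hP q a b).symm
  have B2 : ∀ {P}, MinCE ε G P L → ∀ {p r Q}, P = p :: r :: Q → ¬ Used G₁ p →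
      (∀ q ∈ r :: Q, Used G₂ q → q = x ∨ q = y) → False := by
    rintro P hM p r Q rfl hp hP
    rcases hP r (by simp) (hadj' p r (List.isChain_cons_cons.mp hM.chain).1 hp) with h | h
    · exact hM.not_chord_of_head hsup' hlt₂ hlt₁ hcommon' h2 h1 hx₂ hy₂ hp h hP
    · exact hM.not_chord_of_head hsup' hlt₂ hlt₁ (fun v a b => (hcommon' v a b).symm) h2.symm
        h1.symm hy₂ hx₂ hp h fun q a b => (hP q a b).symm
  have hE1 : ∀ v, v = x ∨ v = y → Used G₁ v := by
    rintro v (rfl | rfl)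
    exacts [⟨y, h1⟩, ⟨x, h1.symm⟩]
  have hE2 : ∀ v, v = x ∨ v = y → Used G₂ v := by
    rintro v (rfl | rfl)
    exacts [⟨y, h2⟩, ⟨x, h2.symm⟩]
  have hc := hM.chain
  have b1 := @B1 _ hM
  have b2 := @B2 _ hM
  have b1' := @B1 _ hM.reverse
  have b2' := @B2 _ hM.reverse
  have hlen := hM.len
  clear B1 B2 hM hcommon' hsup' hsup hlt₁ hlt₂ h1 h2 hx₁ hy₁ hx₂ hy₂
  generalize hE : (fun v => v = x ∨ v = y) = E at *
  have hE : ∀ v, (v = x ∨ v = y) = E v := fun v => by rw [← hE]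
  simp only [hE] at *
  have key := fun p r h => And.intro (hadj p r h) (hadj' p r h)
  match P, hlen with
  | [], _ => simp at A1
  | [a], _ =>
    simp at A1 A2
    have := And.intro (hE1 a) (hE2 a)
    have := hcommon a
    tauto
  | [a, b], _ =>
    clear b1 b2 b1' b2'
    simp at A1 A2 hc
    have := And.intro (hE1 a) (hE2 a)
    have := hcommon a
    have := And.intro (hE1 b) (hE2 b)
    have := hcommon b
    have := key a b hc
    have := key b a hc.symm
    clear hcommon key hadj hadj' hE1 hE2 hc hE
    grind +splitImp
  | [a, b, c], _ =>
    simp only [List.reverse_cons, List.reverse_nil, List.nil_append,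
      List.cons_append] at b1' b2'
    replace b1 := b1 rfl
    replace b2 := b2 rfl
    replace b1' := b1' rfl
    replace b2' := b2' rfl
    simp at A1 A2 hc b1 b2 b1' b2'
    have := And.intro (hE1 a) (hE2 a)
    have := hcommon a
    have := And.intro (hE1 b) (hE2 b)
    have := hcommon b
    have := And.intro (hE1 c) (hE2 c)
    have := hcommon c
    have := key a b hc.1
    have := key b a hc.1.symm
    have := key b c hc.2
    have := key c b hc.2.symm
    clear hcommon key hadj hadj' hE1 hE2 hc hE
    grind +splitImp
  | [a, b, c, d], _ =>
    simp only [List.reverse_cons, List.reverse_nil, List.nil_append,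
      List.cons_append] at b1' b2'
    replace b1 := b1 rfl
    replace b2 := b2 rfl
    replace b1' := b1' rfl
    replace b2' := b2' rfl
    simp at A1 A2 hc b1 b2 b1' b2'
    have := And.intro (hE1 a) (hE2 a)
    have := hcommon a
    have := And.intro (hE1 b) (hE2 b)
    have := hcommon b
    have := And.intro (hE1 c) (hE2 c)
    have := hcommon c
    have := And.intro (hE1 d) (hE2 d)
    have := hcommon d
    have := key a b hc.1
    have := key b a hc.1.symm
    have := key b c hc.2.1
    have := key c b hc.2.1.symm
    have := key c d hc.2.2
    have := key d c hc.2.2.symm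
    clear hcommon key hadj hadj' hE1 hE2 hc hE
    grind +splitImp
  | _ :: _ :: _ :: _ :: _ :: _, h => simp at h; omega

end MinCE

namespace Splits

variable {G₁ G₂ : SimpleGraph V} {x y : V} {Q : G.Walk x y} {c : ℕ → V} {i a b : ℕ}

theorem lt₁ (h : Splits ε G G₁ G₂ Q c i a b) (hb : 0 < b) : G₁ < G :=
  lt_of_le_of_ne (h.sup ▸ le_sup_left) fun he => (h.right 0 hb).1 <| by
    rw [he, ← h.sup]; exact Or.inr (h.right 0 hb).2

theorem lt₂ (h : Splits ε G G₁ G₂ Q c i a b) (ha : 0 < a) : G₂ < G :=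
  lt_of_le_of_ne (h.sup ▸ le_sup_right) fun he => (h.left 0 ha).2 <| by
    rw [he, ← h.sup]; exact Or.inl (h.left 0 ha).1

end Splits

namespace OuterCycle

variable {n : ℕ} {c : ℕ → V}

theorem succ_eq (hC : OuterCycle ε G n c) {i j : ℕ} (h : c i = c j) (k : ℕ) :
    c (i + k) = c (j + k) := by
  rw [hC.eq_iff] at h ⊢
  exact Nat.ModEq.add_right k h

theorem five_le (hC : OuterCycle ε G n c) (hG : G5 G) : 5 ≤ n := by
  by_contra hcon
  have h3 := hC.three
  have h0 := hC.per 0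
  obtain rfl | rfl : n = 3 ∨ n = 4 := by omega
  · have := hC.adj 2
    rw [show 2 + 1 = 0 + 3 from rfl, h0] at this
    exact hG.tri (hC.adj 0) (hC.adj 1) this.symm
  · have := hC.adj 3
    rw [show 3 + 1 = 0 + 4 from rfl, h0] at this
    have := hG.sq (hC.adj 0).symm (hC.adj 1) this (hC.adj 2).symm
      fun h => by simpa using hC.inj 0 2 (by omega) (by omega) h
    simpa using hC.inj 1 3 (by omega) (by omega) this

theorem not_adj (hC : OuterCycle ε G n c) (hM : MinCE ε G P L) {i a : ℕ} (ha : 2 ≤ a)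
    (han : a + 2 ≤ n) : ¬ G.Adj (c i) (c (i + a)) := by
  intro h
  obtain ⟨b, rfl⟩ : ∃ b, n = a + b := ⟨n - a, by omega⟩
  obtain ⟨G₁, G₂, hs⟩ := hC.split hM.planar (i := i) (a := a) (b := b) rfl (by omega) (by omega)
    (Q := .cons h .nil) (by simp [h.ne]) (fun t ht => by simpa using ht) (fun t ht => by
      rw [Walk.edges_cons, Walk.edges_nil, List.mem_singleton, Sym2.eq_iff] at ht
      rcases ht with ⟨h1, h2⟩ | ⟨h1, h2⟩
      · rw [hC.succ_eq h1 1, hC.add_eq_iff (by omega) (by omega)] at h2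
        omega
      · rw [hC.succ_eq h1 1, add_assoc] at h2
        have := (hC.add_eq_iff (i := i) (s := a + 1) (t := 0) (by omega) (by omega)).mp h2
        omega)
  have he := hs.edge s(c i, c (i + a)) (by simp)
  have hx := hs.outer (c i) (by simp)
  have hy := hs.outer (c (i + a)) (by simp)
  exact hM.not_chord hs.sup (hs.lt₁ (by omega)) (hs.lt₂ (by omega))
    (fun v h h' => by simpa using hs.common v h h') he.1 he.2 hx.1 hy.1 hx.2 hy.2

theorem exists_eq (hC : OuterCycle ε G n c) {v : V} (hu : Used G v) (ho : Outer ε G v) :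
    ∃ i, v = c i := by
  by_contra hcon
  push Not at hcon
  exact hC.not_outer hcon hu ho

theorem neighbor (hC : OuterCycle ε G n c) (hM : MinCE ε G P L) {k : ℕ} {v : V}
    (h : G.Adj (c k) v) (hv : ∃ j, v = c j) : v = c (k + 1) ∨ ∃ k', v = c k' ∧
      (∀ t, c (k' + t + 1) = c (k + t)) ∧ ∀ m, k = m + 1 → v = c m := by
  obtain ⟨j, rfl⟩ := hv
  obtain ⟨t, ht, hj⟩ := hC.exists_lt k j
  rw [hj] at h ⊢
  have h3 := hC.three
  by_cases h1 : t = 1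
  · subst h1; exact Or.inl rfl
  by_cases h2 : t + 1 = n
  · right
    refine ⟨k + t, rfl, fun s => ?_, ?_⟩
    · rw [show k + t + s + 1 = k + s + n by omega, hC.per]
    · rintro m rfl
      rw [show m + 1 + t = m + n by omega, hC.per]
  · by_cases h0 : t = 0
    · subst h0; exact absurd rfl h.ne
    · exact absurd h (hC.not_adj hM (by omega) (by omega))

theorem exists_shift (hC : OuterCycle ε G n c) (hM : MinCE ε G P L) :
    ∃ P' c', MinCE ε G P' L ∧ OuterCycle ε G n c' ∧ P' = (List.range P'.length).map c' := by
  have hex : ∀ v ∈ P, ∃ i, v = c i := fun v hv => hC.exists_eq (hM.used v hv) (hM.outP v hv)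
  suffices ∃ k, P = (List.range P.length).map (fun i => c (i + k)) ∨
      P.reverse = (List.range P.length).map (fun i => c (i + k)) by
    obtain ⟨k, h | h⟩ := this
    · exact ⟨P, _, hM, hC.shift k, h⟩
    · exact ⟨P.reverse, _, hM.reverse, hC.shift k, by rwa [List.length_reverse]⟩
  have hc := hM.chain
  have hn := hM.nodup
  have hlen := hM.len
  match P, hlen with
  | [], _ => exact ⟨0, by simp⟩
  | [a], _ =>
    obtain ⟨k, rfl⟩ := hex a (by simp)
    exact ⟨k, by simp⟩
  | [a, b], _ =>
    obtain ⟨k, rfl⟩ := hex a (by simp)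
    simp at hc
    rcases hC.neighbor hM hc (hex b (by simp)) with rfl | ⟨k', rfl, h1, -⟩
    · exact ⟨k, by simp [List.range_succ, add_comm]⟩
    · refine ⟨k', ?_⟩
      have := h1 0
      simp [List.range_succ, add_comm] at this ⊢
      grind
  | [a, b, d], _ =>
    obtain ⟨k, rfl⟩ := hex a (by simp)
    simp at hc hn
    rcases hC.neighbor hM hc.1 (hex b (by simp)) with rfl | ⟨k', rfl, h1, -⟩
    · rcases hC.neighbor hM hc.2 (hex d (by simp)) with rfl | ⟨k', -, -, h⟩
      · exact ⟨k, by simp [List.range_succ, add_comm, add_left_comm]⟩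
      · exact absurd (h k rfl).symm hn.1.2
    · rcases hC.neighbor hM hc.2 (hex d (by simp)) with rfl | ⟨k'', rfl, h2, -⟩
      · exact absurd (h1 0).symm hn.1.2
      · refine ⟨k'', Or.inr ?_⟩
        have e1 := h2 0
        have e2 := h2 1
        have e3 := h1 0
        simp [List.range_succ, add_comm, add_left_comm] at e1 e2 e3 ⊢
        grind
  | [a, b, d, e], _ =>
    obtain ⟨k, rfl⟩ := hex a (by simp)
    simp at hc hn
    rcases hC.neighbor hM hc.1 (hex b (by simp)) with rfl | ⟨k', rfl, h1, -⟩
    · rcases hC.neighbor hM hc.2.1 (hex d (by simp)) with rfl | ⟨k', -, -, h⟩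
      · rcases hC.neighbor hM hc.2.2 (hex e (by simp)) with rfl | ⟨k', -, -, h⟩
        · exact ⟨k, by simp [List.range_succ, add_comm, add_left_comm]⟩
        · exact absurd (h (k + 1) rfl).symm hn.2.1.2
      · exact absurd (h k rfl).symm hn.1.2.1
    · rcases hC.neighbor hM hc.2.1 (hex d (by simp)) with rfl | ⟨k'', rfl, h2, -⟩
      · exact absurd (h1 0).symm hn.1.2.1
      · rcases hC.neighbor hM hc.2.2 (hex e (by simp)) with rfl | ⟨k₃, rfl, h3, -⟩
        · exact absurd (h2 0).symm hn.2.1.2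
        refine ⟨k₃, Or.inr ?_⟩
        have e1 := h3 0
        have e2 := h3 1
        have e3 := h3 2
        have e4 := h2 0
        have e5 := h2 1
        have e6 := h1 0
        simp [List.range_succ, add_comm, add_left_comm] at e1 e2 e3 e4 e5 e6 ⊢
        grind
  | _ :: _ :: _ :: _ :: _ :: _, h => simp at h; omega

end OuterCycle

variable {n : ℕ} {c : ℕ → V}

theorem Finset.exists_mem_notMem_insert {S T : Finset ℕ} (h : T.card + 2 ≤ S.card) (β : ℕ) :
    ∃ α ∈ S, α ∉ T ∧ α ≠ β := by
  obtain ⟨α, hα, h'⟩ := Finset.exists_mem_notMem_of_card_lt_card (s := insert β T) (t := S)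
    ((Finset.card_insert_le _ _).trans_lt (by omega))
  simp only [Finset.mem_insert, not_or] at h'
  exact ⟨α, hα, h'.2, h'.1⟩

namespace OuterCycle

theorem isChain (hC : OuterCycle ε G n c) (l : ℕ) : ((List.range l).map c).IsChain G.Adj := by
  rw [List.isChain_iff_getElem]
  intro i hi
  simpa using hC.adj i

theorem nodup (hC : OuterCycle ε G n c) {l : ℕ} (hl : l ≤ n) : ((List.range l).map c).Nodup :=
  List.nodup_range.map_on fun i hi j hj h => hC.inj i j
    (by simp at hi; omega) (by simp at hj; omega) h

theorem adj_iff (hC : OuterCycle ε G n c) (hM : MinCE ε G P L) {i j : ℕ} (hij : i < j)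
    (hj : j < n) : G.Adj (c i) (c j) ↔ j = i + 1 ∨ i = 0 ∧ j + 1 = n := by
  constructor
  · intro h
    by_contra hcon
    obtain ⟨a, rfl⟩ : ∃ a, j = i + a := ⟨j - i, by omega⟩
    exact hC.not_adj hM (by omega) (by omega) h
  · rintro (rfl | ⟨rfl, h⟩)
    · exact hC.adj i
    · have := hC.adj j
      have h0 := hC.per 0
      rw [h, ← Nat.zero_add n, h0] at this
      exact this.symm

theorem extend (hC : OuterCycle ε G n c) {l : ℕ} (hl : l < 4)
    (hM : MinCE ε G ((List.range l).map c) L) :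
    ∃ L', MinCE ε G ((List.range (l + 1)).map c) L' := by
  classical
  have h5 := hC.five_le hM.g5
  have hnot : ∀ k, l ≤ k → k < n → c k ∉ (List.range l).map c := by
    intro k hk hkn hmem
    simp only [List.mem_map, List.mem_range] at hmem
    obtain ⟨i, hi, h⟩ := hmem
    have := hC.inj i k (by omega) hkn h
    omega
  have hcard : ∀ i < l, (L (c i)).card = 1 := fun i hi => hM.cardP _ (by simp; exact ⟨i, hi, rfl⟩)
  have htwo : ∀ k, l ≤ k → k < n → 2 ≤ (L (c k)).card := fun k hk hkn =>
    hM.two _ (hnot k hk hkn) ⟨_, hC.adj k⟩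
  obtain ⟨α, hα, h1, h3⟩ : ∃ α ∈ L (c l), (∀ m, l = m + 1 → α ∉ L (c m)) ∧
      (l = 3 → n = 5 → ∃ β ∈ L (c 4), β ∉ L (c 0) ∧ β ≠ α) := by
    have h2 := htwo l le_rfl (by omega)
    by_cases h : l = 3 ∧ n = 5
    · obtain ⟨rfl, rfl⟩ := h
      have h0 := hcard 0 (by omega)
      have h2' := hcard 2 (by omega)
      have h4 := htwo 4 (by omega) (by omega)
      rcases hM.indep _ (hnot 3 le_rfl (by omega)) _ (hnot 4 (by omega) (by omega)) (hC.adj 3)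
        with h | h
      · obtain ⟨β, hβ, h⟩ := Finset.exists_mem_notMem_of_card_lt_card (s := L (c 0))
          (t := L (c 4)) (by omega)
        obtain ⟨α, hα, h', hαβ⟩ := Finset.exists_mem_notMem_insert (S := L (c 3)) (T := L (c 2))
          (by omega) β
        exact ⟨α, hα, fun m hm => by obtain rfl : m = 2 := by omega
                                     exact h', fun _ _ => ⟨β, hβ, h, hαβ.symm⟩⟩
      · obtain ⟨α, hα, h'⟩ := Finset.exists_mem_notMem_of_card_lt_card (s := L (c 2))
          (t := L (c 3)) (by omega)
        exact ⟨α, hα, fun m hm => by obtain rfl : m = 2 := by omega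
                                     exact h',
          fun _ _ => Finset.exists_mem_notMem_insert (by omega) α⟩
    · have : ∃ α ∈ L (c l), ∀ m, l = m + 1 → α ∉ L (c m) := by
        rcases l with - | m
        · obtain ⟨α, hα⟩ := hM.nonempty (c 0)
          exact ⟨α, hα, fun m hm => by omega⟩
        · have := hcard m (by omega)
          obtain ⟨α, hα, h⟩ := Finset.exists_mem_notMem_of_card_lt_card (s := L (c m))
            (t := L (c (m + 1))) (by omega)
          exact ⟨α, hα, fun m' hm => by obtain rfl : m' = m := by omega
                                        exact h⟩
      obtain ⟨α, hα, h'⟩ := this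
      exact ⟨α, hα, h', fun h3 h5 => absurd ⟨h3, h5⟩ h⟩
  set L' := Function.update L (c l) {α} with hL'
  have hl' : L' (c l) = {α} := Function.update_self ..
  have hne : ∀ v, v ≠ c l → L' v = L v := fun v h => Function.update_of_ne h ..
  have hmem : ∀ v, v ∈ (List.range (l + 1)).map c ↔ v ∈ (List.range l).map c ∨ v = c l := by
    simp [List.range_succ]
  have hsub : ∀ v, L' v ⊆ L v := by
    intro v
    by_cases h : v = c l
    · rw [h, hl']; simpa using hα
    · rw [hne v h]
  have hPne : ∀ p ∈ (List.range l).map c, p ≠ c l := by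
    rintro p hp rfl
    exact hnot l le_rfl (by omega) hp
  have hcardP : ∀ v ∈ (List.range (l + 1)).map c, (L' v).card = 1 := by
    intro v hv
    rcases (hmem v).mp hv with hv | rfl
    · rw [hne v (hPne v hv)]; exact hM.cardP v hv
    · rw [hl']; simp
  have hlast : ∀ p ∈ (List.range l).map c, G.Adj p (c l) → α ∉ L p := by
    intro p hp h
    simp only [List.mem_map, List.mem_range] at hp
    obtain ⟨i, hi, rfl⟩ := hp
    exact h1 i (by have := (hC.adj_iff hM hi (by omega)).mp h; omega)
  refine ⟨L', ⟨⟨hM.planar, hM.g5, by simpa using hl, hC.nodup (by omega), hC.isChain _, ?_, hcardP,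
    ?_, ?_, ?_, ?_, ?_⟩, hM.ih, fun ⟨φ, h, h'⟩ => hM.no ⟨φ, fun v => hsub v (h v), h'⟩, ?_⟩⟩
  · simp only [List.mem_map, List.mem_range]
    rintro v ⟨i, -, rfl⟩
    exact hC.outer hM.planar i
  · intro u hu v hv h γ hγ
    rcases (hmem u).mp hu with hu | rfl <;> rcases (hmem v).mp hv with hv | rfl
    · rw [hne v (hPne v hv)]; rw [hne u (hPne u hu)] at hγ; exact hM.proper u hu v hv h γ hγ
    · rw [hl', Finset.mem_singleton]; rw [hne u (hPne u hu)] at hγ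
      rintro rfl; exact hlast u hu h hγ
    · rw [hl', Finset.mem_singleton] at hγ; rw [hne v (hPne v hv), hγ]
      exact hlast v hv h.symm
    · exact absurd rfl h.ne
  · intro v hv hu
    simp only [hmem, not_or] at hv
    rw [hne v hv.2]; exact hM.two v hv.1 hu
  · intro v hv hu
    simp only [hmem, not_or] at hv
    rw [hne v hv.2]; exact hM.three v hv.1 hu
  · intro u hu v hv
    simp only [hmem, not_or] at hu hv
    rw [hne v hv.2, hne u hu.2]; exact hM.indep u hu.1 v hv.1
  · intro z hz
    have hz' := hz
    simp only [hmem, not_or] at hz'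
    rw [hne z hz'.2]
    choose! φ hφ using fun v hv => Finset.card_eq_one.mp (hcardP v hv)
    by_cases hs : l = 3 ∧ n = 5 ∧ z = c 4
    · obtain ⟨rfl, rfl, rfl⟩ := hs
      obtain ⟨β, hβ, hβ0, hβα⟩ := h3 rfl rfl
      refine ⟨β, hβ, fun p hp h => ?_⟩
      rcases (hmem p).mp hp with hp | rfl
      · rw [hne p (hPne p hp)]
        simp only [List.mem_map, List.mem_range] at hp
        obtain ⟨i, hi, rfl⟩ := hp
        have := (hC.adj_iff hM (show i < 4 by omega) (by omega)).mp h.symm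
        obtain rfl : i = 0 := by omega
        exact hβ0
      · rwa [hl', Finset.mem_singleton]
    · have h4 : ∀ p₀ p₁ p₂ p₃, (List.range (l + 1)).map c = [p₀, p₁, p₂, p₃] → G.Adj z p₀ →
          G.Adj z p₃ → 3 ≤ (L z).card := by
        intro p₀ p₁ p₂ p₃ hp h0 h3
        obtain rfl : l = 3 := by simpa using congrArg List.length hp
        simp [List.range_succ] at hp
        obtain ⟨rfl, rfl, rfl, rfl⟩ := hp
        refine hM.three z hz'.1 ⟨_, h0⟩ fun ho => hs ⟨rfl, ?_⟩
        obtain ⟨t, rfl⟩ := hC.exists_eq ⟨_, h0⟩ ho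
        obtain ⟨t', ht', h⟩ := hC.exists_lt 0 t
        rw [h, Nat.zero_add] at h0 h3 hz ⊢
        have h4 : 4 ≤ t' := by
          by_contra hlt
          exact hz (by simp; exact ⟨t', by omega, rfl⟩)
        have e0 := (hC.adj_iff hM (by omega) ht').mp h0.symm
        have e3 := (hC.adj_iff hM (show 3 < t' by omega) ht').mp h3.symm
        obtain rfl : t' = 4 := by omega
        exact ⟨by omega, rfl⟩
      obtain ⟨β, hβ, h⟩ := hM.g5.exists_color (P := (List.range (l + 1)).map c) (by simpa using hl)
        (hC.isChain _) (hC.nodup (by omega)) hz (S := L z) (hM.nonempty z) (hM.two z hz'.1) h4 φ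
      exact ⟨β, hβ, fun p hp hzp => by rw [hφ p hp, Finset.mem_singleton]; exact h p hp hzp⟩
  · simp only [List.mem_map, List.mem_range]
    rintro v ⟨i, -, rfl⟩
    exact ⟨_, hC.adj i⟩

/-- A minimal counterexample has one whose precolored path has exactly four vertices. -/
theorem exists_extension (hC : OuterCycle ε G n c) (l : ℕ) (hl : l ≤ 4)
    (hM : MinCE ε G ((List.range l).map c) L) : ∃ L', MinCE ε G [c 0, c 1, c 2, c 3] L' := by
  induction hd : 4 - l generalizing l L with
  | zero =>
    obtain rfl : l = 4 := by omega
    exact ⟨L, by simpa [List.range_succ] using hM⟩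
  | succ k ih =>
    obtain ⟨L', h⟩ := hC.extend (by omega) hM
    exact ih (l + 1) (by omega) h (by omega)

end OuterCycle

/-- A minimal counterexample whose outer cycle starts with the precolored path. -/
structure Core (ε : Sym2 V → Sym2 V → ZMod 2) (G : SimpleGraph V) (L : V → Finset ℕ) (n : ℕ)
    (c : ℕ → V) : Prop where
  cycle : OuterCycle ε G n c
  minCE : MinCE ε G [c 0, c 1, c 2, c 3] L

/-- The two parts of a graph separated by a path `Q` between the vertices `c i` and `c j` of the
outer cycle. -/
structure Cut (ε : Sym2 V → Sym2 V → ZMod 2) (G G₁ G₂ : SimpleGraph V) {x y : V}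
    (Q : G.Walk x y) (n : ℕ) (c : ℕ → V) (i j : ℕ) : Prop where
  sup : G₁ ⊔ G₂ = G
  lt₁ : G₁ < G
  lt₂ : G₂ < G
  common : ∀ v, Used G₁ v → Used G₂ v → v ∈ Q.support
  edge : ∀ e ∈ Q.edges, e ∈ G₁.edgeSet ∧ e ∈ G₂.edgeSet
  outer : ∀ v ∈ Q.support, Outer ε G₁ v ∧ Outer ε G₂ v
  adj₁ : ∀ t, i ≤ t → t < j → G₁.Adj (c t) (c (t + 1))
  adj₂ : ∀ t < n, t < i ∨ j ≤ t → G₂.Adj (c t) (c (t + 1))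
  unused₁ : ∀ t < n, t < i ∨ j < t → ¬ Used G₁ (c t)
  unused₂ : ∀ t, i < t → t < j → ¬ Used G₂ (c t)

namespace Core

variable (hK : Core ε G L n c)
include hK

theorem five_le : 5 ≤ n := hK.cycle.five_le hK.minCE.g5

theorem inj {i j : ℕ} (hi : i < n) (hj : j < n) (h : c i = c j) : i = j :=
  hK.cycle.inj i j hi hj h

theorem adj_iff {i j : ℕ} (hi : i < n) (hj : j < n) : G.Adj (c i) (c j) ↔
    j = i + 1 ∨ i = j + 1 ∨ i = 0 ∧ j + 1 = n ∨ j = 0 ∧ i + 1 = n := by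
  have := hK.five_le
  rcases lt_trichotomy i j with h | rfl | h
  · rw [hK.cycle.adj_iff hK.minCE h hj]; omega
  · simp only [SimpleGraph.irrefl, false_iff]; omega
  · rw [G.adj_comm, hK.cycle.adj_iff hK.minCE h hi]; omega

theorem exists_lt (i : ℕ) : ∃ t < n, c i = c t := by
  obtain ⟨t, ht, h⟩ := hK.cycle.exists_lt 0 i
  exact ⟨t, ht, by rwa [zero_add] at h⟩

theorem mem_iff {i : ℕ} (hi : i < n) : c i ∈ [c 0, c 1, c 2, c 3] ↔ i < 4 := by
  have h5 := hK.five_le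
  constructor
  · intro h
    simp only [List.mem_cons, List.not_mem_nil, or_false] at h
    rcases h with h | h | h | h <;> have := hK.inj hi (by omega) h <;> omega
  · intro h
    interval_cases i <;> simp

omit hK in
theorem off_notMem {v : V} (hv : ∀ i, v ≠ c i) : v ∉ [c 0, c 1, c 2, c 3] := by simp [hv]

theorem off_card {u v : V} (hv : ∀ i, v ≠ c i) (h : G.Adj v u) : 3 ≤ (L v).card :=
  hK.minCE.three v (off_notMem hv) ⟨u, h⟩ (hK.cycle.not_outer hv ⟨u, h⟩)

theorem two_le {i : ℕ} (hi : 4 ≤ i) (hin : i < n) : 2 ≤ (L (c i)).card :=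
  hK.minCE.two _ (by rw [hK.mem_iff hin]; omega) ⟨_, hK.cycle.adj i⟩

theorem three_le {i j : ℕ} (hi : 4 ≤ i) (hin : i < n) (hj : 4 ≤ j) (hjn : j < n)
    (h : G.Adj (c i) (c j)) (hs : (L (c i)).card < 3) : 3 ≤ (L (c j)).card :=
  (hK.minCE.indep _ (by rw [hK.mem_iff hin]; omega) _ (by rw [hK.mem_iff hjn]; omega) h).resolve_left
    (by omega)

theorem exists_cut {i j : ℕ} (hij : i < j) (hj : j < n) {Q : G.Walk (c i) (c j)} (hQ : Q.IsPath)
    (hQs : ∀ t, c t ∈ Q.support → c t = c i ∨ c t = c j)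
    (hQe : ∀ t, s(c t, c (t + 1)) ∉ Q.edges) : ∃ G₁ G₂, Cut ε G G₁ G₂ Q n c i j := by
  obtain ⟨a, rfl⟩ : ∃ a, j = i + a := ⟨j - i, by omega⟩
  obtain ⟨b, rfl⟩ : ∃ b, n = a + b := ⟨n - a, by omega⟩
  obtain ⟨G₁, G₂, hs⟩ := hK.cycle.split hK.minCE.planar rfl (by omega) (by omega) hQ hQs hQe
  have adj₁ : ∀ t, i ≤ t → t < i + a → G₁.Adj (c t) (c (t + 1)) := by
    intro t h h'
    obtain ⟨r, rfl⟩ := Nat.exists_eq_add_of_le h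
    exact (hs.left r (by omega)).1
  have adj₂ : ∀ t < a + b, t < i ∨ i + a ≤ t → G₂.Adj (c t) (c (t + 1)) := by
    intro t htn ht
    rcases ht with ht | ht
    · have := (hs.right (b + t - i) (by omega)).2
      rw [show i + a + (b + t - i) = t + (a + b) by omega, hK.cycle.per,
        show t + (a + b) + 1 = t + 1 + (a + b) by omega, hK.cycle.per] at this
      exact this
    · obtain ⟨r, rfl⟩ := Nat.exists_eq_add_of_le ht
      exact (hs.right r (by omega)).2
  have key : ∀ t < a + b, c t ∈ Q.support → t = i ∨ t = i + a := fun t ht h =>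
    (hQs t h).imp (hK.inj ht (by omega)) (hK.inj ht (by omega))
  refine ⟨G₁, G₂, hs.sup, hs.lt₁ (by omega), hs.lt₂ (by omega), hs.common, hs.edge, hs.outer,
    adj₁, adj₂, fun t htn ht hu => ?_, fun t h h' hu => ?_⟩
  · have := key t htn (hs.common _ hu ⟨_, adj₂ t htn (by omega)⟩)
    omega
  · have := key t (by omega) (hs.common _ ⟨_, adj₁ t h.le h'⟩ hu)
    omega

omit hK in
theorem path_two {u v w : V} (h₁ : G.Adj u v) (h₂ : G.Adj v w) (huw : u ≠ w) :
    (Walk.cons h₁ (.cons h₂ .nil)).IsPath := by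
  simp [h₁.ne, h₂.ne, huw]

/-- There is no path of length two through an inner vertex between vertices of the outer cycle
in `G`, except if it starts at one of the two middle vertices of the precolored path. -/
theorem chord_two {u : V} (hu : ∀ i, u ≠ c i) {i j : ℕ} (hij : i < j) (hj : j < n)
    (hi : G.Adj (c i) u) (huj : G.Adj u (c j)) : i = 1 ∨ i = 2 := by
  by_contra hcon
  have h5 := hK.five_le
  have hne : c i ≠ c j := fun h => hij.ne (hK.inj (hij.trans hj) hj h)
  obtain ⟨G₁, G₂, h⟩ := hK.exists_cut hij hj (Q := .cons hi (.cons huj .nil))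
    (path_two hi huj hne) (fun t ht => by simpa [(hu t).symm] using ht)
    (fun t ht => by
      have h1 := hu t
      have h2 := hu (t + 1)
      simp only [Walk.edges_cons, Walk.edges_nil, List.mem_cons, List.not_mem_nil, or_false,
        Sym2.eq_iff] at ht
      grind)
  have e1 := h.edge s(c i, u) (by simp)
  have e2 := h.edge s(u, c j) (by simp)
  have o1 := h.outer (c i) (by simp)
  have o2 := h.outer u (by simp)
  have o3 := h.outer (c j) (by simp)
  rcases Nat.eq_zero_or_pos i with rfl | hpos
  · have h3 : 3 ≤ j := by
      by_contra hlt
      obtain rfl | rfl : j = 1 ∨ j = 2 := by omega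
      · exact hK.minCE.g5.tri hi huj (hK.cycle.adj 0)
      · exact hu 1 (hK.minCE.g5.sq hi.symm huj (hK.cycle.adj 0).symm (hK.cycle.adj 1) hne)
    refine hK.minCE.no_split h.sup h.lt₂ (hK.minCE.ih _ h.lt₁ _ _ (hK.minCE.toInst.mono h.lt₁.le
      (List.Sublist.refl _) ?_ (by simp))) (P' := [c j, u, c 0]) (by simp)
      (by simp [huj.ne', hi.ne', hne.symm]) ?_ ?_ ?_ ?_ (by simp)
    · simp only [List.isChain_cons_cons, List.IsChain.singleton, and_true]
      exact ⟨h.adj₁ 0 (by omega) (by omega), h.adj₁ 1 (by omega) (by omega),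
        h.adj₁ 2 (by omega) (by omega)⟩
    · simp only [List.isChain_cons_cons, List.IsChain.singleton, and_true]
      exact ⟨⟨e2.2.symm, .inl e2.1.symm⟩, e1.2.symm, .inl e1.1.symm⟩
    · simp [o1.2, o2.2, o3.2]
    · intro v hv hv'
      have := h.common v hv hv'
      simp at this ⊢; tauto
    · simp only [List.mem_cons, List.not_mem_nil, or_false, not_or]
      rintro v (rfl | rfl | rfl | rfl) hv
      · exact absurd rfl hv.2.2
      · exact h.unused₂ 1 (by omega) (by omega)
      · exact h.unused₂ 2 (by omega) (by omega)
      · refine h.unused₂ 3 (by omega) (lt_of_le_of_ne h3 ?_)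
        rintro rfl; exact hv.1 rfl
  · have h3 : 3 ≤ i := by omega
    refine hK.minCE.no_split ((sup_comm _ _).trans h.sup) h.lt₁ (hK.minCE.ih _ h.lt₂ _ _
      (hK.minCE.toInst.mono h.lt₂.le
      (List.Sublist.refl _) ?_ (by simp))) (P' := [c i, u, c j]) (by simp)
      (by simp [huj.ne, hi.ne, hne]) ?_ ?_ ?_ ?_ (by simp)
    · simp only [List.isChain_cons_cons, List.IsChain.singleton, and_true]
      exact ⟨h.adj₂ 0 (by omega) (by omega), h.adj₂ 1 (by omega) (by omega),
        h.adj₂ 2 (by omega) (by omega)⟩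
    · simp only [List.isChain_cons_cons, List.IsChain.singleton, and_true]
      exact ⟨⟨e1.1, .inl e1.2⟩, e2.1, .inl e2.2⟩
    · simp [o1.1, o2.1, o3.1]
    · intro v hv hv'
      have := h.common v hv' hv
      simpa using this
    · simp only [List.mem_cons, List.not_mem_nil, or_false, not_or]
      rintro v (rfl | rfl | rfl | rfl) hv
      · exact h.unused₁ 0 (by omega) (by omega)
      · exact h.unused₁ 1 (by omega) (by omega)
      · exact h.unused₁ 2 (by omega) (by omega)
      · refine h.unused₁ 3 (by omega) (.inl (lt_of_le_of_ne h3 ?_))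
        rintro rfl; exact hv.1 rfl

theorem chord_two' {u : V} (hu : ∀ i, u ≠ c i) {i j : ℕ} (hi : 3 ≤ i) (hin : i < n) (hj : 3 ≤ j)
    (hj : j < n) (hui : G.Adj u (c i)) (huj : G.Adj u (c j)) : i = j := by
  rcases lt_trichotomy i j with h | h | h
  · have := hK.chord_two hu h (by omega) hui.symm huj
    omega
  · exact h
  · have := hK.chord_two hu h (by omega) huj.symm hui
    omega

theorem chord_three_of_lt {x y : V} (hx : ∀ i, x ≠ c i) (hy : ∀ i, y ≠ c i) {i j : ℕ} (hi : 4 ≤ i)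
    (hij : i < j) (hj : j < n) (h1 : G.Adj (c i) x) (h2 : G.Adj x y) (h3 : G.Adj y (c j)) :
    3 ≤ (L (c i)).card ∧ 3 ≤ (L (c j)).card := by
  by_contra hcon
  have hne : c i ≠ c j := fun h => hij.ne (hK.inj (hij.trans hj) hj h)
  obtain ⟨G₁, G₂, h⟩ := hK.exists_cut hij hj (Q := .cons h1 (.cons h2 (.cons h3 .nil)))
    (by simp [h1.ne, h2.ne, h3.ne, hne, hx, (hy _).symm])
    (fun t ht => by simpa [(hx t).symm, (hy t).symm] using ht)
    (fun t ht => by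
      have h1 := hx t
      have h2 := hx (t + 1)
      have h1 := hy t
      have h2 := hy (t + 1)
      simp only [Walk.edges_cons, Walk.edges_nil, List.mem_cons, List.not_mem_nil, or_false,
        Sym2.eq_iff] at ht
      grind)
  have e1 := h.edge s(c i, x) (by simp)
  have e2 := h.edge s(x, y) (by simp)
  have e3 := h.edge s(y, c j) (by simp)
  have o1 := h.outer (c i) (by simp)
  have o2 := h.outer x (by simp)
  have o3 := h.outer y (by simp)
  have o4 := h.outer (c j) (by simp)
  refine hK.minCE.no_split ((sup_comm _ _).trans h.sup) h.lt₁ (hK.minCE.ih _ h.lt₂ _ _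
    (hK.minCE.toInst.mono h.lt₂.le
    (List.Sublist.refl _) ?_ (by simp))) (P' := [c i, x, y, c j]) (by simp)
    (by simp [h1.ne, h2.ne, h3.ne, hne, hx, (hy _).symm]) ?_ ?_ ?_ ?_ ?_
  · simp only [List.isChain_cons_cons, List.IsChain.singleton, and_true]
    exact ⟨h.adj₂ 0 (by omega) (by omega), h.adj₂ 1 (by omega) (by omega),
      h.adj₂ 2 (by omega) (by omega)⟩
  · simp only [List.isChain_cons_cons, List.IsChain.singleton, and_true]
    exact ⟨⟨e1.1, .inl e1.2⟩, ⟨e2.1, .inl e2.2⟩, e3.1, .inl e3.2⟩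
  · simp [o1.1, o2.1, o3.1, o4.1]
  · intro v hv hv'
    have := h.common v hv' hv
    simpa using this
  · simp only [List.mem_cons, List.not_mem_nil, or_false, not_or]
    rintro v (rfl | rfl | rfl | rfl) -
    · exact h.unused₁ 0 (by omega) (by omega)
    · exact h.unused₁ 1 (by omega) (by omega)
    · exact h.unused₁ 2 (by omega) (by omega)
    · exact h.unused₁ 3 (by omega) (by omega)
  · simp only [List.cons.injEq, and_true]
    rintro _ _ _ _ ⟨rfl, rfl, rfl, rfl⟩ z - hzi hzj
    by_cases hz : ∀ t, z ≠ c t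
    · exact hK.off_card hz (h.lt₁.le hzi)
    · push Not at hz
      obtain ⟨t, rfl⟩ := hz
      obtain ⟨t, ht, h'⟩ := hK.exists_lt t
      rw [h'] at hzi hzj ⊢
      have h4 : 4 ≤ t := by
        by_contra hlt
        exact h.unused₁ t ht (by omega) ⟨_, hzi⟩
      by_contra hz
      exact hcon ⟨hK.three_le h4 ht hi (by omega) (h.lt₁.le hzi) (by omega),
        hK.three_le h4 ht (by omega) hj (h.lt₁.le hzj) (by omega)⟩

theorem chord_three {x y : V} (hx : ∀ i, x ≠ c i) (hy : ∀ i, y ≠ c i) {i j : ℕ} (hi : 4 ≤ i)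
    (hin : i < n) (hj : 4 ≤ j) (hjn : j < n) (h1 : G.Adj (c i) x) (h2 : G.Adj x y)
    (h3 : G.Adj y (c j)) : 3 ≤ (L (c j)).card := by
  rcases lt_trichotomy i j with h | rfl | h
  · exact (hK.chord_three_of_lt hx hy hi h hjn h1 h2 h3).2
  · exact absurd h3.symm (hK.minCE.g5.tri h1 h2)
  · exact (hK.chord_three_of_lt hy hx hj h hin h3.symm h2.symm h1.symm).1

end Core

/-- A coloring of a cycle of length five on the outer face extends to the inner vertices. -/
theorem Inst.exists_pentagon_extension {G₁ : SimpleGraph V} (hp : Planar ε G₁) (hg : G5 G₁)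
    {k₁ k₂ k₃ k₄ k₅ : V}
    (hnd : [k₁, k₂, k₃, k₄, k₅].Nodup) (h12 : G₁.Adj k₁ k₂) (h23 : G₁.Adj k₂ k₃)
    (h34 : G₁.Adj k₃ k₄) (h45 : G₁.Adj k₄ k₅) (h51 : G₁.Adj k₅ k₁)
    (ho : ∀ v ∈ [k₁, k₂, k₃, k₄, k₅], Outer ε G₁ v) (hne : ∀ v, (L v).Nonempty)
    (hcard : ∀ v, v ∉ [k₁, k₂, k₃, k₄, k₅] → Used G₁ v → 3 ≤ (L v).card) {φ : V → ℕ}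
    (hφ : ∀ v, φ v ∈ L v) (c12 : φ k₁ ≠ φ k₂) (c23 : φ k₂ ≠ φ k₃) (c34 : φ k₃ ≠ φ k₄)
    (c45 : φ k₄ ≠ φ k₅) (c51 : φ k₅ ≠ φ k₁)
    (ih : ∀ H < G₁, ∀ P' L', Inst ε H P' L' → LColorable H L') :
    ∃ φ', IsLColoring G₁ L φ' ∧ ∀ v ∈ [k₁, k₂, k₃, k₄, k₅], φ' v = φ v := by
  classical
  set L₁ : V → Finset ℕ := fun v => if v ∈ [k₁, k₂, k₃] then {φ v} else
    if v = k₄ ∨ v = k₅ then {φ v, φ v + 1, φ v + 2} else L v with hL₁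
  have hL1 : ∀ v ∈ [k₁, k₂, k₃], L₁ v = {φ v} := fun v hv => if_pos hv
  have hL2 : ∀ v, v ∉ [k₁, k₂, k₃] → v = k₄ ∨ v = k₅ → L₁ v = {φ v, φ v + 1, φ v + 2} :=
    fun v hv h => (if_neg hv).trans (if_pos h)
  have hL3 : ∀ v, v ∉ [k₁, k₂, k₃] → ¬ (v = k₄ ∨ v = k₅) → L₁ v = L v :=
    fun v hv h => (if_neg hv).trans (if_neg h)
  have hsplit : ∀ v, v ∈ [k₁, k₂, k₃, k₄, k₅] ↔ v ∈ [k₁, k₂, k₃] ∨ v = k₄ ∨ v = k₅ := by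
    intro v; simp only [List.mem_cons, List.not_mem_nil, or_false]; tauto
  have hcard' : ∀ v, v ∉ [k₁, k₂, k₃] → Used G₁ v → 3 ≤ (L₁ v).card := by
    intro v hv hu
    by_cases h : v = k₄ ∨ v = k₅
    · rw [hL2 v hv h, Finset.card_insert_of_notMem (by simp),
        Finset.card_insert_of_notMem (by simp)]; simp
    · rw [hL3 v hv h]; exact hcard v (by rw [hsplit]; tauto) hu
  have hne' : ∀ v, (L₁ v).Nonempty := by
    intro v
    by_cases h1 : v ∈ [k₁, k₂, k₃]
    · rw [hL1 v h1]; simp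
    · by_cases h : v = k₄ ∨ v = k₅
      · rw [hL2 v h1 h]; simp
      · rw [hL3 v h1 h]; exact hne v
  simp only [List.nodup_cons, List.mem_cons, List.not_mem_nil, or_false, not_or, not_false_eq_true,
    List.nodup_nil, and_true] at hnd
  obtain ⟨⟨n12, n13, n14, n15⟩, ⟨n23, n24, n25⟩, ⟨n34, n35⟩, n45⟩ := hnd
  have hnd : [k₁, k₂, k₃].Nodup := by simp [n12, n13, n23]
  have hchain : [k₁, k₂, k₃].IsChain G₁.Adj := by simp [h12, h23]
  have hψP : ∀ p ∈ [k₁, k₂, k₃], ∀ x, x = k₄ ∨ x = k₅ → G₁.Adj p x → φ x ≠ φ p := by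
    simp only [List.mem_cons, List.not_mem_nil, or_false]
    rintro p (rfl | rfl | rfl) x (rfl | rfl) h
    · exact absurd h.symm (hg.tri h45 h51)
    · exact c51
    · exact absurd h (hg.tri h23 h34)
    · exact absurd h.symm (hg.tri h51 h12)
    · exact c34.symm
    · exact absurd h (hg.tri h34 h45)
  have hI : Inst ε G₁ [k₁, k₂, k₃] L₁ := by
    refine ⟨hp, hg, by simp, hnd, hchain, fun v hv => ho v (by rw [hsplit]; exact .inl hv),
      fun v hv => by rw [hL1 v hv]; simp, ?_, fun v hv hu => by have := hcard' v hv hu; omega,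
      fun v hv hu _ => hcard' v hv hu, fun u hu v _ h => .inl (hcard' u hu ⟨v, h⟩), ?_⟩
    · intro u hu v hv h α hα
      rw [hL1 u hu, Finset.mem_singleton] at hα
      rw [hL1 v hv, Finset.mem_singleton, hα]
      simp only [List.mem_cons, List.not_mem_nil, or_false] at hu hv
      rcases hu with rfl | rfl | rfl <;> rcases hv with rfl | rfl | rfl
      · exact absurd rfl h.ne
      · exact c12
      · exact absurd h (hg.tri h12 h23)
      · exact c12.symm
      · exact absurd rfl h.ne
      · exact c23
      · exact absurd h.symm (hg.tri h12 h23)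
      · exact c23.symm
      · exact absurd rfl h.ne
    · intro z hz
      obtain ⟨α, hα, h⟩ := hg.exists_color (by simp) hchain hnd hz (hne' z)
        (fun h => (hcard' z hz h).trans' (by omega)) (by simp) φ
      exact ⟨α, hα, fun p hp hzp => by rw [hL1 p hp, Finset.mem_singleton]; exact h p hp hzp⟩
  obtain ⟨L', hI', hcol⟩ := hI.delete {v | v = k₄ ∨ v = k₅}
    {v | v ∉ [k₁, k₂, k₃, k₄, k₅] ∧ (G₁.Adj v k₄ ∨ G₁.Adj v k₅)} φ (List.Sublist.refl _) hchain
    (fun v hv hv' => absurd hv hv') (by simp [*]) (by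
      rintro x (rfl | rfl)
      · rw [hL2 _ (by simp [Ne.symm, *]) (.inl rfl)]; simp
      · rw [hL2 _ (by simp [Ne.symm, *]) (.inr rfl)]; simp) (by
      rintro x (rfl | rfl) y (rfl | rfl) h
      · exact absurd rfl h.ne
      · exact c45
      · exact c45.symm
      · exact absurd rfl h.ne)
    (fun p hp x hx h => by rw [hL1 p hp, Finset.mem_singleton]; exact hψP p hp x hx h)
    (fun v hv => by
      have := hv.1
      rw [hsplit, not_or] at this
      exact this)
    (fun v hv hv' hvD x hx h => absurd ⟨by rw [hsplit, not_or]; exact ⟨hv', hv⟩, by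
      rcases hx with rfl | rfl
      · exact .inl h
      · exact .inr h⟩ hvD)
    (fun v hv => hcard' v (fun h => hv.1 ((hsplit v).mpr (.inl h)))
      (hv.2.elim (fun h => ⟨_, h⟩) fun h => ⟨_, h⟩)) (by
      rintro v hv x (rfl | rfl) y (rfl | rfl) h h'
      · rfl
      · exact absurd h' (hg.tri h h45)
      · exact absurd h (hg.tri h' h45)
      · rfl) (by
      rintro v ⟨hv, h | h⟩
      · exact ⟨k₄, .inl rfl, h, .inl (ho _ (by simp))⟩
      · exact ⟨k₅, .inr rfl, h, .inl (ho _ (by simp))⟩) (by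
      rintro v ⟨hv, h⟩ w hw hw' hvw
      refine ⟨?_, hcard' w hw' ⟨v, hvw.symm⟩⟩
      rintro ⟨hw, h'⟩
      simp only [List.mem_cons, List.not_mem_nil, or_false, not_or] at hv hw
      rcases h with h | h <;> rcases h' with h' | h'
      · exact hg.tri hvw h' h
      · exact hw.2.2.2.1 (hg.sq hvw.symm h' h.symm h45 hv.2.2.2.2)
      · exact hw.2.2.2.2 (hg.sq hvw.symm h' h.symm h45.symm hv.2.2.2.1)
      · exact hg.tri hvw h' h) (by
      simp only [List.mem_cons, List.not_mem_nil, or_false, not_or]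
      rintro z hz hz' p (rfl | rfl | rfl) q (rfl | rfl | rfl) h h'
      · rfl
      · exact absurd h' (hg.tri h h12)
      · exact absurd (hg.sq h h' h12.symm h23 n13) hz'.2.1
      · exact absurd h (hg.tri h' h12)
      · rfl
      · exact absurd h' (hg.tri h h23)
      · exact absurd (hg.sq h' h h12.symm h23 n13) hz'.2.1
      · exact absurd h (hg.tri h' h23)
      · rfl)
  obtain ⟨φ', ⟨h1, h2⟩, h3⟩ := hcol (ih _ (del_lt (x := k₄) (.inl rfl) h45) _ _ hI')
  have h4 : ∀ v ∈ [k₁, k₂, k₃, k₄, k₅], φ' v = φ v := by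
    intro v hv
    rcases (hsplit v).mp hv with hv | hv
    · have := h1 v
      rwa [hL1 v hv, Finset.mem_singleton] at this
    · exact h3 v hv
  refine ⟨φ', ⟨fun v => ?_, h2⟩, h4⟩
  by_cases hv : v ∈ [k₁, k₂, k₃, k₄, k₅]
  · rw [h4 v hv]; exact hφ v
  · have := h1 v
    rwa [hL3 v (fun h => hv ((hsplit v).mpr (.inl h))) fun h => hv ((hsplit v).mpr (.inr h))] at this

namespace Core

/-- Cycles of length five have no inner edges. -/
theorem noIn (hK : Core ε G L n c) : NoIn ε G := by
  intro r K hKc hlen e he heK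
  by_contra hne
  have h1 : wsum ε K e = 1 := (by decide : ∀ a : ZMod 2, a ≠ 0 → a = 1) _ hne
  obtain ⟨G₁, G₂, hsup, hcommon, hout, hedge, hside⟩ := hK.minCE.planar.inside hKc
  have hle₁ : G₁ ≤ G := hsup ▸ le_sup_left
  have hlt₂ : G₂ < G := lt_of_le_of_ne (hsup ▸ le_sup_right) fun h =>
    ((hside e he heK).2.mp h1) (h ▸ he)
  have hadj : ∀ i, G₂.Adj (c i) (c (i + 1)) := by
    intro i
    by_cases h : s(c i, c (i + 1)) ∈ K.edges
    · exact (hedge _ h).2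
    · have h0 := hK.cycle.extreme i K h
      by_contra hcon
      have := (hside s(c i, c (i + 1)) (hK.cycle.adj i) h).2.mpr hcon
      rw [h0] at this
      exact absurd this (by decide)
  obtain ⟨φ, hφ, hφ'⟩ := hK.minCE.ih _ hlt₂ _ _ (hK.minCE.toInst.mono hlt₂.le
    (List.Sublist.refl _) (by simp [hadj 0, hadj 1, hadj 2]) fun v h h' => absurd h h')
  have h3 : ∀ v, v ∉ K.support → Used G₁ v → 3 ≤ (L v).card := by
    intro v hv hu
    have : ∀ i, v ≠ c i := by
      rintro i rfl
      exact hv (hcommon _ hu ⟨_, hadj i⟩)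
    obtain ⟨u, hu⟩ := hu
    exact hK.off_card this (hle₁ hu)
  match K, hlen with
  | .cons (v := k₂) h12 (.cons (v := k₃) h23 (.cons (v := k₄) h34 (.cons (v := k₅) h45
      (.cons h51 .nil)))), _ =>
    have hnd := hKc.support_nodup
    simp only [Walk.support_cons, Walk.support_nil, List.tail_cons] at hnd
    have hmem : ∀ v, v ∈ [r, k₂, k₃, k₄, k₅] ↔ v ∈ (Walk.cons h12 (.cons h23 (.cons h34 (.cons h45
      (.cons h51 .nil))))).support := by
      intro v; simp; tauto
    have e12 := hedge s(r, k₂) (by simp)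
    have e23 := hedge s(k₂, k₃) (by simp)
    have e34 := hedge s(k₃, k₄) (by simp)
    have e45 := hedge s(k₄, k₅) (by simp)
    have e51 := hedge s(k₅, r) (by simp)
    obtain ⟨φ', h, h'⟩ := Inst.exists_pentagon_extension (hK.minCE.planar.mono hle₁)
      (hK.minCE.g5.mono hle₁) (k₁ := r) (k₂ := k₂) (k₃ := k₃) (k₄ := k₄) (k₅ := k₅)
      ((List.perm_append_comm (l₁ := [k₂, k₃, k₄, k₅]) (l₂ := [r])).nodup_iff.mp hnd)
      e12.1 e23.1 e34.1 e45.1 e51.1 (fun v hv => hout v ((hmem v).mp hv))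
      (fun v => hK.minCE.nonempty v) (fun v hv => h3 v fun h => hv ((hmem v).mpr h)) hφ
      (hφ' e12.2) (hφ' e23.2) (hφ' e34.2) (hφ' e45.2) (hφ' e51.2)
      (fun H hH => hK.minCE.ih H (hH.trans_le hle₁))
    exact hK.minCE.no (glue hsup h ⟨hφ, hφ'⟩ fun v hv hv' => h' v ((hmem v).mpr (hcommon v hv hv')))

end Core

namespace Core

variable (hK : Core ε G L n c)
include hK

theorem cases (v : V) : (∀ i, v ≠ c i) ∨ ∃ t < n, v = c t := by
  by_cases h : ∀ i, v ≠ c i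
  · exact .inl h
  · push Not at h
    obtain ⟨i, rfl⟩ := h
    exact .inr (hK.exists_lt i)

theorem exists_index (ψ : ℕ → ℕ) : ∃ ψ' : V → ℕ, ∀ t < n, ψ' (c t) = ψ t := by
  have : ∀ v, ∃ a, ∀ t < n, v = c t → a = ψ t := by
    intro v
    by_cases h : ∃ t < n, v = c t
    · obtain ⟨t, ht, rfl⟩ := h
      exact ⟨ψ t, fun t' ht' h => by rw [hK.inj ht ht' h]⟩
    · exact ⟨0, fun t ht h' => absurd ⟨t, ht, h'⟩ h⟩
  choose ψ' h using this
  exact ⟨ψ', fun t ht => h _ t ht rfl⟩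

omit hK in
/-- The initial segments of the precolored path. -/
theorem sublist {k : ℕ} (hk : k ≤ 4) : ((List.range k).map c).Sublist [c 0, c 1, c 2, c 3] :=
  (List.range_sublist.mpr hk).map c

/-- Coloring up to three consecutive vertices of the outer cycle. -/
theorem step {s e : ℕ} (hs : 3 ≤ s) (hse : s < e) (hl : e ≤ s + 3) (he : e ≤ n)
    (hn : n = 5 → s = 3) {ψ : ℕ → ℕ} (hψ : ∀ t, s ≤ t → t < e → ψ t ∈ L (c t))
    (hψ' : ∀ t, s ≤ t → t + 1 < e → ψ t ≠ ψ (t + 1))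
    (hx : e = s + 3 → ∀ x x', (∀ i, x ≠ c i) → (∀ i, x' ≠ c i) → G.Adj x (c s) →
      G.Adj x' (c (s + 2)) → ¬ G.Adj x x')
    (hleft : s = 3 ∨ (s = 4 ∧ ψ 4 ∉ L (c 3)) ∨ ∃ m, 4 ≤ m ∧ s = m + 1 ∧
      ((ψ s ∉ L (c m) ∨ m = 4 ∧ L (c 3) = {ψ s}) ∨ 3 ≤ (L (c m)).card ∧
        ∀ m', 4 ≤ m' → m = m' + 1 → 3 ≤ (L (c m')).card))
    (hright : ∀ m, e = m + 1 → (e = n ∧ ψ m ∉ L (c 0)) ∨ e < n ∧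
      ((ψ m ∉ L (c e) ∨ e + 1 = n ∧ L (c 0) = {ψ m}) ∨ 3 ≤ (L (c e)).card ∧
        (e + 1 < n → 3 ≤ (L (c (e + 1))).card))) : False := by
  have h5 := hK.five_le
  have hM := hK.minCE
  have t3 := fun {a b c} => @G5.tri _ _ hM.g5 a b c
  have t4 := fun {a b c d} => @G5.sq _ _ hM.g5 a b c d
  obtain ⟨ψ₁, hψ₁⟩ := hK.exists_index ψ
  obtain ⟨k, hk⟩ : ∃ k, k = 3 ∧ s = 3 ∨ k = 4 ∧ 4 ≤ s := by
    rcases hs.eq_or_lt with h | h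
    · exact ⟨3, .inl ⟨rfl, h.symm⟩⟩
    · exact ⟨4, .inr ⟨rfl, h⟩⟩
  have hadj := fun {i j} (hi : i < n) (hj : j < n) => (hK.adj_iff hi hj).mp
  set P' := (List.range k).map c with hP'
  have hP'mem : ∀ v, v ∈ P' ↔ ∃ i < k, v = c i := by
    intro v; simp [hP', eq_comm]
  have hcP : ∀ {t}, t < n → (c t ∈ P' ↔ t < k) := by
    intro t ht
    rw [hP'mem]
    refine ⟨?_, fun h => ⟨t, h, rfl⟩⟩
    rintro ⟨i, hi, h⟩
    have := hK.inj ht (by omega) h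
    omega
  set X : Set V := {v | ∃ t, s ≤ t ∧ t < e ∧ v = c t} with hX
  have hcX : ∀ {t}, t < n → (c t ∈ X ↔ s ≤ t ∧ t < e) := by
    intro t ht
    refine ⟨?_, fun h => ⟨t, h.1, h.2, rfl⟩⟩
    rintro ⟨i, hi, hi', h⟩
    have := hK.inj ht (by omega) h
    omega
  set DM : ℕ → Prop := fun m => (4 ≤ m ∧ s = m + 1 ∧ ¬ (ψ s ∉ L (c m) ∨ m = 4 ∧ L (c 3) = {ψ s})) ∨
    (m = e ∧ e < n ∧ ¬ (ψ (e - 1) ∉ L (c e) ∨ e + 1 = n ∧ L (c 0) = {ψ (e - 1)})) with hDM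
  have hright := hright (e - 1) (by omega)
  have hDM1 : ∀ {m}, DM m → m < n ∧ 4 ≤ m ∧ (s = m + 1 ∨ m = e) := by
    rintro m (h | h) <;> omega
  have hDM2 : ∀ {m}, DM m → 3 ≤ (L (c m)).card ∧ ∀ t < n, 4 ≤ t → G.Adj (c m) (c t) →
      ¬ (s ≤ t ∧ t < e) → 3 ≤ (L (c t)).card := by
    rintro m (⟨h4, h, h'⟩ | ⟨rfl, h, h'⟩)
    · rcases hleft with h3 | h3 | ⟨m', h3, h6, h7⟩
      · omega
      · omega
      · obtain rfl : m = m' := by omega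
        obtain ⟨h8, h9⟩ := h7.resolve_left h'
        refine ⟨h8, fun t ht ht4 hmt hst => h9 t ht4 ?_⟩
        have := hadj (by omega) ht hmt
        omega
    · obtain ⟨h8, h9⟩ := (hright.resolve_left fun h => by omega).2.resolve_left h'
      refine ⟨h8, fun t ht ht4 hmt hst => ?_⟩
      have := hadj (by omega) ht hmt
      obtain rfl : t = m + 1 := by omega
      exact h9 ht
  set D : Set V := {v | ((∀ i, v ≠ c i) ∧ ∃ t, s ≤ t ∧ t < e ∧ G.Adj v (c t)) ∨
    ∃ m, DM m ∧ v = c m} with hD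
  have hoff : ∀ {v t t'}, (∀ i, v ≠ c i) → 3 ≤ t → t < n → 3 ≤ t' → t' < n → G.Adj v (c t) →
      G.Adj v (c t') → t = t' := fun hv h1 h2 h3 h4 h h' => hK.chord_two' hv h1 h2 h3 h4 h h'
  have hdel := hM.toInst.delete X D ψ₁ (sublist (c := c) (k := k) (by omega))
    (hK.cycle.isChain k) ?_ ?_ ?_ ?_ ?_ ?_ ?_ ?_ ?_ ?_ ?_ ?_
  · obtain ⟨L', hI, hcol⟩ := hdel
    obtain ⟨φ, h, -⟩ := hcol (hM.ih _ (del_lt (X := X) (x := c s) ⟨s, le_rfl, hse, rfl⟩ (hK.cycle.adj s))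
      _ _ hI)
    exact hM.no ⟨φ, h⟩
  · intro v hv hv'
    rcases hK.cases v with h | ⟨t, ht, rfl⟩
    · exact absurd hv (off_notMem h)
    · rw [hK.mem_iff ht] at hv
      rw [hcP ht] at hv'
      rw [hcX ht]; omega
  · intro v hv
    obtain ⟨i, hi, rfl⟩ := (hP'mem v).mp hv
    rw [hcX (by omega)]; omega
  · rintro x ⟨t, h, h', rfl⟩
    rw [hψ₁ t (by omega)]; exact hψ t h h'
  · rintro x ⟨t, h, h', rfl⟩ y ⟨t', h1, h1', rfl⟩ hxy
    rw [hψ₁ t (by omega), hψ₁ t' (by omega)]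
    rcases hadj (by omega) (by omega) hxy with rfl | rfl | h2 | h2
    · exact hψ' t h h1'
    · exact (hψ' t' h1 h').symm
    · omega
    · omega
  · rintro p hp x ⟨t, h, h', rfl⟩ hpt
    obtain ⟨i, hi, rfl⟩ := (hP'mem p).mp hp
    rw [hψ₁ t (by omega)]
    have := hadj (by omega) (by omega) hpt
    by_cases h0 : i = 0 ∧ t + 1 = n
    · obtain ⟨rfl, h0⟩ := h0
      have := (hright.resolve_right fun h => by omega).2
      rwa [show e - 1 = t by omega] at this
    · obtain rfl : t = i + 1 := by omega
      rcases hk with ⟨rfl, rfl⟩ | ⟨rfl, hs4⟩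
      · obtain rfl : i = 2 := by omega
        exact fun h => hM.proper _ (by simp) _ (by simp) hpt _ h (hψ 3 (by omega) (by omega))
      · obtain rfl : i = 3 := by omega
        rcases hleft with h3 | h3 | ⟨m, h3, h6, h7⟩
        · omega
        · exact h3.2
        · omega
  · rintro v (⟨h, -⟩ | ⟨m, hm, rfl⟩)
    · refine ⟨fun h' => ?_, ?_⟩
      · obtain ⟨i, hi, rfl⟩ := (hP'mem v).mp h'
        exact h i rfl
      · rintro ⟨t, -, -, rfl⟩
        exact h t rfl
    · have := hDM1 hm
      rw [hcP this.1, hcX this.1]; omega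
  · intro v hvX hvP hvD x hxX hvx
    obtain ⟨t, h, h', rfl⟩ := hxX
    rw [hψ₁ t (by omega)]
    rcases hK.cases v with hv | ⟨m, hm, rfl⟩
    · exact absurd (.inl ⟨hv, t, h, h', hvx⟩) hvD
    · rw [hcX hm] at hvX
      rw [hcP hm] at hvP
      have hDm : ¬ DM m := fun h => hvD (.inr ⟨m, h, rfl⟩)
      have := hadj hm (by omega) hvx
      by_cases h1 : t = m + 1
      · subst h1
        obtain rfl : s = m + 1 := by omega
        by_contra hcon
        refine hDm (.inl ⟨by omega, rfl, fun hc => hcon (hc.imp_right ?_)⟩)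
        rintro ⟨rfl, h3⟩
        exact ⟨c 3, (hcP (by omega)).mpr (by omega), (hK.cycle.adj 3).symm, h3⟩
      · obtain rfl : m = e := by omega
        obtain rfl : t = m - 1 := by omega
        by_contra hcon
        refine hDm (.inr ⟨rfl, hm, fun hc => hcon (hc.imp_right ?_)⟩)
        rintro ⟨h2, h3⟩
        exact ⟨c 0, (hcP (by omega)).mpr (by omega), (hK.adj_iff hm (by omega)).mpr (by omega), h3⟩
  · rintro v (⟨hv, t, -, -, h⟩ | ⟨m, hm, rfl⟩)
    · exact hK.off_card hv h
    · exact (hDM2 hm).1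
  · rintro v hv x ⟨t, h1, h2, rfl⟩ y ⟨t', h3, h4, rfl⟩ h h'
    rcases hv with ⟨hv, -⟩ | ⟨m, hm, rfl⟩
    · rw [hoff hv (by omega) (by omega) (by omega) (by omega) h h']
    · have h6 := hDM1 hm
      have := hadj h6.1 (by omega) h
      have := hadj h6.1 (by omega) h'
      rw [show t = t' by omega]
  · rintro v (⟨hv, t, h1, h2, h⟩ | ⟨m, hm, rfl⟩)
    · exact ⟨c t, ⟨t, h1, h2, rfl⟩, h, .inl (hK.cycle.outer hM.planar t)⟩
    · have h6 := hDM1 hm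
      obtain ⟨t, h1, h2, h⟩ : ∃ t, s ≤ t ∧ t < e ∧ (t = m + 1 ∨ m = t + 1) := by
        rcases h6.2.2 with h | h
        · exact ⟨s, by omega⟩
        · exact ⟨e - 1, by omega⟩
      exact ⟨c t, ⟨t, h1, h2, rfl⟩, (hK.adj_iff h6.1 (by omega)).mpr (by omega),
        .inl (hK.cycle.outer hM.planar t)⟩
  · intro v hv w hwX hwP hvw
    rcases hK.cases w with hw | ⟨m', hm', rfl⟩
    · refine ⟨?_, hK.off_card hw hvw.symm⟩
      rintro (⟨-, t', h1', h2', h'⟩ | ⟨m, hm, rfl⟩)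
      · rcases hv with ⟨hv, t, h1, h2, h⟩ | ⟨m, hm, rfl⟩
        · have : t = t' ∨ t' = t + 1 ∨ t = t' + 1 ∨ t' = t + 2 ∨ t = t' + 2 := by omega
          rcases this with rfl | rfl | rfl | rfl | rfl
          · exact t3 hvw h' h
          · exact hw t (t4 hvw.symm h' h.symm (hK.cycle.adj t) (hv _))
          · exact hv t' (t4 hvw h h'.symm (hK.cycle.adj t') (hw _))
          · obtain rfl : t = s := by omega
            exact hx (by omega) v w hv hw h h' hvw
          · obtain rfl : t' = s := by omega
            exact hx (by omega) w v hw hv h' h hvw.symm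
        · have h6 := hDM1 hm
          have := hoff hw (by omega) h6.1 (by omega) (by omega) hvw.symm h'
          omega
      · exact hw m rfl
    · rw [hcX hm'] at hwX
      rw [hcP hm'] at hwP
      rcases hv with ⟨hv, t, h1, h2, h⟩ | ⟨m, hm, rfl⟩
      · have := hoff hv (by omega) (by omega) (by omega) hm' h hvw
        omega
      · have h6 := hDM1 hm
        refine ⟨?_, (hDM2 hm).2 m' hm' (by omega) hvw hwX⟩
        rintro (⟨hw, -⟩ | ⟨m'', hm'', hmm⟩)
        · exact hw m' rfl
        · have h7 := hDM1 hm''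
          obtain rfl := hK.inj hm' h7.1 hmm
          have := hadj h6.1 hm' hvw
          omega
  · intro z hzX hzP p hp q hq hzp hzq
    by_contra hpq
    obtain ⟨a, b, d, f, hPeq, ha, hf⟩ := hM.g5.ends (P := P') (by simp [hP']; omega)
      (hK.cycle.isChain k) (hK.cycle.nodup (by omega)) hzP hp hq hpq hzp hzq
    obtain rfl : k = 4 := by simpa [hP'] using congrArg List.length hPeq
    simp [hP', List.range_succ] at hPeq
    obtain ⟨rfl, rfl, rfl, rfl⟩ := hPeq
    rcases hK.cases z with hz | ⟨m, hm, rfl⟩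
    · have := hK.chord_two hz (i := 0) (j := 3) (by omega) (by omega) ha.symm hf
      omega
    · rw [hcP hm] at hzP
      have h1 := hadj hm (by omega) ha
      have h2 := hadj hm (by omega) hf
      omega

end Core

/-- A cycle of length five. -/
structure Pentagon (G : SimpleGraph V) (k : Fin 5 → V) : Prop where
  g5 : G5 G
  adj : ∀ i, G.Adj (k i) (k (i + 1))

namespace Pentagon

variable {k : Fin 5 → V} (hk : Pentagon G k)
include hk

omit hk in
theorem index_cases (i j : Fin 5) : i = j ∨ j = i + 1 ∨ i = j + 1 ∨ j = i + 1 + 1 ∨ i = j + 1 + 1 := by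
  revert i j; decide

theorem adj_last (i : Fin 5) : G.Adj (k (i + 1 + 1 + 1 + 1)) (k i) := by
  have := hk.adj (i + 1 + 1 + 1 + 1)
  rwa [show i + 1 + 1 + 1 + 1 + 1 = i by clear this; revert i; decide] at this

theorem ne (i : Fin 5) : k i ≠ k (i + 1 + 1) := fun h =>
  hk.g5.tri (h ▸ hk.adj (i + 1 + 1)) (hk.adj _) (hk.adj_last i).symm

theorem inj : Function.Injective k := by
  intro i j h
  rcases index_cases i j with rfl | rfl | rfl | rfl | rfl
  · rfl
  · exact absurd h (hk.adj i).ne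
  · exact absurd h (hk.adj j).ne'
  · exact absurd h (hk.ne i)
  · exact absurd h (hk.ne j).symm

theorem adj_cases {i j : Fin 5} (h : G.Adj (k i) (k j)) : j = i + 1 ∨ i = j + 1 := by
  rcases index_cases i j with rfl | rfl | rfl | rfl | rfl
  · exact absurd rfl h.ne
  · exact .inl rfl
  · exact .inr rfl
  · exact absurd h (hk.g5.tri (hk.adj i) (hk.adj _))
  · exact absurd h.symm (hk.g5.tri (hk.adj j) (hk.adj _))

theorem eq_of_adj {v : V} (hv : ∀ i, v ≠ k i) {i j : Fin 5} (hi : G.Adj v (k i))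
    (hj : G.Adj v (k j)) : i = j := by
  rcases index_cases i j with rfl | rfl | rfl | rfl | rfl
  · rfl
  · exact absurd hj (hk.g5.tri hi (hk.adj i))
  · exact absurd hi (hk.g5.tri hj (hk.adj j))
  · exact absurd (hk.g5.sq hi hj (hk.adj i).symm (hk.adj _) (hk.ne i)) (hv _)
  · exact absurd (hk.g5.sq hj hi (hk.adj j).symm (hk.adj _) (hk.ne j)) (hv _)

theorem middle (hG : Planar ε G) (hN : NoIn ε G) {v w : V} (hv : ∀ i, v ≠ k i)
    (hw : ∀ i, w ≠ k i) (hvw : G.Adj v w) {i j : Fin 5} (hi : G.Adj v (k i))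
    (hj : G.Adj w (k j)) : ∃ m, (∃ (r : V) (W : G.Walk r r), s(k m, k (m + 1)) ∉ W.edges ∧
      wsum ε W s(k m, k (m + 1)) = 1) ∧ ∀ t, G.Adj (k (m + 1)) t → t = k m ∨ t = k (m + 1 + 1) := by
  have key : ∀ i {v w : V}, (∀ i, v ≠ k i) → (∀ i, w ≠ k i) → G.Adj v w → G.Adj v (k i) →
      G.Adj w (k (i + 1 + 1)) → (∃ (r : V) (W : G.Walk r r), s(k i, k (i + 1)) ∉ W.edges ∧
      wsum ε W s(k i, k (i + 1)) = 1) ∧ ∀ t, G.Adj (k (i + 1)) t → t = k i ∨ t = k (i + 1 + 1) := by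
    intro i v w hv hw hvw hi hj
    refine hN.hexagon hG (y := v) (y' := w) ?_ (hk.adj i) (hk.adj _) (hk.adj _) (hk.adj _)
      (hk.adj_last i) hi.symm hvw hj
    have h := hk.inj
    simp only [List.nodup_cons, List.mem_cons, List.not_mem_nil, or_false, not_or,
      not_false_eq_true, List.nodup_nil, and_true, h.eq_iff, (hv _).symm, (hw _).symm, hvw.ne]
    clear hi hj; revert i; decide
  have side : ∀ i {v w : V}, (∀ i, v ≠ k i) → (∀ i, w ≠ k i) → G.Adj v w → G.Adj v (k i) →
      ¬ G.Adj w (k (i + 1)) := fun i v w hv hw hvw hi hj =>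
    hv _ (hk.g5.sq hi hvw (hk.adj i).symm hj.symm (hw i).symm)
  rcases index_cases i j with rfl | rfl | rfl | rfl | rfl
  · exact absurd hi (hk.g5.tri hvw hj)
  · exact absurd hj (side i hv hw hvw hi)
  · exact absurd hi (side j hw hv hvw.symm hj)
  · exact ⟨i, key i hv hw hvw hi hj⟩
  · exact ⟨j, key j hw hv hvw.symm hj hi⟩

end Pentagon

namespace Core

variable (hK : Core ε G L n c)
include hK

theorem eq_of_adj_path {z : V} (hz : ∀ i, z ≠ c i) {p q : V} (hp : p ∈ [c 0, c 1, c 2, c 3])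
    (hq : q ∈ [c 0, c 1, c 2, c 3]) (hzp : G.Adj z p) (hzq : G.Adj z q) : p = q := by
  have h5 := hK.five_le
  by_contra hpq
  obtain ⟨a, b, d, f, hP, ha, hf⟩ := hK.minCE.g5.ends
      (P := [c 0, c 1, c 2, c 3]) (by simp) (hK.cycle.isChain 4)
    (hK.cycle.nodup (l := 4) (by omega)) (off_notMem hz) hp hq hpq hzp hzq
  simp only [List.cons.injEq, and_true] at hP
  obtain ⟨rfl, rfl, rfl, rfl⟩ := hP
  have := hK.chord_two hz (i := 0) (j := 3) (by omega) (by omega) ha.symm hf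
  omega

/-- The neighbors of an inner vertex on the precolored path forbid at most one color. -/
theorem exists_forbidden {z : V} (hz : ∀ i, z ≠ c i) : ∃ T : Finset ℕ, T.card ≤ 1 ∧
    (∀ p ∈ [c 0, c 1, c 2, c 3], G.Adj z p → L p ⊆ T) ∧
    (T = ∅ ∨ ∃ p ∈ [c 0, c 1, c 2, c 3], G.Adj z p) := by
  by_cases h : ∃ p ∈ [c 0, c 1, c 2, c 3], G.Adj z p
  · obtain ⟨p, hp, hzp⟩ := h
    refine ⟨L p, (hK.minCE.cardP p hp).le, fun q hq hzq => ?_, .inr ⟨p, hp, hzp⟩⟩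
    rw [hK.eq_of_adj_path hz hp hq hzp hzq]
  · exact ⟨∅, by simp, fun p hp hzp => absurd ⟨p, hp, hzp⟩ h, .inl rfl⟩

theorem middle_of_adj {z : V} (hz : ∀ i, z ≠ c i) {t : ℕ} (ht : 4 ≤ t) (htn : t < n)
    (hzt : G.Adj z (c t)) {p : V} (hp : p ∈ [c 0, c 1, c 2, c 3]) (hzp : G.Adj z p) :
    p = c 1 ∨ p = c 2 := by
  simp only [List.mem_cons, List.not_mem_nil, or_false] at hp
  rcases hp with rfl | rfl | rfl | rfl
  · have := hK.chord_two hz (i := 0) (j := t) (by omega) htn hzp.symm hzt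
    omega
  · exact .inl rfl
  · exact .inr rfl
  · have := hK.chord_two hz (i := 3) (j := t) (by omega) htn hzp.symm hzt
    omega

theorem exists_colors {x x' : V} (hx : ∀ i, x ≠ c i) (hx' : ∀ i, x' ≠ c i) {s t : ℕ}
    (hs : 4 ≤ s) (hsn : s < n) (ht : 4 ≤ t) (htn : t < n) (hxs : G.Adj x (c s)) (hxx : G.Adj x x')
    (hxt : G.Adj x' (c t)) (b : ℕ) : ∃ β ∈ L x, ∃ β' ∈ L x', β ≠ b ∧ β' ≠ b ∧ β ≠ β' ∧
      (∀ p ∈ [c 0, c 1, c 2, c 3], G.Adj p x → β ∉ L p) ∧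
      ∀ p ∈ [c 0, c 1, c 2, c 3], G.Adj p x' → β' ∉ L p := by
  obtain ⟨T, hT, hTL, hT0⟩ := hK.exists_forbidden hx
  obtain ⟨T', hT', hTL', hT0'⟩ := hK.exists_forbidden hx'
  have h3 := hK.off_card hx hxs
  have h3' := hK.off_card hx' hxt
  have hor : T = ∅ ∨ T' = ∅ := by
    by_contra hcon
    obtain ⟨h1, h2⟩ := not_or.mp hcon
    obtain ⟨p, hp, hxp⟩ := hT0.resolve_left h1
    obtain ⟨q, hq, hxq⟩ := hT0'.resolve_left h2
    have hg := hK.minCE.g5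
    rcases hK.middle_of_adj hx hs hsn hxs hp hxp with rfl | rfl <;>
      rcases hK.middle_of_adj hx' ht htn hxt hq hxq with rfl | rfl
    · exact hg.tri hxx hxq hxp
    · exact hx _ (hg.sq hxp hxx (hK.cycle.adj 1).symm hxq.symm (hx' _).symm)
    · exact hx _ (hg.sq hxp hxx (hK.cycle.adj 1) hxq.symm (hx' _).symm)
    · exact hg.tri hxx hxq hxp
  have aux : ∀ {S T : Finset ℕ} (a : ℕ), 3 ≤ S.card → T.card ≤ 1 → ∃ α ∈ S, α ≠ a ∧ α ∉ T := by
    intro S T a hS hT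
    obtain ⟨α, h, h', h''⟩ := Finset.exists_mem_notMem_insert (S := S) (T := T) (by omega) a
    exact ⟨α, h, h'', h'⟩
  rcases hor with rfl | rfl
  · obtain ⟨β', h1, h2, h4⟩ := aux b h3' hT'
    obtain ⟨β, h5, h6, h7⟩ := aux (T := {β'}) b h3 (by simp)
    exact ⟨β, h5, β', h1, h6, h2, by simpa using h7, fun p hp h h' => absurd (hTL p hp h.symm h')
      (by simp), fun p hp h h' => h4 (hTL' p hp h.symm h')⟩
  · obtain ⟨β, h1, h2, h4⟩ := aux b h3 hT
    obtain ⟨β', h5, h6, h7⟩ := aux (T := {β}) b h3' (by simp)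
    exact ⟨β, h1, β', h5, h2, h6, by simpa [eq_comm] using h7,
      fun p hp h h' => h4 (hTL p hp h.symm h'), fun p hp h h' => absurd (hTL' p hp h.symm h')
      (by simp)⟩

/-- Coloring a pentagon with three consecutive vertices on the outer cycle. -/
theorem pentagon_step (hn : 9 ≤ n) {x x' : V} (hx : ∀ i, x ≠ c i) (hx' : ∀ i, x' ≠ c i)
    (h1 : G.Adj x (c 5)) (h2 : G.Adj x x') (h3 : G.Adj x' (c 7)) {b d : ℕ} (hbd : b ≠ d)
    (hb5 : b ∈ L (c 5)) (hd6 : d ∈ L (c 6)) (hb7 : b ∈ L (c 7))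
    (hb4 : b ∉ L (c 4) ∨ L (c 3) = {b}) (hb8 : b ∉ L (c 8)) : False := by
  have hM := hK.minCE
  have hC := hK.cycle
  have hadj := fun {i j} (hi : i < n) (hj : j < n) => (hK.adj_iff hi hj).mp
  obtain ⟨β, hβ, β', hβ', hβb, hβb', hββ, hβP, hβP'⟩ := hK.exists_colors hx hx' (s := 5) (t := 7)
    (by omega) (by omega) (by omega) (by omega) h1 h2 h3 b
  set k : Fin 5 → V := ![c 5, c 6, c 7, x', x] with hkdef
  set col : Fin 5 → ℕ := ![b, d, b, β', β] with hcol
  have hk : Pentagon G k := by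
    refine ⟨hM.g5, fun i => ?_⟩
    fin_cases i
    · exact hC.adj 5
    · exact hC.adj 6
    · exact h3.symm
    · exact h2.symm
    · exact h1
  have hkc : ∀ i, (∃ t, 5 ≤ t ∧ t ≤ 7 ∧ k i = c t ∧ (col i = b ∨ t = 6)) ∨ ∀ t, k i ≠ c t := by
    intro i
    fin_cases i
    · exact .inl ⟨5, by simp [hkdef, hcol]⟩
    · exact .inl ⟨6, by simp [hkdef]⟩
    · exact .inl ⟨7, by simp [hkdef, hcol]⟩
    · exact .inr hx'
    · exact .inr hx
  have hkn : ∀ i, G.Adj (k i) (c 5) ∨ G.Adj (k i) (c 7) ∨ ∃ t, k i = c t := by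
    intro i
    fin_cases i
    · exact .inr (.inr ⟨5, rfl⟩)
    · exact .inr (.inr ⟨6, rfl⟩)
    · exact .inr (.inr ⟨7, rfl⟩)
    · exact .inr (.inl h3)
    · exact .inl h1
  have hkC : ∀ t < n, (∀ i, c t ≠ k i) ↔ ¬ (5 ≤ t ∧ t ≤ 7) := by
    intro t ht
    constructor
    · intro h h'
      obtain rfl | rfl | rfl : t = 5 ∨ t = 6 ∨ t = 7 := by omega
      exacts [h 0 rfl, h 1 rfl, h 2 rfl]
    · intro h i hi
      rcases hkc i with ⟨t', h5, h7, h', -⟩ | h'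
      · have := hK.inj ht (by omega) (hi.trans h')
        omega
      · exact h' t hi.symm
  have hCk : ∀ {t i}, t < n → 4 ≤ t → G.Adj (c t) (k i) → 3 ≤ t ∧ t ≤ 8 := by
    intro t i ht ht4 h
    rcases hkc i with ⟨t', h5, h7, h', -⟩ | h'
    · rw [h'] at h
      have := hadj ht (by omega) h
      omega
    · rcases hkn i with h'' | h'' | ⟨t', h''⟩
      · have := hK.chord_two' h' (by omega) ht (by omega) (by omega) h.symm h''
        omega
      · have := hK.chord_two' h' (by omega) ht (by omega) (by omega) h.symm h''
        omega
      · exact absurd h'' (h' _)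
  set X : Set V := {v | ∃ i, v = k i} with hX
  set D : Set V := {v | (∀ i, v ≠ c i) ∧ (∀ i, v ≠ k i) ∧ ∃ i, G.Adj v (k i)} with hD
  set ψ : V → ℕ := fun v => Function.extend k col 0 v with hψ
  have hψk : ∀ i, ψ (k i) = col i := fun i => hk.inj.extend_apply _ _ _
  have hdel := hM.toInst.delete X D ψ (List.Sublist.refl _) (hK.cycle.isChain 4)
    ?_ ?_ ?_ ?_ ?_ ?_ ?_ ?_ ?_ ?_ ?_ ?_
  · obtain ⟨L', hI, hcol⟩ := hdel
    obtain ⟨φ, h, -⟩ := hcol (hM.ih _ (del_lt (X := X) (x := k 0) ⟨0, rfl⟩ (hk.adj 0)) _ _ hI)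
    exact hM.no ⟨φ, h⟩
  · exact fun v h h' => absurd h h'
  · rintro v hv ⟨i, rfl⟩
    rcases hkc i with ⟨t, h5, h7, h', -⟩ | h'
    · rw [h', hK.mem_iff (by omega)] at hv
      omega
    · exact off_notMem h' hv
  · rintro _ ⟨i, rfl⟩
    rw [hψk]
    fin_cases i
    exacts [hb5, hd6, hb7, hβ', hβ]
  · have : ∀ i, col i ≠ col (i + 1) := by
      intro i
      fin_cases i
      exacts [hbd, hbd.symm, hβb'.symm, hββ.symm, hβb]
    rintro _ ⟨i, rfl⟩ _ ⟨j, rfl⟩ h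
    rw [hψk, hψk]
    rcases hk.adj_cases h with rfl | rfl
    · exact this i
    · exact (this j).symm
  · have hno : ∀ p ∈ [c 0, c 1, c 2, c 3], ∀ t, 5 ≤ t → t ≤ 7 → ¬ G.Adj p (c t) := by
      intro p hp t ht5 ht7 h
      obtain ⟨t', ht', rfl⟩ : ∃ t' < 4, p = c t' := by
        simp only [List.mem_cons, List.not_mem_nil, or_false] at hp
        rcases hp with rfl | rfl | rfl | rfl
        exacts [⟨0, by simp⟩, ⟨1, by simp⟩, ⟨2, by simp⟩, ⟨3, by simp⟩]
      have := hadj (by omega) (by omega) h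
      omega
    rintro p hp _ ⟨i, rfl⟩ h
    rw [hψk]
    fin_cases i
    · exact absurd h (hno p hp 5 (by omega) (by omega))
    · exact absurd h (hno p hp 6 (by omega) (by omega))
    · exact absurd h (hno p hp 7 (by omega) (by omega))
    · exact hβP' p hp h
    · exact hβP p hp h
  · rintro v ⟨hv, hv', -⟩
    exact ⟨off_notMem hv, fun ⟨i, h⟩ => hv' i h⟩
  · rintro v hvX hvP hvD _ ⟨i, rfl⟩ hvi
    have hvk : ∀ i, v ≠ k i := fun i h => hvX ⟨i, h⟩
    rw [hψk]
    rcases hK.cases v with hv | ⟨t, ht, rfl⟩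
    · exact absurd ⟨hv, hvk, i, hvi⟩ hvD
    · rw [hK.mem_iff ht] at hvP
      rw [hkC t ht] at hvk
      have h8 := hCk ht (by omega) hvi
      obtain rfl | rfl : t = 4 ∨ t = 8 := by omega
      all_goals
        rcases hkc i with ⟨t', h5, h7, h', h''⟩ | h'
        · rw [h'] at hvi
          have := hadj ht (by omega) hvi
          rw [h''.resolve_right (by omega)]
          first
          | exact .inl hb8
          | exact hb4.imp_right fun h => ⟨c 3, by simp, (hC.adj 3).symm, h⟩
        · rcases hkn i with h'' | h'' | ⟨t', h''⟩
          · have := hK.chord_two' h' (by omega) ht (by omega) (by omega) hvi.symm h''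
            omega
          · have := hK.chord_two' h' (by omega) ht (by omega) (by omega) hvi.symm h''
            omega
          · exact absurd h'' (h' _)
  · rintro v ⟨hv, -, i, h⟩
    exact hK.off_card hv h
  · rintro v ⟨-, hv, -⟩ _ ⟨i, rfl⟩ _ ⟨j, rfl⟩ hi hj
    rw [hk.eq_of_adj hv hi hj]
  · rintro v ⟨-, -, i, h⟩
    refine ⟨k i, ⟨i, rfl⟩, h, ?_⟩
    rcases hkn i with h' | h' | ⟨t, h'⟩
    · exact .inr ⟨c 5, ⟨0, rfl⟩, h', hC.outer hM.planar 5⟩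
    · exact .inr ⟨c 7, ⟨2, rfl⟩, h', hC.outer hM.planar 7⟩
    · exact .inl (h' ▸ hC.outer hM.planar t)
  · rintro v ⟨hv, hvk, i, hvi⟩ w hwX hwP hvw
    have hwk : ∀ i, w ≠ k i := fun i h => hwX ⟨i, h⟩
    rcases hK.cases w with hw | ⟨t, ht, rfl⟩
    · refine ⟨?_, hK.off_card hw hvw.symm⟩
      rintro ⟨-, -, j, hwj⟩
      obtain ⟨m, ⟨r, W, hW, hW'⟩, hm⟩ := hk.middle hM.planar hK.noIn hvk hwk hvw hvi hwj
      have hdeg : (∀ t, k (m + 1) ≠ c t) → False := by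
        intro h
        have h3 := hK.off_card h (hk.adj (m + 1))
        classical
        have := hM.card_le (S := {k m, k (m + 1 + 1)}) (off_notMem h) ⟨_, hk.adj (m + 1)⟩
          (fun t ht => by simpa using hm t ht)
        have := Finset.card_le_two (a := k m) (b := k (m + 1 + 1))
        omega
      fin_cases m
      · have := hC.extreme 5 W hW
        exact zero_ne_one (this.symm.trans hW')
      · rcases hm (c 8) (hC.adj 7) with h | h
        · have := hK.inj (i := 8) (j := 6) (by omega) (by omega) h
          omega
        · exact hx' _ h.symm
      · exact hdeg hx'
      · exact hdeg hx
      · rcases hm (c 4) (hC.adj 4).symm with h | h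
        · exact hx _ h.symm
        · have := hK.inj (i := 4) (j := 6) (by omega) (by omega) h
          omega
    · rw [hK.mem_iff ht] at hwP
      refine ⟨fun h => h.1 t rfl, ?_⟩
      rw [hkC t ht] at hwk
      rcases hkc i with ⟨t', h5, h7, h', -⟩ | h'
      · rw [h'] at hvi
        have := hK.chord_two' hv (by omega) ht (by omega) (by omega) hvw hvi
        omega
      · rcases hkn i with h'' | h'' | ⟨t', h''⟩
        · exact hK.chord_three h' hv (by omega) (by omega) (by omega) ht h''.symm hvi.symm hvw
        · exact hK.chord_three h' hv (by omega) (by omega) (by omega) ht h''.symm hvi.symm hvw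
        · exact absurd h'' (h' _)
  · rintro z hzX hzP p hp q hq hzp hzq
    rcases hK.cases z with hz | ⟨t, ht, rfl⟩
    · exact hK.eq_of_adj_path hz hp hq hzp hzq
    · rw [hK.mem_iff ht] at hzP
      have key : ∀ p ∈ [c 0, c 1, c 2, c 3], G.Adj (c t) p → t = 4 ∧ p = c 3 ∨ t + 1 = n ∧ p = c 0 := by
        intro p hp h
        simp only [List.mem_cons, List.not_mem_nil, or_false] at hp
        rcases hp with rfl | rfl | rfl | rfl
        all_goals
          have := hadj ht (by omega) h
          first
          | exact .inl ⟨by omega, rfl⟩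
          | exact .inr ⟨by omega, rfl⟩
          | omega
      rcases key p hp hzp with ⟨h, rfl⟩ | ⟨h, rfl⟩ <;> rcases key q hq hzq with ⟨h', rfl⟩ | ⟨h', rfl⟩
      · rfl
      · omega
      · omega
      · rfl

theorem card_one {i : ℕ} (hi : i < 4) : (L (c i)).card = 1 :=
  hK.minCE.cardP _ ((hK.mem_iff (by have := hK.five_le; omega)).mpr hi)

theorem ne_five : n ≠ 5 := by
  rintro rfl
  have hmem := hK.mem_iff (i := 4) (by omega)
  obtain ⟨α, hα, h⟩ := hK.minCE.q (c 4) (by rw [hmem]; omega)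
  obtain ⟨γ, hγ⟩ := hK.minCE.nonempty (c 3)
  have h3 := h (c 3) (by simp) (hK.cycle.adj 3).symm
  have h0 := h (c 0) (by simp) ((hK.adj_iff (by omega) (by omega)).mpr (by omega))
  refine hK.step (s := 3) (e := 5) (ψ := fun t => if t = 3 then γ else α) le_rfl (by omega)
    (by omega) le_rfl (fun _ => rfl) ?_ ?_ (by omega) (.inl rfl) ?_
  · intro t h1 h2
    obtain rfl | rfl : t = 3 ∨ t = 4 := by omega
    · simpa using hγ
    · simpa using hα
  · intro t h1 h2
    obtain rfl : t = 3 := by omega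
    simp only [reduceIte, show 3 + 1 ≠ 3 by omega]
    rintro rfl
    exact h3 hγ
  · intro m hm
    obtain rfl : m = 4 := by omega
    exact .inl ⟨rfl, by simpa using h0⟩

theorem small_four : (L (c 4)).card < 3 := by
  by_contra h4
  push Not at h4
  have hn := hK.five_le
  have hn5 := hK.ne_five
  have ht5 := hK.two_le (i := 5) (by omega) (by omega)
  have c3 := hK.card_one (i := 3) (by omega)
  by_cases h5 : 3 ≤ (L (c 5)).card
  · obtain ⟨γ, hγ⟩ := hK.minCE.nonempty (c 3)
    refine hK.step (s := 3) (e := 4) (ψ := fun _ => γ) le_rfl (by omega) (by omega) (by omega)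
      (fun _ => rfl) ?_ (by omega) (by omega) (.inl rfl) ?_
    · intro t h1 h2
      obtain rfl : t = 3 := by omega
      exact hγ
    · exact fun m hm => .inr ⟨by omega, .inr ⟨h4, fun _ => h5⟩⟩
  have h56 : 6 < n → 3 ≤ (L (c 6)).card := fun h =>
    hK.three_le (i := 5) (j := 6) (by omega) (by omega) (by omega) h (hK.cycle.adj 5) (by omega)
  have hleft : ∀ {β}, β ∈ L (c 5) → (n = 6 → β ∉ L (c 0)) →
      (6 < n → 7 < n → 3 ≤ (L (c 7)).card) → False := by
    intro β hβ h0 h7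
    obtain ⟨α, hα, hα', hne⟩ := Finset.exists_mem_notMem_insert (S := L (c 4)) (T := L (c 3))
      (by omega) β
    refine hK.step (s := 4) (e := 6) (ψ := fun t => if t = 4 then α else β) (by omega) (by omega)
      (by omega) (by omega) (by omega) ?_ ?_ (by omega) (.inr (.inl ⟨rfl, hα'⟩)) ?_
    · intro t h1 h2
      obtain rfl | rfl : t = 4 ∨ t = 5 := by omega
      · simpa using hα
      · simpa using hβ
    · intro t h1 h2
      obtain rfl : t = 4 := by omega
      simpa using hne
    · intro m hm
      obtain rfl : m = 5 := by omega
      by_cases h6 : n = 6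
      · exact .inl ⟨h6.symm, by simpa using h0 h6⟩
      · exact .inr ⟨by omega, .inr ⟨h56 (by omega), h7 (by omega)⟩⟩
  by_cases h6 : n = 6
  · obtain ⟨β, hβ, h0⟩ := Finset.exists_mem_notMem_of_card_lt_card (s := L (c 0)) (t := L (c 5))
      (by rw [hK.card_one (by omega)]; omega)
    exact hleft hβ (fun _ => h0) (by omega)
  by_cases h7 : 7 < n → 3 ≤ (L (c 7)).card
  · obtain ⟨β, hβ⟩ := hK.minCE.nonempty (c 5)
    exact hleft hβ (by omega) fun _ => h7
  push Not at h7
  obtain ⟨α, hα, hα'⟩ := Finset.exists_mem_notMem_of_card_lt_card (s := L (c 7)) (t := L (c 6))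
    (by have := h56 (by omega); omega)
  obtain ⟨β, hβ, -, hne⟩ := Finset.exists_mem_notMem_insert (S := L (c 5)) (T := ∅) (by simpa) α
  refine hK.step (s := 5) (e := 7) (ψ := fun t => if t = 5 then β else α) (by omega) (by omega)
    (by omega) (by omega) (by omega) ?_ ?_ (by omega) (.inr (.inr ⟨4, le_rfl, rfl, .inr
    ⟨h4, by omega⟩⟩)) ?_
  · intro t h1 h2
    obtain rfl | rfl : t = 5 ∨ t = 6 := by omega
    · simpa using hβ
    · simpa using hα
  · intro t h1 h2
    obtain rfl : t = 5 := by omega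
    simpa using hne
  · intro m hm
    obtain rfl : m = 6 := by omega
    exact .inr ⟨h7.1, .inl (.inl (by simpa using hα'))⟩

theorem false : False := by
  have hM := hK.minCE
  have hn := hK.five_le
  have hn5 := hK.ne_five
  have h4 := hK.small_four
  have t4 := hK.two_le (i := 4) (by omega) (by omega)
  have h5 : 3 ≤ (L (c 5)).card :=
    hK.three_le (i := 4) (by omega) (by omega) (by omega) (by omega) (hK.cycle.adj 4) h4
  obtain ⟨p, hp⟩ := Finset.card_eq_one.mp (hK.card_one (i := 3) (by omega))
  have hpL : p ∈ L (c 4) := hM.exists_common (z := c 4) (p := c 3)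
    (by rw [hK.mem_iff (by omega)]; omega) (by simp) (hK.cycle.adj 3).symm (by simp [hp])
  obtain ⟨a, ha, -, hap⟩ := Finset.exists_mem_notMem_insert (S := L (c 4)) (T := ∅) (by simpa) p
  have hpa : L (c 4) = {p, a} :=
    (Finset.eq_of_subset_of_card_le (by simp [Finset.insert_subset_iff, hpL, ha])
      (by rw [Finset.card_pair hap.symm]; omega)).symm
  have safe : ∀ {η}, η ≠ a → η ∉ L (c 4) ∨ L (c 3) = {η} := by
    intro η h
    rw [hpa, hp]
    by_cases h' : η = p
    · exact .inr (by rw [h'])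
    · exact .inl (by simp [h, h'])
  by_cases h6 : 6 < n → 3 ≤ (L (c 6)).card
  · refine hK.step (s := 4) (e := 5) (ψ := fun _ => a) (by omega) (by omega) (by omega) (by omega)
      (by omega) ?_ (by omega) (by omega) (.inr (.inl ⟨rfl, by simpa [hp] using hap⟩)) ?_
    · intro t h1 h2
      obtain rfl : t = 4 := by omega
      exact ha
    · exact fun m hm => .inr ⟨by omega, .inr ⟨h5, h6⟩⟩
  push Not at h6
  obtain ⟨hn6, h6⟩ := h6
  have t6 := hK.two_le (i := 6) (by omega) hn6
  have five : ∀ {η}, η ∈ L (c 5) → η ≠ a → η ∉ L (c 6) ∨ n = 7 ∧ L (c 0) = {η} → False := by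
    intro η hη hηa h
    refine hK.step (s := 5) (e := 6) (ψ := fun _ => η) (by omega) (by omega) (by omega) (by omega)
      (by omega) ?_ (by omega) (by omega) (.inr (.inr ⟨4, le_rfl, rfl, .inl ?_⟩)) ?_
    · intro t h1 h2
      obtain rfl : t = 5 := by omega
      exact hη
    · exact (safe hηa).imp_right fun h => ⟨rfl, h⟩
    · exact fun m hm => .inr ⟨by omega, .inl (h.imp_right fun h => ⟨h.1.symm, h.2⟩)⟩
  have hsub : (L (c 5)).erase a ⊆ L (c 6) := by
    intro η hη
    rw [Finset.mem_erase] at hη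
    by_contra h
    exact five hη.2 hη.1 (.inl h)
  have heq : (L (c 5)).erase a = L (c 6) := Finset.eq_of_subset_of_card_le hsub
    (by have := Finset.pred_card_le_card_erase (s := L (c 5)) (a := a); omega)
  have h65 : ∀ {η}, η ∈ L (c 6) → η ∈ L (c 5) ∧ η ≠ a := by
    intro η h
    rw [← heq, Finset.mem_erase] at h
    exact h.symm
  by_cases hn7 : n = 7
  · obtain ⟨q, hq⟩ := Finset.card_eq_one.mp (hK.card_one (i := 0) (by omega))
    have hq6 : q ∈ L (c 6) := hM.exists_common (z := c 6) (p := c 0)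
      (by rw [hK.mem_iff (by omega)]; omega) (by simp)
      ((hK.adj_iff (by omega) (by omega)).mpr (by omega)) (by simp [hq])
    exact five (h65 hq6).1 (h65 hq6).2 (.inr ⟨hn7, hq⟩)
  have h7 : 3 ≤ (L (c 7)).card :=
    hK.three_le (i := 6) (by omega) (by omega) (by omega) (by omega) (hK.cycle.adj 6) h6
  by_cases h8 : 8 < n → 3 ≤ (L (c 8)).card
  · obtain ⟨b, hb⟩ := hM.nonempty (c 6)
    obtain ⟨d, hd, -, hne⟩ := Finset.exists_mem_notMem_insert (S := L (c 6)) (T := ∅) (by simpa) b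
    have hb5 := h65 hb
    refine hK.step (s := 5) (e := 7) (ψ := fun t => if t = 5 then b else d) (by omega) (by omega)
      (by omega) (by omega) (by omega) ?_ ?_ (by omega) (.inr (.inr ⟨4, le_rfl, rfl, .inl ?_⟩)) ?_
    · intro t h1 h2
      obtain rfl | rfl : t = 5 ∨ t = 6 := by omega
      · simpa using hb5.1
      · simpa using hd
    · intro t h1 h2
      obtain rfl : t = 5 := by omega
      simpa using hne.symm
    · exact (safe hb5.2).imp_right fun h => ⟨rfl, h⟩
    · exact fun m hm => .inr ⟨by omega, .inr ⟨h7, h8⟩⟩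
  push Not at h8
  obtain ⟨hn8, h8⟩ := h8
  obtain ⟨b, hb, hb8⟩ := Finset.exists_mem_notMem_of_card_lt_card (s := L (c 8)) (t := L (c 7))
    (by omega)
  by_cases hb6 : b ∈ L (c 6)
  · obtain ⟨d, hd, -, hne⟩ := Finset.exists_mem_notMem_insert (S := L (c 6)) (T := ∅) (by simpa) b
    have hb5 := h65 hb6
    by_cases hx : ∃ x x', (∀ i, x ≠ c i) ∧ (∀ i, x' ≠ c i) ∧ G.Adj x (c 5) ∧ G.Adj x' (c 7) ∧
        G.Adj x x'
    · obtain ⟨x, x', hx, hx', h1, h3, h2⟩ := hx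
      exact hK.pentagon_step (by omega) hx hx' h1 h2 h3 hne.symm hb5.1 hd hb (safe hb5.2) hb8
    · refine hK.step (s := 5) (e := 8) (ψ := fun t => if t = 6 then d else b) (by omega) (by omega)
        (by omega) (by omega) (by omega) ?_ ?_ ?_ (.inr (.inr ⟨4, le_rfl, rfl, .inl ?_⟩)) ?_
      · intro t h1 h2
        obtain rfl | rfl | rfl : t = 5 ∨ t = 6 ∨ t = 7 := by omega
        · simpa using hb5.1
        · simpa using hd
        · simpa using hb
      · intro t h1 h2
        obtain rfl | rfl : t = 5 ∨ t = 6 := by omega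
        · simpa using hne.symm
        · simpa using hne
      · exact fun _ x x' h1 h2 h3 h4 h5 => hx ⟨x, x', h1, h2, h3, h4, h5⟩
      · exact (safe hb5.2).imp_right fun h => ⟨rfl, h⟩
      · intro m hm
        obtain rfl : m = 7 := by omega
        exact .inr ⟨hn8, .inl (.inl (by simpa using hb8))⟩
  · refine hK.step (s := 7) (e := 8) (ψ := fun _ => b) (by omega) (by omega) (by omega) (by omega)
      (by omega) ?_ (by omega) (by omega)
      (.inr (.inr ⟨6, by omega, rfl, .inl (.inl hb6)⟩)) ?_
    · intro t h1 h2
      obtain rfl : t = 7 := by omega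
      exact hb
    · exact fun m hm => .inr ⟨hn8, .inl (.inl hb8)⟩

end Core

theorem used_of_isChain {P : List V} (h : P.IsChain G.Adj) (hl : 2 ≤ P.length) :
    ∀ v ∈ P, Used G v := by
  rw [List.isChain_iff_getElem] at h
  intro v hv
  obtain ⟨i, hi, rfl⟩ := List.getElem_of_mem hv
  by_cases hi' : i + 1 < P.length
  · exact ⟨_, h i hi'⟩
  · obtain ⟨j, rfl⟩ : ∃ j, i = j + 1 := ⟨i - 1, by omega⟩
    exact ⟨_, (h j hi).symm⟩

theorem Inst.exists_used {P : List V} (hI : Inst ε G P L) :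
    ∃ P', Inst ε G P' L ∧ ∀ v ∈ P', Used G v := by
  by_cases hu : ∀ v ∈ P, Used G v
  · exact ⟨P, hI, hu⟩
  refine ⟨[], hI.mono le_rfl (List.nil_sublist _) .nil fun v hv _ => ?_, by simp⟩
  have hl : P.length ≤ 1 := by
    by_contra! hl
    exact hu (used_of_isChain hI.chain hl)
  match P, hl with
  | [a], _ => simp_all

theorem Inst.colorable [Finite V] {P : List V} (hI : Inst ε G P L) : LColorable G L := by
  induction G using WellFoundedLT.induction generalizing P L with
  | ind G ih =>
    by_contra hno
    obtain ⟨P, hI, hu⟩ := hI.exists_used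
    have hM : MinCE ε G P L := ⟨hI, fun H hH P' L' h => ih H hH h, hno, hu⟩
    obtain ⟨n, c, hC⟩ := hM.exists_outerCycle
    obtain ⟨P', c', hM', hC', hP'⟩ := hC.exists_shift hM
    rw [hP'] at hM'
    obtain ⟨L', hM''⟩ := hC'.exists_extension _ (by simpa using hM'.len) hM'
    exact Core.false ⟨hC', hM''⟩

theorem G5.of_cycle_length (h : ∀ (a : V) (c : G.Walk a a), c.IsCycle → 5 ≤ c.length) : G5 G where
  tri hab hbd had := by
    have hc : (Walk.cons hab (.cons hbd (.cons had.symm .nil))).IsCycle := by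
      simp [Walk.cons_isCycle_iff, Walk.cons_isPath_iff, hab.ne, hab.ne', hbd.ne, had.ne, had.ne']
    simpa using h _ _ hc
  sq hba hbc hda hdc hac := by
    by_contra hbd
    have hc : (Walk.cons hba (.cons hda.symm (.cons hdc (.cons hbc.symm .nil)))).IsCycle := by
      simp [Walk.cons_isCycle_iff, Walk.cons_isPath_iff, hba.ne, hba.ne', hbc.ne, hbc.ne', hda.ne',
        hdc.ne, hac, hbd, Ne.symm hbd]
    simpa using h _ _ hc

end Combinatorial

theorem plane_girth_five_precolored_path_list_colorable
    {V : Type} [Fintype V] [DecidableEq V] (G : SimpleGraph V)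
    (emb : PlaneEmbedding G)
    (hgirth : ∀ (a : V) (c : G.Walk a a), c.IsCycle → 5 ≤ c.length)
    {p₀ p₁ : V} (P : G.Walk p₀ p₁) (hP : P.IsPath)
    (hPlen : P.support.length ≤ 3)
    (hPouter : ∀ v ∈ P.support, emb.OuterVertex v)
    (L : V → Finset ℕ)
    (hS1 : ∀ v, ¬ emb.OuterVertex v → (L v).card = 3)
    (hS2 : ∀ v, emb.OuterVertex v → v ∉ P.support → 2 ≤ (L v).card ∧ (L v).card ≤ 3)
    (hS3 : (∀ v ∈ P.support, (L v).card = 1) ∧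
      ∀ u ∈ P.support, ∀ v ∈ P.support, G.Adj u v → L u ≠ L v)
    (hI : ∀ u v, (L u).card = 2 → (L v).card = 2 → ¬ G.Adj u v)
    (hQ : ∀ v, (L v).card = 2 → ∀ w₁ ∈ P.support, ∀ w₂ ∈ P.support, w₁ ≠ w₂ →
      G.Adj v w₁ → G.Adj v w₂ → L v ≠ L w₁ ∪ L w₂) :
    LColorable G L := by
  have hG := G5.of_cycle_length hgirth
  have h23 : ∀ v ∉ P.support, (L v).card = 2 ∨ (L v).card = 3 := fun v hv => by
    by_cases hv' : emb.OuterVertex v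
    · have := hS2 v hv' hv; omega
    · exact .inr (hS1 v hv')
  refine Inst.colorable (ε := emb.edgeEps) (P := P.support)
    { planar := emb.planar
      g5 := hG
      len := by omega
      nodup := hP.support_nodup
      chain := P.isChain_adj_support
      outP := fun v hv => emb.outer (hPouter v hv)
      cardP := hS3.1
      proper := ?_
      two := fun v hv _ => by have := h23 v hv; omega
      three := fun v _ _ ho => (hS1 v (mt emb.outer ho)).ge
      indep := fun u hu v hv huv => by
        have := h23 u hu; have := h23 v hv; have := hI u v; grind
      q := ?_ }
  · intro u hu v hv huv α hαu hαv
    obtain ⟨β, hβ⟩ := Finset.card_eq_one.mp (hS3.1 u hu)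
    obtain ⟨γ, hγ⟩ := Finset.card_eq_one.mp (hS3.1 v hv)
    have := hS3.2 u hu v hv huv
    grind
  · intro z hz
    have h2 := h23 z hz
    by_cases hp : ∃ p ∈ P.support, G.Adj z p
    · obtain ⟨p, hp, hzp⟩ := hp
      obtain ⟨α, hα, hαp⟩ := Finset.exists_mem_notMem_of_card_lt_card (s := L p) (t := L z)
        (by rw [hS3.1 p hp]; omega)
      refine ⟨α, hα, fun q hq hzq => ?_⟩
      obtain rfl | hpq := eq_or_ne p q
      · exact hαp
      obtain ⟨a, b, d, f, hs, -⟩ := hG.ends (by omega) P.isChain_adj_support hP.support_nodup hz hp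
        hq hpq hzp hzq
      simp [hs] at hPlen
    · obtain ⟨α, hα⟩ := Finset.card_pos.mp (by omega : 0 < (L z).card)
      exact ⟨α, hα, fun p hp' h => (hp ⟨p, hp', h⟩).elim⟩
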